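/- Let m ≥ 1, n ≥ 1 be integers, d = m + n, and let k ≥ 1 be an integer with k ≥ 2 in the case d = 2. Set s_{d,k} := d/2 − 1/k. There exist δ' > 0 and C > 0, depending only on m, n, k, such that for all dyadic integers N₁ ≥ N₂ ≥ ⋯ ≥ N_{k+1} ≥ 1 and all Fourier data g₁, …, g_{k+1} : ℝ^m×ℤⁿ → ℂ with gⱼ supported in {κ : |κ| ≤ 2Nⱼ, and moreover |κ| ≥ Nⱼ/2 when Nⱼ > 1}, the free waves uⱼ = U₁ gⱼ on ℝ^m×𝕋ⁿ satisfy ‖∏_{j=1}^{k+1} uⱼ‖_{L²([0,1]×ℝ^m×𝕋ⁿ)} ≤ C (N_{k+1}/N₁ + 1/N₂)^{δ'} ‖g₁‖_{L²} ∏_{j=2}^{k+1} Nⱼ^{s_{d,k}} ‖gⱼ‖_{L²}. -/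

import Mathlib

noncomputable section
open MeasureTheory
open scoped ENNReal NNReal Classical

/-- `|k|` for `k = (ζ, j/λ) ∈ ℝ^m × (1/λ)ℤⁿ`. -/
def freqNorm (lam : ℝ) {m n : ℕ} (ζ : Fin m → ℝ) (j : Fin n → ℤ) : ℝ :=
  Real.sqrt ((∑ i, (ζ i) ^ 2) + ∑ i, ((j i : ℝ) / lam) ^ 2)

/-- The free Schrödinger wave `(U_λ g)(t, x, y) = ∫ g(k) e^{i(z·k − t|k|²)} (dk)_λ`
on `ℝ^m × 𝕋ⁿ_λ`, where `g ζ j` stands for `g (ζ, j/λ)`. -/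
def waveU (lam : ℝ) {m n : ℕ} (g : (Fin m → ℝ) → (Fin n → ℤ) → ℂ)
    (t : ℝ) (x : Fin m → ℝ) (y : Fin n → ℝ) : ℂ :=
  ((1 / lam ^ n : ℝ) : ℂ) * ∑' j : Fin n → ℤ, ∫ ζ : Fin m → ℝ,
    g ζ j * Complex.exp (Complex.I *
      ((((∑ i, x i * ζ i) + ∑ i, y i * ((j i : ℝ) / lam))
        - t * ((∑ i, (ζ i) ^ 2) + ∑ i, ((j i : ℝ) / lam) ^ 2) : ℝ) : ℂ))

/-- Squared `L²_λ` norm of Fourier data on `ℝ^m × (1/λ)ℤⁿ`. -/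
def l2sq (lam : ℝ) {m n : ℕ} (g : (Fin m → ℝ) → (Fin n → ℤ) → ℂ) : ℝ≥0∞ :=
  ENNReal.ofReal (1 / lam ^ n) * ∑' j : Fin n → ℤ, ∫⁻ ζ : Fin m → ℝ, (‖g ζ j‖₊ : ℝ≥0∞) ^ 2

/-- `N` is a dyadic integer, i.e. `N ∈ 2^ℕ`. -/
def IsDyadic (N : ℝ) : Prop := ∃ a : ℕ, N = 2 ^ a

/-- `g` is supported in `{k : |k| ≤ 2N, and moreover |k| ≥ N/2 when N > 1}`. -/
def SuppIn (lam : ℝ) {m n : ℕ} (g : (Fin m → ℝ) → (Fin n → ℤ) → ℂ) (N : ℝ) : Prop :=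
  ∀ ζ j, g ζ j ≠ 0 → freqNorm lam ζ j ≤ 2 * N ∧ (1 < N → N / 2 ≤ freqNorm lam ζ j)

/-- One period box of the torus `𝕋ⁿ_λ`. -/
def torusBox (lam : ℝ) (n : ℕ) : Set (Fin n → ℝ) :=
  Set.Icc 0 (fun _ => 2 * Real.pi * lam)

section
open MeasureTheory
open scoped ENNReal NNReal Classical

/-- weight -/
def wt (a : ℝ) : ℝ := if a < -2 then 0 else 8 / Real.sqrt (max a 1)

lemma wt_nonneg (a : ℝ) : 0 ≤ wt a := by
  unfold wt; split_ifs <;> positivity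

lemma wt_le (a : ℝ) : wt a ≤ 8 := by
  unfold wt; split_ifs
  · norm_num
  · have : (1:ℝ) ≤ Real.sqrt (max a 1) := Real.one_le_sqrt.2 (le_max_right _ _)
    rw [div_le_iff₀ (by positivity)]; linarith

lemma wt_le_of {a b : ℝ} (hb : 0 < b) (h : b ≤ a) : wt a ≤ 8 / Real.sqrt b := by
  unfold wt; split_ifs
  · positivity
  · have : Real.sqrt b ≤ Real.sqrt (max a 1) := Real.sqrt_le_sqrt (h.trans (le_max_left _ _))
    have := Real.sqrt_pos.2 hb
    gcongr

lemma wt_zero {a : ℝ} (h : a < -2) : wt a = 0 := by unfold wt; rw [if_pos h]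

lemma sum_inv_sqrt (n : ℕ) : ∑ l ∈ Finset.Icc 1 n, 1 / Real.sqrt (l : ℝ) ≤ 2 * Real.sqrt n := by
  induction n with
  | zero => simp
  | succ k ih =>
    rw [Finset.sum_Icc_succ_top (by omega)]
    have h1 : 1 / Real.sqrt ((k+1 : ℕ) : ℝ) ≤ 2 * Real.sqrt ((k+1 : ℕ) : ℝ) - 2 * Real.sqrt k := by
      have hp : 0 < Real.sqrt ((k+1 : ℕ) : ℝ) := Real.sqrt_pos.2 (by positivity)
      have h2 : Real.sqrt ((k+1 : ℕ) : ℝ) ^ 2 = k + 1 := by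
        rw [Real.sq_sqrt (by positivity)]; push_cast; ring
      have h3 : Real.sqrt (k : ℝ) ^ 2 = k := Real.sq_sqrt (by positivity)
      rw [div_le_iff₀ hp]
      nlinarith [sq_nonneg (Real.sqrt ((k+1 : ℕ) : ℝ) - Real.sqrt k)]
    linarith

lemma sum_int_inv_sqrt (J : Finset ℤ) (j0 : ℤ) (K : ℝ) (hK : 0 ≤ K) (hJ : ∀ j ∈ J, j ≠ j0)
    (hd : ∀ j ∈ J, |((j - j0 : ℤ) : ℝ)| ≤ K) :
    ∑ j ∈ J, 1 / Real.sqrt |((j - j0 : ℤ) : ℝ)| ≤ 4 * Real.sqrt K := by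
  have key : ∀ J' : Finset ℤ, (∀ j ∈ J', j ∈ J) → (Set.InjOn (fun j => (j - j0).natAbs) (J' : Set ℤ)) →
      ∑ j ∈ J', 1 / Real.sqrt |((j - j0 : ℤ) : ℝ)| ≤ 2 * Real.sqrt K := by
    intro J' hs hi
    have h1 : ∑ j ∈ J', 1 / Real.sqrt |((j - j0 : ℤ) : ℝ)| =
        ∑ l ∈ J'.image (fun j => (j - j0).natAbs), 1 / Real.sqrt (l : ℝ) := by
      rw [Finset.sum_image hi]
      refine Finset.sum_congr rfl fun j _ => ?_
      rw [Nat.cast_natAbs, Int.cast_abs]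
    rw [h1]
    calc _ ≤ ∑ l ∈ Finset.Icc 1 ⌊K⌋₊, 1 / Real.sqrt (l : ℝ) := by
          apply Finset.sum_le_sum_of_subset_of_nonneg
          · intro l hl
            obtain ⟨j, hj, rfl⟩ := Finset.mem_image.1 hl
            rw [Finset.mem_Icc]
            constructor
            · have := hJ j (hs j hj); omega
            · apply Nat.le_floor
              rw [Nat.cast_natAbs, Int.cast_abs]
              exact hd j (hs j hj)
          · intros; positivity
      _ ≤ 2 * Real.sqrt ⌊K⌋₊ := sum_inv_sqrt _
      _ ≤ 2 * Real.sqrt K := by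
          gcongr; exact Nat.floor_le hK
  rw [← Finset.sum_filter_add_sum_filter_not J (fun j => j0 < j)]
  have h1 := key (J.filter (fun j => j0 < j)) (fun j hj => (Finset.mem_filter.1 hj).1) (by
    intro a ha b hb hab
    simp at ha hb hab; omega)
  have h2 := key (J.filter (fun j => ¬ j0 < j)) (fun j hj => (Finset.mem_filter.1 hj).1) (by
    intro a ha b hb hab
    simp at ha hb hab; omega)
  linarith

lemma lemS (J : Finset ℤ) (hne : J.Nonempty) (a : ℤ → ℝ) (ρ K : ℝ) (hρ : 4 ≤ ρ) (hK : 0 ≤ K)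
    (hsep : ∀ i ∈ J, ∀ j ∈ J, ρ * |((i - j : ℤ) : ℝ)| ≤ |a i - a j|)
    (hdiam : ∀ i ∈ J, ∀ j ∈ J, |((i - j : ℤ) : ℝ)| ≤ K)
    (ha : ∀ j ∈ J, -2 ≤ a j) :
    ∃ j0 ∈ J, ∑ j ∈ J, wt (a j) ≤ wt (a j0) + 48 * Real.sqrt (K / ρ) := by
  obtain ⟨j0, hj0, hmin⟩ := Finset.exists_min_image J a hne
  refine ⟨j0, hj0, ?_⟩
  rw [← Finset.add_sum_erase J _ hj0]
  gcongr
  have h1 : ∀ j ∈ J.erase j0, wt (a j) ≤ 12 / Real.sqrt ρ * (1 / Real.sqrt |((j - j0 : ℤ) : ℝ)|) := by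
    intro j hj
    obtain ⟨hne', hjJ⟩ := Finset.mem_erase.1 hj
    have h2 := hsep j hjJ j0 hj0
    rw [abs_of_nonneg (sub_nonneg.2 (hmin j hjJ))] at h2
    have h3 : (1:ℝ) ≤ |((j - j0 : ℤ) : ℝ)| := by
      rw [← Int.cast_abs]; exact_mod_cast Int.one_le_abs (sub_ne_zero.2 hne')
    have h4 : (ρ / 2) * |((j - j0 : ℤ) : ℝ)| ≤ a j := by
      have := ha j0 hj0
      nlinarith
    have h5 := wt_le_of (by positivity) h4
    refine h5.trans ?_
    rw [Real.sqrt_mul (by positivity), Real.sqrt_div (by positivity)]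
    have h6 : Real.sqrt 2 ≤ 3/2 := by
      rw [Real.sqrt_le_left (by norm_num)]; norm_num
    have hp : 0 < Real.sqrt ρ := Real.sqrt_pos.2 (by linarith)
    have hq : 0 < Real.sqrt |((j - j0 : ℤ) : ℝ)| := Real.sqrt_pos.2 (by linarith)
    rw [div_mul_div_comm, mul_one, div_le_div_iff₀ (by positivity) (by positivity)]
    have : 12 * (Real.sqrt ρ / Real.sqrt 2 * Real.sqrt |((j - j0 : ℤ) : ℝ)|) =
       (12 / Real.sqrt 2) * (Real.sqrt ρ * Real.sqrt |((j - j0 : ℤ) : ℝ)|) := by ring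
    rw [this]
    gcongr
    rw [le_div_iff₀ (by positivity)]; linarith
  calc _ ≤ ∑ j ∈ J.erase j0, 12 / Real.sqrt ρ * (1 / Real.sqrt |((j - j0 : ℤ) : ℝ)|) :=
        Finset.sum_le_sum h1
    _ = 12 / Real.sqrt ρ * ∑ j ∈ J.erase j0, (1 / Real.sqrt |((j - j0 : ℤ) : ℝ)|) := by
        rw [Finset.mul_sum]
    _ ≤ 12 / Real.sqrt ρ * (4 * Real.sqrt K) := by
        gcongr
        refine sum_int_inv_sqrt _ _ _ hK ?_ ?_
        · intro j hj; exact (Finset.mem_erase.1 hj).1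
        · intro j hj; exact hdiam j (Finset.mem_erase.1 hj).2 j0 hj0
    _ = 48 * Real.sqrt (K / ρ) := by
        rw [Real.sqrt_div hK]; ring

/-- integers in a set of diameter at most `L`. -/
lemma card_int_le (J : Finset ℤ) (L : ℝ) (hL : 0 ≤ L)
    (hd : ∀ i ∈ J, ∀ j ∈ J, ((i - j : ℤ) : ℝ) ≤ L) : (J.card : ℝ) ≤ L + 1 := by
  rcases J.eq_empty_or_nonempty with rfl | hne
  · simp; linarith
  obtain ⟨j0, hj0, hmin⟩ := Finset.exists_min_image J id hne
  have : J ⊆ Finset.Icc j0 (j0 + ⌊L⌋) := by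
    intro j hj
    rw [Finset.mem_Icc]
    refine ⟨hmin j hj, ?_⟩
    have : j - j0 ≤ ⌊L⌋ := Int.le_floor.2 (hd j hj j0 hj0)
    omega
  have h2 := Finset.card_le_card this
  rw [Int.card_Icc] at h2
  have h3 : (0:ℤ) ≤ ⌊L⌋ := Int.floor_nonneg.2 hL
  have h4 : ((J.card : ℤ)) ≤ ⌊L⌋ + 1 := by omega
  have h5 : ((J.card : ℤ) : ℝ) ≤ ((⌊L⌋ + 1 : ℤ) : ℝ) := by exact_mod_cast h4
  push_cast at h5
  have := Int.floor_le L
  linarith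

/-- one-sided part of the F2 estimate -/
lemma F2_side (J : Finset ℤ) (c R : ℝ) (s r : ℝ) (hs : s = 1 ∨ s = -1) (hr : 10 ≤ r) (hrR : r ^ 2 = R + 2)
    (hJ : ∀ j ∈ J, r / 2 ≤ s * ((j : ℝ) - c) ∧ s * ((j:ℝ) - c) ≤ r) :
    ∑ j ∈ J, wt (R - ((j : ℝ) - c) ^ 2) ≤ 56 := by
  rcases J.eq_empty_or_nonempty with rfl | hne
  · simp
  have hs2 : s ^ 2 = 1 := by rcases hs with rfl | rfl <;> norm_num
  have hsa : |s| = 1 := by rcases hs with rfl | rfl <;> norm_num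
  have hdiam : ∀ i ∈ J, ∀ j ∈ J, |((i - j : ℤ) : ℝ)| ≤ r := by
    intro i hi j hj
    have h1 := hJ i hi
    have h2 := hJ j hj
    have : |((i - j : ℤ) : ℝ)| = |s * ((i:ℝ) - c) - s * ((j:ℝ) - c)| := by
      rw [← mul_sub, abs_mul, hsa]; push_cast; ring_nf
    rw [this, abs_le]; constructor <;> linarith
  obtain ⟨j0, hj0, h⟩ := lemS J hne (fun j => R - ((j : ℝ) - c) ^ 2) r r (by linarith) (by linarith)
    (by
      intro i hi j hj
      have h1 := hJ i hi
      have h2 := hJ j hj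
      have : (R - ((i : ℝ) - c) ^ 2) - (R - ((j : ℝ) - c) ^ 2) =
        - (((i - j : ℤ) : ℝ) * s * (s * ((i:ℝ) - c) + s * ((j:ℝ) - c))) := by
        push_cast
        linear_combination (-(((i:ℝ) - c) ^ 2) + ((j : ℝ) - c) ^ 2) * (-hs2)
      simp only [this]
      rw [abs_neg, abs_mul, abs_mul, hsa, mul_one, mul_comm]
      gcongr
      refine le_trans ?_ (le_abs_self _)
      linarith) hdiam
    (by
      intro j hj
      have h2 := hJ j hj
      have : ((j:ℝ) - c) ^ 2 = (s * ((j:ℝ) - c)) ^ 2 := by rw [mul_pow, hs2, one_mul]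
      have h3 : (s * ((j:ℝ) - c)) ^ 2 ≤ r ^ 2 := by
        apply pow_le_pow_left₀ _ h2.2; linarith
      rw [this]; linarith)
  refine h.trans ?_
  rw [div_self (by linarith), Real.sqrt_one]
  have := wt_le (R - ((j0 : ℝ) - c) ^ 2)
  linarith

lemma F2 (J : Finset ℤ) (c R : ℝ) : ∑ j ∈ J, wt (R - ((j : ℝ) - c) ^ 2) ≤ 200 := by
  by_cases hR : R < -2
  · rw [Finset.sum_eq_zero]
    · norm_num
    · intro j _; apply wt_zero; nlinarith [sq_nonneg ((j:ℝ) - c)]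
  push Not at hR
  set r := Real.sqrt (R + 2) with hr
  have hr2 : r ^ 2 = R + 2 := Real.sq_sqrt (by linarith)
  have hr0 : 0 ≤ r := Real.sqrt_nonneg _
  have hfilt : ∑ j ∈ J, wt (R - ((j : ℝ) - c) ^ 2) =
      ∑ j ∈ J.filter (fun j : ℤ => |(j : ℝ) - c| ≤ r), wt (R - ((j : ℝ) - c) ^ 2) := by
    symm
    apply Finset.sum_filter_of_ne
    intro j _ hj
    by_contra hcon
    push Not at hcon
    apply hj
    apply wt_zero
    have : r ^ 2 < |(j:ℝ) - c| ^ 2 := pow_lt_pow_left₀ hcon hr0 (by norm_num)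
    rw [sq_abs] at this; linarith
  rw [hfilt]
  set J' := J.filter (fun j : ℤ => |(j : ℝ) - c| ≤ r)
  have hJ' : ∀ j ∈ J', |(j : ℝ) - c| ≤ r := fun j hj => (Finset.mem_filter.1 hj).2
  by_cases h10 : r ≤ 10
  · have hc := card_int_le J' 20 (by norm_num) (by
      intro i hi j hj
      have h1 := abs_le.1 (hJ' i hi)
      have h2 := abs_le.1 (hJ' j hj)
      push_cast; linarith)
    have h8 : ∑ j ∈ J', wt (R - ((j : ℝ) - c) ^ 2) ≤ J'.card • (8:ℝ) :=
      Finset.sum_le_card_nsmul _ _ _ (fun j _ => wt_le _)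
    rw [nsmul_eq_mul] at h8
    linarith
  push Not at h10
  rw [← Finset.sum_filter_add_sum_filter_not J' (fun j : ℤ => |(j : ℝ) - c| ≤ r / 2)]
  rw [← Finset.sum_filter_add_sum_filter_not (J'.filter (fun j : ℤ => ¬ |(j : ℝ) - c| ≤ r / 2)) (fun j : ℤ => c < j)]
  have A : ∑ j ∈ J'.filter (fun j : ℤ => |(j : ℝ) - c| ≤ r / 2), wt (R - ((j : ℝ) - c) ^ 2) ≤ 24 := by
    have hb : ∀ j ∈ J'.filter (fun j : ℤ => |(j : ℝ) - c| ≤ r / 2), wt (R - ((j : ℝ) - c) ^ 2) ≤ 16 / r := by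
      intro j hj
      have h1 := (Finset.mem_filter.1 hj).2
      have h2 : ((j:ℝ) - c) ^ 2 ≤ (r / 2) ^ 2 := by
        rw [← sq_abs]; exact pow_le_pow_left₀ (abs_nonneg _) h1 2
      have h3 : (r/2)^2 ≤ R - ((j:ℝ) - c)^2 := by nlinarith
      refine (wt_le_of (by positivity) h3).trans ?_
      rw [Real.sqrt_sq (by linarith)]
      apply le_of_eq; field_simp; norm_num
    have hc := card_int_le (J'.filter (fun j : ℤ => |(j : ℝ) - c| ≤ r / 2)) r hr0 (by
      intro i hi j hj
      have h1 := abs_le.1 (Finset.mem_filter.1 hi).2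
      have h2 := abs_le.1 (Finset.mem_filter.1 hj).2
      push_cast; linarith)
    have h8 := Finset.sum_le_card_nsmul _ _ _ hb
    rw [nsmul_eq_mul] at h8
    refine h8.trans ?_
    rw [mul_div_assoc', div_le_iff₀ (by linarith)]
    nlinarith
  have B := F2_side ((J'.filter (fun j : ℤ => ¬ |(j : ℝ) - c| ≤ r / 2)).filter (fun j : ℤ => c < j)) c R 1 r
    (Or.inl rfl) h10.le hr2 (by
      intro j hj
      simp only [Finset.mem_filter] at hj
      obtain ⟨⟨h1, h2⟩, h3⟩ := hj
      have h4 := hJ' j h1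
      rw [abs_of_pos (by linarith)] at h2 h4
      push Not at h2
      constructor <;> linarith)
  have C := F2_side ((J'.filter (fun j : ℤ => ¬ |(j : ℝ) - c| ≤ r / 2)).filter (fun j : ℤ => ¬ c < j)) c R (-1) r
    (Or.inr rfl) h10.le hr2 (by
      intro j hj
      simp only [Finset.mem_filter] at hj
      obtain ⟨⟨h1, h2⟩, h3⟩ := hj
      have h4 := hJ' j h1
      rw [abs_of_nonpos (by linarith)] at h2 h4
      push Not at h2
      constructor <;> linarith)
  linarith

end

section
open MeasureTheory
open scoped ENNReal NNReal Classical

lemma card_le_real {α β : Type*} [DecidableEq β] (s : Finset α) (f : α → β) (B : ℝ)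
    (h : ∀ b ∈ s.image f, ((s.filter (fun x => f x = b)).card : ℝ) ≤ B) :
    (s.card : ℝ) ≤ B * (s.image f).card := by
  have := Finset.card_eq_sum_card_image f s
  rw [this]
  push_cast
  calc _ ≤ ∑ b ∈ s.image f, B := Finset.sum_le_sum (fun b hb => h b hb)
    _ = _ := by rw [Finset.sum_const, nsmul_eq_mul, mul_comm]

lemma tri_aux (a b c : ℝ) : |2 * c| ≤ |a + b - 2 * c| + |a| + |b| := by
  rcases abs_cases (2 * c) with h1 | h1 <;> rcases abs_cases (a + b - 2 * c) with h2 | h2 <;>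
  rcases abs_cases a with h3 | h3 <;> rcases abs_cases b with h4 | h4 <;> linarith

lemma quad_diff {β h j h' j' c1 c2 v1 v2 : ℝ} (hv : v1 ≠ 0) (hl : v1 * h' + β * v2 * j' = v1 * h + β * v2 * j) :
    ((h' - c1)^2 + β * (j' - c2)^2) - ((h - c1)^2 + β * (j - c2)^2) =
      (h' - h)^2 + β * (j' - j)^2 + 2 * β * (j' - j) * (((j - c2) * v1 - v2 * (h - c1)) / v1) := by
  have : h' - h = - (β * v2 * (j' - j)) / v1 := by
    rw [eq_div_iff hv]; linarith
  have h2 : h' = h + - (β * v2 * (j' - j)) / v1 := by linarith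
  subst h2
  field_simp
  ring

lemma line_card (β : ℝ) (hβ : 1 ≤ β) (c1 c2 R L v1 v2 l : ℝ) (hL : 0 ≤ L) (hv : 0 < v1) (P : Finset (ℤ × ℤ))
    (hQ : ∀ p ∈ P, R ≤ ((p.1:ℝ) - c1)^2 + β * ((p.2:ℝ) - c2)^2 ∧
      ((p.1:ℝ) - c1)^2 + β * ((p.2:ℝ) - c2)^2 ≤ R + L)
    (hl : ∀ p ∈ P, v1 * (p.1:ℝ) + β * v2 * (p.2:ℝ) = l) :
    (P.card : ℝ) ≤ 2 * (L + 1) := by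
  have inj : ∀ p ∈ P, ∀ q ∈ P, p.2 = q.2 → p = q := by
    intro p hp q hq h
    have h1 := hl p hp
    have h2 := hl q hq
    rw [h] at h1
    have h3 : v1 * ((p.1:ℝ) - q.1) = 0 := by linarith
    have h4 : (p.1:ℝ) - q.1 = 0 := by
      rcases mul_eq_zero.1 h3 with h | h
      · linarith
      · exact h
    ext
    · have : (p.1:ℝ) = q.1 := by linarith
      exact_mod_cast this
    · exact h
  have side : ∀ P' ⊆ P, (∀ p ∈ P', ∀ q ∈ P', ((p.2 - q.2 : ℤ):ℝ) ≤ L) → (P'.card : ℝ) ≤ L + 1 := by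
    intro P' hs hd
    have : P'.card = (P'.image Prod.snd).card := by
      rw [Finset.card_image_of_injOn]
      intro p hp q hq h
      exact inj p (hs hp) q (hs hq) h
    rw [this]
    apply card_int_le _ _ hL
    intro i hi j hj
    obtain ⟨p, hp, rfl⟩ := Finset.mem_image.1 hi
    obtain ⟨q, hq, rfl⟩ := Finset.mem_image.1 hj
    exact hd p hp q hq
  have intsq : ∀ d : ℤ, (d:ℝ) ≤ (d:ℝ)^2 := by
    intro d
    have : d ≤ d^2 := Int.le_self_sq d
    exact_mod_cast this
  have h1 := side (P.filter (fun p => 0 ≤ (((p.2:ℝ) - c2) * v1 - v2 * ((p.1:ℝ) - c1)))) (Finset.filter_subset _ _) (by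
    intro p hp q hq
    obtain ⟨hp, hps⟩ := Finset.mem_filter.1 hp
    obtain ⟨hq, hqs⟩ := Finset.mem_filter.1 hq
    by_cases hd : p.2 - q.2 ≤ 0
    · have : ((p.2 - q.2 : ℤ):ℝ) ≤ 0 := by exact_mod_cast hd
      linarith
    push Not at hd
    have hd' : (0:ℝ) < ((p.2 - q.2 : ℤ):ℝ) := by exact_mod_cast hd
    have e := quad_diff (c1 := c1) (c2 := c2) hv.ne' ((hl p hp).trans (hl q hq).symm)
    have h1 := hQ p hp
    have h2 := hQ q hq
    have h3 : 0 ≤ (((q.2:ℝ) - c2) * v1 - v2 * ((q.1:ℝ) - c1)) / v1 := by positivity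
    have h4 := intsq (p.2 - q.2)
    push_cast at h4 hd' ⊢
    have h5 : 0 ≤ 2 * β * ((p.2:ℝ) - q.2) * ((((q.2:ℝ) - c2) * v1 - v2 * ((q.1:ℝ) - c1)) / v1) := by positivity
    nlinarith [sq_nonneg ((p.1:ℝ) - q.1)])
  have h2 := side (P.filter (fun p => ¬ 0 ≤ (((p.2:ℝ) - c2) * v1 - v2 * ((p.1:ℝ) - c1)))) (Finset.filter_subset _ _) (by
    intro p hp q hq
    obtain ⟨hp, hps⟩ := Finset.mem_filter.1 hp
    obtain ⟨hq, hqs⟩ := Finset.mem_filter.1 hq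
    push Not at hps hqs
    by_cases hd : p.2 - q.2 ≤ 0
    · have : ((p.2 - q.2 : ℤ):ℝ) ≤ 0 := by exact_mod_cast hd
      linarith
    push Not at hd
    have hd' : (0:ℝ) < ((p.2 - q.2 : ℤ):ℝ) := by exact_mod_cast hd
    have e := quad_diff (c1 := c1) (c2 := c2) hv.ne' ((hl q hq).trans (hl p hp).symm)
    have h1 := hQ p hp
    have h2 := hQ q hq
    have h3 : (((p.2:ℝ) - c2) * v1 - v2 * ((p.1:ℝ) - c1)) / v1 ≤ 0 :=
      div_nonpos_of_nonpos_of_nonneg hps.le hv.le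
    have h4 := intsq (p.2 - q.2)
    push_cast at h4 hd' ⊢
    have h5 : 0 ≤ 2 * β * ((q.2:ℝ) - p.2) * ((((p.2:ℝ) - c2) * v1 - v2 * ((p.1:ℝ) - c1)) / v1) := by
      apply mul_nonneg_of_nonpos_of_nonpos _ h3
      nlinarith
    nlinarith [sq_nonneg ((p.1:ℝ) - q.1)])
  rw [← Finset.card_filter_add_card_filter_not (s := P) (fun p => 0 ≤ (((p.2:ℝ) - c2) * v1 - v2 * ((p.1:ℝ) - c1)))]
  push_cast
  linarith

/-- pairs with a given difference -/
lemma diff_card (β : ℕ) (hβ : 1 ≤ β) (c1 c2 R L : ℝ) (hL : 0 ≤ L) (v : ℤ × ℤ) (hv : 1 ≤ v.1) (P : Finset (ℤ × ℤ))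
    (hQ : ∀ p ∈ P, (R ≤ ((p.1:ℝ) - c1)^2 + β * ((p.2:ℝ) - c2)^2 ∧
      ((p.1:ℝ) - c1)^2 + β * ((p.2:ℝ) - c2)^2 ≤ R + L) ∧
      (R ≤ ((p.1:ℝ) + v.1 - c1)^2 + β * ((p.2:ℝ) + v.2 - c2)^2 ∧
      ((p.1:ℝ) + v.1 - c1)^2 + β * ((p.2:ℝ) + v.2 - c2)^2 ≤ R + L)) :
    (P.card : ℝ) ≤ 2 * (L + 1) * (L + 1) := by
  have hβ' : (1:ℝ) ≤ β := by exact_mod_cast hβ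
  have h1 := card_le_real P (fun p => v.1 * p.1 + β * v.2 * p.2) (2 * (L + 1)) (by
    intro l _
    apply line_card β hβ' c1 c2 R L v.1 v.2 l hL (by exact_mod_cast hv)
    · intro p hp
      exact (hQ p (Finset.mem_filter.1 hp).1).1
    · intro p hp
      have := (Finset.mem_filter.1 hp).2
      rw [← this]; push_cast; ring)
  refine h1.trans ?_
  gcongr
  apply card_int_le _ _ hL
  intro i hi j hj
  obtain ⟨p, hp, rfl⟩ := Finset.mem_image.1 hi
  obtain ⟨q, hq, rfl⟩ := Finset.mem_image.1 hj
  obtain ⟨⟨a1, a2⟩, a3, a4⟩ := hQ p hp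
  obtain ⟨⟨b1, b2⟩, b3, b4⟩ := hQ q hq
  push_cast
  nlinarith

lemma slope_aux (β : ℝ) (hβ' : 1 ≤ β) (hβ3' : β ≤ 3) (c1 c2 R N H : ℝ) (hN : 1 ≤ N) (hH : 1 ≤ H) (hHN1 : H ≤ N)
    (hHD : H * N ≤ |c2|) (hD : 100 * N ≤ |c2|) (hc : |c1| ≤ |c2|) (v1 v2 h j : ℝ)
    (a1 : R - H ≤ (h - c1) ^ 2 + β * (j - c2) ^ 2)
    (a2 : (h - c1) ^ 2 + β * (j - c2) ^ 2 ≤ R + 2)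
    (b1 : R - H ≤ (h + v1 - c1) ^ 2 + β * (j + v2 - c2) ^ 2)
    (b2 : (h + v1 - c1) ^ 2 + β * (j + v2 - c2) ^ 2 ≤ R + 2)
    (bp : |h| ≤ 4 * N ∧ |j| ≤ 4 * N)
    (bq : |h + v1| ≤ 4 * N ∧ |j + v2| ≤ 4 * N) (v1pos' : 1 ≤ v1) (v1le : v1 ≤ H) :
    |v2 - (-(c1 / (β * c2)) * v1)| ≤ 78 := by
  have hDpos : 0 < |c2| := by linarith
  have hc2 : c2 ≠ 0 := abs_pos.1 hDpos
  set e := 2 * v1 * (h - c1) + v1^2 + (2 * β * v2 * (j - c2) + β * v2^2) with he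
  have hee : |e| ≤ H + 2 := by rw [abs_le]; constructor <;> nlinarith
  have hv1a : |v1| ≤ H := by rw [abs_of_pos (by linarith)]; exact v1le
  have hv2a : |v2| ≤ 8 * N := by
    have : v2 = (j + v2) - j := by ring
    rw [this]
    refine (abs_sub _ _).trans ?_
    linarith [bp.2, bq.2]
  have hHH : H^2 ≤ H * |c2| := by nlinarith
  -- first bound on v2
  have k1 : |c2| ≤ |2 * (j - c2) + v2| := by
    have e1 : |2 * c2| ≤ |2 * (j - c2) + v2| + |j| + |j + v2| := by
      have := tri_aux j (j + v2) c2
      rwa [show j + (j + v2) - 2 * c2 = 2 * (j - c2) + v2 by ring] at this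
    rw [abs_mul, abs_two] at e1
    linarith [bp.2, bq.2]
  have k2 : |v2| * |c2| ≤ 4 * H * |c2| := by
    have : v2 * (2 * (j - c2) + v2) * β = e - v1 * (2 * (h - c1) + v1) := by rw [he]; ring
    have h3 : |v2| * |2 * (j - c2) + v2| * β ≤ |e| + |v1| * |2 * (h - c1) + v1| := by
      have := congrArg abs this
      rw [abs_mul, abs_mul, abs_of_pos (by linarith : (0:ℝ) < β)] at this
      rw [this]
      refine (abs_sub _ _).trans ?_
      rw [abs_mul]
    have h4 : |2 * (h - c1) + v1| ≤ 8 * N + 2 * |c2| := by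
      have : 2 * (h - c1) + v1 = h + (h + v1) - 2 * c1 := by ring
      rw [this]
      refine (abs_sub _ _).trans ?_
      have := abs_add_le h (h + v1)
      rw [abs_mul, abs_two]
      linarith [bp.1, bq.1]
    have h5 : |v2| * |c2| * 1 ≤ |v2| * |2 * (j - c2) + v2| * β := by gcongr
    have h6 : |v1| * |2 * (h - c1) + v1| ≤ H * (8 * N + 2 * |c2|) := by gcongr
    have h7 : H * (8 * N) ≤ H * |c2| := by gcongr; linarith
    have h8 : H + 2 ≤ H * |c2| := by
      have : H * 3 ≤ H * |c2| := by gcongr; linarith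
      linarith
    have h9 : H * (8 * N + 2 * |c2|) = H * (8 * N) + 2 * (H * |c2|) := by ring
    linarith
  have k3 : |v2| ≤ 4 * H := le_of_mul_le_mul_right k2 hDpos
  -- second
  have k4 : |2 * β * v2 * c2 + 2 * v1 * c1| ≤ 156 * (H * N) := by
    have : 2 * β * v2 * c2 + 2 * v1 * c1 = v1 * (2 * h) + v1 * v1 + β * (v2 * (2 * j)) + β * (v2 * v2) - e := by
      rw [he]; ring
    rw [this]
    refine (abs_sub _ _).trans ?_
    have t1 : |v1 * (2 * h)| ≤ H * (2 * (4 * N)) := by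
      rw [abs_mul, abs_mul, abs_two]; gcongr; exact bp.1
    have t2 : |v1 * v1| ≤ H * N := by
      rw [abs_mul]; gcongr; linarith
    have t3 : |β * (v2 * (2 * j))| ≤ 3 * ((4 * H) * (2 * (4 * N))) := by
      rw [abs_mul, abs_mul, abs_mul, abs_two, abs_of_pos (by linarith : (0:ℝ) < β)]; gcongr; exact bp.2
    have t4 : |β * (v2 * v2)| ≤ 3 * ((4 * H) * (4 * N)) := by
      rw [abs_mul, abs_mul, abs_of_pos (by linarith : (0:ℝ) < β)]; gcongr
      linarith
    have t5 := abs_add_le (v1 * (2 * h) + v1 * v1 + β * (v2 * (2 * j))) (β * (v2 * v2))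
    have t6 := abs_add_le (v1 * (2 * h) + v1 * v1) (β * (v2 * (2 * j)))
    have t7 := abs_add_le (v1 * (2 * h)) (v1 * v1)
    have t8 : H ≤ H * N := le_mul_of_one_le_right (by linarith) hN
    have t9 : 1 ≤ H * N := by linarith
    have e3 : H * (2 * (4 * N)) = 8 * (H * N) := by ring
    have e4 : 3 * ((4 * H) * (2 * (4 * N))) = 96 * (H * N) := by ring
    have e5 : 3 * ((4 * H) * (4 * N)) = 48 * (H * N) := by ring
    linarith
  have k5 : v2 - (-(c1 / (β * c2)) * v1) = (2 * β * v2 * c2 + 2 * v1 * c1) / (2 * β * c2) := by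
    field_simp
    ring
  rw [k5, abs_div, div_le_iff₀ (by positivity)]
  rw [abs_mul, abs_mul, abs_two, abs_of_pos (by linarith : (0:ℝ) < β)]
  have : 1 * |c2| ≤ β * |c2| := by gcongr
  linarith

lemma Pcount (β : ℕ) (hβ : 1 ≤ β) (hβ3 : β ≤ 3) (c1 c2 R N H : ℝ) (hN : 1 ≤ N) (hH : 1 ≤ H) (hHN : H^4 ≤ N)
    (hHD : H * N ≤ |c2|) (hD : 100 * N ≤ |c2|) (hc : |c1| ≤ |c2|) (P : Finset (ℤ × ℤ))
    (hbox : ∀ p ∈ P, |(p.1:ℝ)| ≤ 4 * N ∧ |(p.2:ℝ)| ≤ 4 * N)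
    (hQ : ∀ p ∈ P, R - H ≤ ((p.1:ℝ) - c1)^2 + β * ((p.2:ℝ) - c2)^2 ∧
      ((p.1:ℝ) - c1)^2 + β * ((p.2:ℝ) - c2)^2 ≤ R + 2) :
    (P.card : ℝ) ≤ 20000 * (N / H) := by
  have hβ' : (1:ℝ) ≤ β := by exact_mod_cast hβ
  have hβ3' : (β:ℝ) ≤ 3 := by exact_mod_cast hβ3
  have hHN1 : H ≤ N := le_trans (le_self_pow₀ hH (by norm_num)) hHN
  have hDpos : 0 < |c2| := by linarith
  have hc2 : c2 ≠ 0 := abs_pos.1 hDpos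
  -- uniqueness
  have uniq : ∀ p ∈ P, ∀ q ∈ P, p.1 = q.1 → p = q := by
    intro p hp q hq h
    obtain ⟨a1, a2⟩ := hQ p hp
    obtain ⟨b1, b2⟩ := hQ q hq
    ext
    · exact h
    by_contra hne
    have h3 : (1:ℝ) ≤ |(p.2:ℝ) - q.2| := by
      have : (1:ℤ) ≤ |p.2 - q.2| := Int.one_le_abs (sub_ne_zero.2 hne)
      exact_mod_cast this
    rw [h] at a1 a2
    have h4 : |β * (((p.2:ℝ) - q.2) * (p.2 + q.2 - 2 * c2))| ≤ H + 2 := by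
      rw [abs_le]; constructor <;> nlinarith
    rw [abs_mul, abs_mul, abs_of_pos (by linarith : (0:ℝ) < β)] at h4
    have h5 : |c2| ≤ |(p.2:ℝ) + q.2 - 2 * c2| := by
      have e1 : |2 * c2| ≤ |(p.2:ℝ) + q.2 - 2 * c2| + |(p.2:ℝ)| + |(q.2:ℝ)| := by
        exact tri_aux _ _ _
      rw [abs_mul, abs_two] at e1
      have := (hbox p hp).2
      have := (hbox q hq).2
      linarith
    have h6 : 1 * (1 * |c2|) ≤ β * (|(p.2:ℝ) - q.2| * |(p.2:ℝ) + q.2 - 2 * c2|) := by gcongr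
    linarith
  set P' := P.filter (fun p => ∃ q ∈ P, 1 ≤ q.1 - p.1 ∧ ((q.1 - p.1 : ℤ):ℝ) ≤ H) with hP'
  rw [← Finset.card_filter_add_card_filter_not (s := P) (fun p => ∃ q ∈ P, 1 ≤ q.1 - p.1 ∧ ((q.1 - p.1 : ℤ):ℝ) ≤ H)]
  rw [Nat.cast_add]
  -- separated part
  have hsep : ((P.filter (fun p => ¬ ∃ q ∈ P, 1 ≤ q.1 - p.1 ∧ ((q.1 - p.1 : ℤ):ℝ) ≤ H)).card : ℝ) ≤ 8 * N / H + 2 := by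
    set P'' := P.filter (fun p => ¬ ∃ q ∈ P, 1 ≤ q.1 - p.1 ∧ ((q.1 - p.1 : ℤ):ℝ) ≤ H)
    have : P''.card = (P''.image (fun p => ⌊(p.1:ℝ) / H⌋)).card := by
      rw [Finset.card_image_of_injOn]
      have aux : ∀ p ∈ P'', ∀ q ∈ P'', ⌊(p.1:ℝ) / H⌋ = ⌊(q.1:ℝ) / H⌋ → ¬ p.1 < q.1 := by
        intro p hp q hq h hlt
        obtain ⟨hp, hp2⟩ := Finset.mem_filter.1 hp
        obtain ⟨hq, hq2⟩ := Finset.mem_filter.1 hq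
        apply hp2
        refine ⟨q, hq, by omega, ?_⟩
        have h1 := Int.floor_le ((p.1:ℝ) / H)
        have h2 := Int.lt_floor_add_one ((q.1:ℝ) / H)
        rw [← h] at h2
        have h3 : ((q.1:ℝ) / H) - (p.1:ℝ) / H < 1 := by linarith
        rw [← sub_div, div_lt_one (by linarith)] at h3
        push_cast; exact h3.le
      intro p hp q hq h
      have h1 := aux p hp q hq h
      have h2 := aux q hq p hp h.symm
      exact uniq p (Finset.mem_filter.1 hp).1 q (Finset.mem_filter.1 hq).1 (by omega)
    rw [this]
    have : 8 * N / H + 2 = (8 * N / H + 1) + 1 := by ring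
    rw [this]
    apply card_int_le _ _ (by positivity)
    intro i hi j hj
    obtain ⟨p, hp, rfl⟩ := Finset.mem_image.1 hi
    obtain ⟨q, hq, rfl⟩ := Finset.mem_image.1 hj
    have h1 := Int.floor_le ((p.1:ℝ) / H)
    have h2 := Int.lt_floor_add_one ((q.1:ℝ) / H)
    have h3 := abs_le.1 (hbox p (Finset.mem_filter.1 hp).1).1
    have h4 := abs_le.1 (hbox q (Finset.mem_filter.1 hq).1).1
    have h5 : (p.1:ℝ) / H - q.1 / H ≤ 8 * N / H := by
      rw [← sub_div]; gcongr; linarith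
    push_cast
    linarith
  -- clustered part
  have hclu : (P'.card : ℝ) ≤ (2 * (H + 2 + 1) * (H + 2 + 1)) * (157 * (H + 1)) := by
    have hch : ∀ p : ℤ × ℤ, ∃ v : ℤ × ℤ, p ∈ P' → (1 ≤ v.1 ∧ (v.1:ℝ) ≤ H ∧ (p.1 + v.1, p.2 + v.2) ∈ P) := by
      intro p
      by_cases hp : p ∈ P'
      · obtain ⟨_, q, hq, h1, h2⟩ := Finset.mem_filter.1 hp
        exact ⟨(q.1 - p.1, q.2 - p.2), fun _ => ⟨h1, h2, by simpa using hq⟩⟩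
      · exact ⟨0, fun h => absurd h hp⟩
    choose f hf using hch
    have hsub : ∀ p ∈ P', p ∈ P := fun p hp => (Finset.mem_filter.1 hp).1
    have h1 := card_le_real P' f (2 * (H + 2 + 1) * (H + 2 + 1)) (by
      intro v hv
      obtain ⟨p0, hp0, rfl⟩ := Finset.mem_image.1 hv
      apply diff_card β hβ c1 c2 (R - H) (H + 2) (by linarith) (f p0) (hf p0 hp0).1
      intro p hp
      obtain ⟨hp, hpv⟩ := Finset.mem_filter.1 hp
      obtain ⟨a1, a2⟩ := hQ p (hsub p hp)
      obtain ⟨b1, b2⟩ := hQ _ (hf p hp).2.2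
      rw [hpv] at b1 b2
      push_cast at b1 b2
      refine ⟨⟨a1, by linarith⟩, b1, by linarith⟩)
    refine h1.trans ?_
    gcongr
    -- count differences
    have h2 := card_le_real (P'.image f) Prod.fst 157 (by
      intro w hw
      have hst : ∀ v ∈ (P'.image f).filter (fun x => x.1 = w), |(v.2:ℝ) - (-(c1 / (β * c2)) * w)| ≤ 78 := by
        intro v hv
        obtain ⟨hv', rfl⟩ := Finset.mem_filter.1 hv
        clear hv
        obtain ⟨p, hp, rfl⟩ := Finset.mem_image.1 hv'
        obtain ⟨v1pos, v1le, hq⟩ := hf p hp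
        obtain ⟨a1, a2⟩ := hQ p (hsub p hp)
        obtain ⟨b1, b2⟩ := hQ _ hq
        have bp := hbox p (hsub p hp)
        have bq := hbox _ hq
        push_cast at b1 b2 bq
        generalize hx1 : ((f p).1 : ℝ) = v1 at *
        generalize hx2 : ((f p).2 : ℝ) = v2 at *
        have v1pos' : (1:ℝ) ≤ v1 := by rw [← hx1]; exact_mod_cast v1pos
        generalize (p.1 : ℝ) = h at *
        generalize (p.2 : ℝ) = j at *
        clear hq hf h1 hsep uniq
        exact slope_aux β hβ' hβ3' c1 c2 R N H hN hH hHN1 hHD hD hc v1 v2 h j a1 a2 b1 b2 bp bq v1pos' v1le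
      have hinj : ((P'.image f).filter (fun x => x.1 = w)).card = (((P'.image f).filter (fun x => x.1 = w)).image Prod.snd).card := by
        rw [Finset.card_image_of_injOn]
        intro a ha b hb hab
        have ha := (Finset.mem_filter.1 ha).2
        have hb := (Finset.mem_filter.1 hb).2
        ext
        · rw [ha, hb]
        · exact hab
      rw [hinj]
      have : (157:ℝ) = 156 + 1 := by norm_num
      rw [this]
      apply card_int_le _ _ (by norm_num)
      intro i hi j hj
      obtain ⟨p, hp, rfl⟩ := Finset.mem_image.1 hi
      obtain ⟨q, hq, rfl⟩ := Finset.mem_image.1 hj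
      have h1 := abs_le.1 (hst p hp)
      have h2 := abs_le.1 (hst q hq)
      push_cast; linarith)
    refine h2.trans ?_
    gcongr
    apply card_int_le _ _ (by linarith)
    intro i hi j hj
    obtain ⟨p, hp, rfl⟩ := Finset.mem_image.1 hi
    obtain ⟨q, hq, rfl⟩ := Finset.mem_image.1 hj
    obtain ⟨p, hp', rfl⟩ := Finset.mem_image.1 hp
    obtain ⟨q, hq', rfl⟩ := Finset.mem_image.1 hq
    have h1 := (hf p hp').2.1
    have h2 := (hf q hq').1
    have h3 : (1:ℝ) ≤ (f q).1 := by exact_mod_cast h2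
    push_cast; linarith
  have hH3 : H^3 ≤ N / H := by
    rw [le_div_iff₀ (by linarith)]
    calc H^3 * H = H^4 := by ring
      _ ≤ N := hHN
  have h1H : 1 ≤ H^3 := one_le_pow₀ hH
  have e1 : (2 * (H + 2 + 1) * (H + 2 + 1)) * (157 * (H + 1)) ≤ 10048 * H^3 := by
    have : (H + 2 + 1) ≤ 4 * H := by linarith
    calc (2 * (H + 2 + 1) * (H + 2 + 1)) * (157 * (H + 1)) ≤ (2 * (4 * H) * (4 * H)) * (157 * (2 * H)) := by
          gcongr; linarith
      _ = 10048 * H^3 := by ring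
  have : 8 * N / H = 8 * (N / H) := by ring
  rw [this] at hsep
  linarith

end

section
open MeasureTheory
open scoped ENNReal NNReal Classical

lemma core (β : ℕ) (hβ : 1 ≤ β) (hβ3 : β ≤ 3) (c1 c2 R N H : ℝ) (hN : 1 ≤ N) (hH : 1 ≤ H) (hHN : H^4 ≤ N)
    (hHD : H^4 * N ≤ |c2|) (hD : 100 * N ≤ |c2|) (hc : |c1| ≤ |c2|) (A : Finset ℤ)
    (hA : ∀ j ∈ A, |(j:ℝ)| ≤ 4 * N) :
    ∑ p ∈ A ×ˢ A, wt (R - (((p.1:ℝ) - c1)^2 + β * ((p.2:ℝ) - c2)^2)) ≤ 200000 * (N / Real.sqrt H) := by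
  have hβ' : (1:ℝ) ≤ β := by exact_mod_cast hβ
  have hH4 : H ≤ H^4 := le_self_pow₀ hH (by norm_num)
  have hsH1 : 1 ≤ Real.sqrt H := Real.one_le_sqrt.2 hH
  have hsH : Real.sqrt H ≤ H := by
    rw [Real.sqrt_le_left (by linarith)]; nlinarith
  set a : ℤ × ℤ → ℝ := fun p => R - (((p.1:ℝ) - c1)^2 + β * ((p.2:ℝ) - c2)^2) with ha
  have hfilt : ∑ p ∈ A ×ˢ A, wt (a p) = ∑ p ∈ (A ×ˢ A).filter (fun p => -2 ≤ a p), wt (a p) := by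
    symm
    apply Finset.sum_filter_of_ne
    intro p _ hp
    by_contra hcon
    push Not at hcon
    exact hp (wt_zero hcon)
  change ∑ p ∈ A ×ˢ A, wt (a p) ≤ _
  rw [hfilt, ← Finset.sum_filter_add_sum_filter_not _ (fun p => a p ≤ H)]
  have h1 : ∑ p ∈ ((A ×ˢ A).filter (fun p => -2 ≤ a p)).filter (fun p => a p ≤ H), wt (a p) ≤ 160000 * (N / Real.sqrt H) := by
    have hP := Pcount β hβ hβ3 c1 c2 R N H hN hH hHN (by nlinarith) hD hc
      (((A ×ˢ A).filter (fun p => -2 ≤ a p)).filter (fun p => a p ≤ H)) (by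
        intro p hp
        simp only [Finset.mem_filter, Finset.mem_product] at hp
        exact ⟨hA _ hp.1.1.1, hA _ hp.1.1.2⟩) (by
        intro p hp
        simp only [Finset.mem_filter, Finset.mem_product, ha] at hp
        constructor <;> linarith [hp.1.2, hp.2])
    have h8 := Finset.sum_le_card_nsmul (((A ×ˢ A).filter (fun p => -2 ≤ a p)).filter (fun p => a p ≤ H)) (fun p => wt (a p)) 8
      (fun p _ => wt_le _)
    rw [nsmul_eq_mul] at h8
    have : N / H ≤ N / Real.sqrt H := by gcongr
    linarith
  have hcard : (A.card : ℝ) ≤ 9 * N := by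
    have := card_int_le A (8 * N) (by linarith) (by
      intro i hi j hj
      have h1 := abs_le.1 (hA i hi)
      have h2 := abs_le.1 (hA j hj)
      push_cast; linarith)
    linarith
  have h2 : ∑ p ∈ ((A ×ˢ A).filter (fun p => -2 ≤ a p)).filter (fun p => ¬ a p ≤ H), wt (a p) ≤ 9 * N * (152 / Real.sqrt H) := by
    rw [Finset.filter_filter, Finset.sum_filter, Finset.sum_product]
    have hh : ∀ h ∈ A, ∑ j ∈ A, (if -2 ≤ a (h, j) ∧ ¬ a (h, j) ≤ H then wt (a (h, j)) else 0) ≤ 152 / Real.sqrt H := by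
      intro h _
      rw [← Finset.sum_filter]
      rcases (A.filter (fun j => -2 ≤ a (h, j) ∧ ¬ a (h, j) ≤ H)).eq_empty_or_nonempty with he | hne
      · rw [he]; simp; positivity
      obtain ⟨j0, hj0, hs⟩ := lemS _ hne (fun j => a (h, j)) |c2| (8 * N) (by linarith) (by linarith) (by
        intro i hi j hj
        have h1 := hA i (Finset.mem_filter.1 hi).1
        have h2 := hA j (Finset.mem_filter.1 hj).1
        have e : a (h, i) - a (h, j) = - (((i - j : ℤ) : ℝ) * (β * (i + j - 2 * c2))) := by
          simp only [ha]; push_cast; ring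
        simp only [e]
        rw [abs_neg, abs_mul, mul_comm, abs_mul, abs_of_pos (by linarith : (0:ℝ) < β)]
        have h3 := tri_aux i j c2
        rw [abs_mul, abs_two] at h3
        gcongr
        have h4 : |c2| ≤ |(i:ℝ) + j - 2 * c2| := by linarith
        nlinarith [abs_nonneg ((i:ℝ) + j - 2 * c2)]) (by
        intro i hi j hj
        have h1 := abs_le.1 (hA i (Finset.mem_filter.1 hi).1)
        have h2 := abs_le.1 (hA j (Finset.mem_filter.1 hj).1)
        rw [abs_le]; push_cast; constructor <;> linarith) (by
        intro j hj
        exact (Finset.mem_filter.1 hj).2.1)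
      refine hs.trans ?_
      have h3 : wt (a (h, j0)) ≤ 8 / Real.sqrt H := by
        have := (Finset.mem_filter.1 hj0).2.2
        push Not at this
        exact wt_le_of (by linarith) this.le
      have h4 : Real.sqrt (8 * N / |c2|) ≤ 3 / Real.sqrt H := by
        rw [Real.sqrt_le_left (by positivity), div_pow, Real.sq_sqrt (by linarith)]
        rw [div_le_div_iff₀ (by linarith) (by linarith)]
        nlinarith
      have : 152 / Real.sqrt H = 8 / Real.sqrt H + 48 * (3 / Real.sqrt H) := by ring
      rw [this]
      linarith
    calc _ ≤ A.card • (152 / Real.sqrt H) := Finset.sum_le_card_nsmul _ _ _ hh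
      _ = A.card * (152 / Real.sqrt H) := by rw [nsmul_eq_mul]
      _ ≤ _ := by gcongr
  have : 9 * N * (152 / Real.sqrt H) = 1368 * (N / Real.sqrt H) := by ring
  have : 0 ≤ N / Real.sqrt H := by positivity
  linarith

/-- `core` with explicit gain -/
lemma core' (β : ℕ) (hβ : 1 ≤ β) (hβ3 : β ≤ 3) (c1 c2 R N : ℝ) (hN : 1 ≤ N)
    (hD : 100 * N ≤ |c2|) (hc : |c1| ≤ |c2|) (A : Finset ℤ)
    (hA : ∀ j ∈ A, |(j:ℝ)| ≤ 4 * N) :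
    ∑ p ∈ A ×ˢ A, wt (R - (((p.1:ℝ) - c1)^2 + β * ((p.2:ℝ) - c2)^2))
      ≤ 200000 * (N * (N / |c2| + 1 / N) ^ (1/8 : ℝ)) := by
  have hc2 : 0 < |c2| := by linarith
  set ρ := min N (|c2| / N) with hρ
  have hρ1 : 1 ≤ ρ := by
    apply le_min hN
    rw [le_div_iff₀ (by linarith)]; linarith
  set H := ρ ^ (1/4 : ℝ) with hHdef
  have hH : 1 ≤ H := Real.one_le_rpow hρ1 (by norm_num)
  have hH4 : H^4 = ρ := by
    rw [hHdef, ← Real.rpow_natCast, ← Real.rpow_mul (by linarith)]; norm_num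
  have h := core β hβ hβ3 c1 c2 R N H hN hH (by rw [hH4]; exact min_le_left _ _)
    (by
      rw [hH4]
      calc ρ * N ≤ |c2| / N * N := by gcongr; exact min_le_right _ _
        _ = |c2| := by field_simp) hD hc A hA
  refine h.trans ?_
  gcongr
  rw [div_eq_mul_inv]
  gcongr
  have e1 : (Real.sqrt H)⁻¹ = (ρ⁻¹) ^ (1/8 : ℝ) := by
    rw [Real.sqrt_eq_rpow, hHdef, ← Real.rpow_mul (by linarith), Real.inv_rpow (by linarith)]; norm_num
  rw [e1]
  apply Real.rpow_le_rpow (by positivity) _ (by norm_num)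
  have hp1 : 0 ≤ N / |c2| := by positivity
  have hp2 : 0 ≤ 1 / N := by positivity
  rcases min_choice N (|c2| / N) with h | h
  · rw [hρ, h, ← one_div]; linarith
  · rw [hρ, h, inv_div]; linarith

end

section
open MeasureTheory
open scoped ENNReal NNReal Classical

lemma slice1 (γ : ℝ) (hγ : 1 ≤ γ) (c a : ℝ) :
    volume {z : ℝ | |γ * (z - c)^2 - a| ≤ 2} ≤ ENNReal.ofReal (wt a) := by
  by_cases h1 : a < -2
  · have : {z : ℝ | |γ * (z - c)^2 - a| ≤ 2} = ∅ := by
      ext z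
      simp only [Set.mem_ofPred_eq, Set.mem_empty_iff_false, iff_false, not_le]
      have : 0 ≤ γ * (z - c)^2 := by positivity
      rw [abs_of_nonneg (by linarith)]; linarith
    rw [this]; simp
  push Not at h1
  by_cases h3 : a < 3
  · have hsub : {z : ℝ | |γ * (z - c)^2 - a| ≤ 2} ⊆ Set.Icc (c - 9/4) (c + 9/4) := by
      intro z hz
      have hz := (abs_le.1 (show |γ * (z - c)^2 - a| ≤ 2 from hz)).2
      have h5 : (z - c)^2 ≤ (9/4)^2 := by nlinarith [sq_nonneg (z - c)]
      have := abs_le.1 (abs_le_of_sq_le_sq h5 (by norm_num))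
      constructor <;> linarith
    refine (measure_mono hsub).trans ?_
    rw [Real.volume_Icc]
    apply ENNReal.ofReal_le_ofReal
    unfold wt
    rw [if_neg (by linarith)]
    have h4 : Real.sqrt (max a 1) ≤ 7/4 := by
      rw [Real.sqrt_le_left (by norm_num)]
      apply max_le <;> linarith
    have h5 : 0 < Real.sqrt (max a 1) := Real.sqrt_pos.2 (lt_max_of_lt_right one_pos)
    rw [le_div_iff₀ h5]
    nlinarith
  push Not at h3
  have hγ0 : 0 < γ := by linarith
  set u := Real.sqrt ((a + 2) / γ) with hu
  set l := Real.sqrt ((a - 2) / γ) with hl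
  have hu2 : u^2 = (a+2)/γ := Real.sq_sqrt (div_nonneg (by linarith) hγ0.le)
  have hl2 : l^2 = (a-2)/γ := Real.sq_sqrt (div_nonneg (by linarith) hγ0.le)
  have hu0 : 0 ≤ u := Real.sqrt_nonneg _
  have hl0 : 0 ≤ l := Real.sqrt_nonneg _
  have hsub : {z : ℝ | |γ * (z - c)^2 - a| ≤ 2} ⊆ Set.Icc (c - u) (c - l) ∪ Set.Icc (c + l) (c + u) := by
    intro z hz
    have hz := abs_le.1 (show |γ * (z - c)^2 - a| ≤ 2 from hz)
    have k1 : |z - c| ≤ u := by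
      apply Real.abs_le_sqrt
      rw [le_div_iff₀ hγ0]; linarith
    have k2 : l ≤ |z - c| := by
      rw [hl, Real.sqrt_le_left (abs_nonneg _), sq_abs, div_le_iff₀ hγ0]; linarith
    rcases abs_cases (z - c) with ⟨h, _⟩ | ⟨h, _⟩
    · right; constructor <;> linarith
    · left; constructor <;> linarith
  refine (measure_mono hsub).trans ((measure_union_le _ _).trans ?_)
  rw [Real.volume_Icc, Real.volume_Icc]
  have hlu : l ≤ u := Real.sqrt_le_sqrt (by gcongr; linarith)
  rw [← ENNReal.ofReal_add (by linarith) (by linarith)]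
  apply ENNReal.ofReal_le_ofReal
  unfold wt
  rw [if_neg (by linarith), max_eq_left (by linarith)]
  have hsa : 0 < Real.sqrt a := Real.sqrt_pos.2 (by linarith)
  have hsa2 : Real.sqrt a ^ 2 = a := Real.sq_sqrt (by linarith)
  rw [le_div_iff₀ hsa]
  have hd : γ * ((u - l) * (u + l)) = 4 := by
    have : (u - l) * (u + l) = u^2 - l^2 := by ring
    rw [this, hu2, hl2]; field_simp; ring
  have hge : Real.sqrt a ≤ γ * u := by
    rw [Real.sqrt_le_left (by positivity), mul_pow, hu2]
    have : γ^2 * ((a+2)/γ) = γ * (a+2) := by field_simp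
    rw [this]; nlinarith
  nlinarith [mul_nonneg (sub_nonneg.2 hlu) (sub_nonneg.2 hge), mul_nonneg (mul_nonneg hγ0.le (sub_nonneg.2 hlu)) hl0]

lemma sliceA (c a N : ℝ) (hN : 0 < N) (hc : 4 * N ≤ |c|) :
    volume {z : ℝ | |z| ≤ 2 * N ∧ |(z - c)^2 - a| ≤ 2} ≤ ENNReal.ofReal (4 / |c|) := by
  refine (Real.volume_le_diam _).trans ?_
  apply Metric.ediam_le
  rintro z ⟨hz, hz'⟩ w ⟨hw, hw'⟩
  rw [edist_dist, Real.dist_eq]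
  apply ENNReal.ofReal_le_ofReal
  rw [le_div_iff₀ (by linarith)]
  have h3 := tri_aux z w c
  rw [abs_mul, abs_two] at h3
  have h4 : |c| ≤ |z + w - 2 * c| := by linarith
  have h5 : |z - w| * |z + w - 2 * c| ≤ 4 := by
    rw [← abs_mul]
    have : (z - w) * (z + w - 2 * c) = ((z - c)^2 - a) - ((w - c)^2 - a) := by ring
    rw [this]
    exact (abs_sub _ _).trans (by linarith)
  nlinarith [abs_nonneg (z - w)]

/-- `ν` is controlled by unit lattice sums. -/
def Tame (ν : Measure ℝ) : Prop :=
  ∀ (G : ℝ → ℝ≥0∞), Measurable G → ∀ B : ℝ≥0∞, (∀ θ ∈ Set.Icc (0:ℝ) 1, ∑' h : ℤ, G (h + θ) ≤ B) → ∫⁻ x, G x ∂ν ≤ B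

lemma tame_volume : Tame volume := by
  intro G hG B h
  have e : ∫⁻ x, G x = ∑' j : ℤ, ∫⁻ x in Set.Ioc (j:ℝ) (j+1), G x := by
    rw [← lintegral_iUnion (fun _ => measurableSet_Ioc) (Set.pairwise_disjoint_Ioc_intCast ℝ), iUnion_Ioc_intCast]
    simp
  have e2 : ∀ j : ℤ, ∫⁻ x in Set.Ioc (j:ℝ) (j+1), G x = ∫⁻ x in Set.Ioc (0:ℝ) 1, G (j + x) := by
    intro j
    rw [← lintegral_indicator measurableSet_Ioc, ← lintegral_indicator measurableSet_Ioc,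
      ← lintegral_add_left_eq_self _ (j:ℝ)]
    congr 1; ext x
    simp only [Set.indicator, Set.mem_Ioc]
    congr 1
    simp
  rw [e]
  simp_rw [e2]
  rw [← lintegral_tsum (fun j => by fun_prop)]
  calc _ ≤ ∫⁻ x in Set.Ioc (0:ℝ) 1, B := setLIntegral_mono measurable_const (fun x hx => h x ⟨hx.1.le, hx.2⟩)
    _ = B := by simp

/-- the counting measure of ℤ on ℝ -/
def zc : Measure ℝ := (Measure.count : Measure ℤ).map (fun j : ℤ => (j:ℝ))

lemma cast_me : MeasurableEmbedding (fun j : ℤ => (j:ℝ)) :=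
  (measurable_from_top).measurableEmbedding Int.cast_injective

instance zc_sf : SigmaFinite zc := cast_me.sigmaFinite_map

lemma lintegral_zc (G : ℝ → ℝ≥0∞) : ∫⁻ x, G x ∂zc = ∑' j : ℤ, G j := by
  unfold zc
  rw [cast_me.lintegral_map, lintegral_count]

lemma tame_zc : Tame zc := by
  intro G hG B h
  rw [lintegral_zc]
  simpa using h 0 (by simp)

lemma tame_box {ν : Measure ℝ} (hν : Tame ν) (N : ℝ) (hN : 1 ≤ N) : ν {x | |x| ≤ 2 * N} ≤ ENNReal.ofReal (5 * N) := by
  have hm : MeasurableSet {x : ℝ | |x| ≤ 2 * N} := measurableSet_le (by fun_prop) (by fun_prop)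
  rw [← lintegral_indicator_one hm]
  apply hν _ (measurable_one.indicator hm)
  intro θ _
  rw [ENNReal.tsum_eq_iSup_sum]
  apply iSup_le
  intro s
  simp only [Set.indicator, Set.mem_ofPred_eq, Pi.one_apply]
  rw [← Finset.sum_filter, Finset.sum_const, nsmul_one]
  have := card_int_le (s.filter fun j : ℤ => |(j:ℝ) + θ| ≤ 2 * N) (4 * N) (by linarith) (by
    intro i hi j hj
    have h1 := abs_le.1 (Finset.mem_filter.1 hi).2
    have h2 := abs_le.1 (Finset.mem_filter.1 hj).2
    push_cast; linarith)
  rw [← ENNReal.ofReal_natCast]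
  apply ENNReal.ofReal_le_ofReal
  linarith

end

section
open MeasureTheory
open scoped ENNReal NNReal Classical

lemma wt_meas : Measurable wt := by
  unfold wt
  apply Measurable.ite (measurableSet_lt measurable_id measurable_const) measurable_const
  fun_prop

lemma core2 (c1 c2 R N : ℝ) (hN : 1 ≤ N)
    (hD : 100 * N ≤ |c2|) (A : Finset ℤ)
    (hA : ∀ j ∈ A, |(j:ℝ)| ≤ 4 * N) :
    ∑ p ∈ A ×ˢ A, wt (R - (((p.1:ℝ) - c1)^2 + ((p.2:ℝ) - c2)^2))
      ≤ 200000 * (N * (N / |c2| + 1 / N) ^ (1/8 : ℝ)) := by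
  rcases le_total |c1| |c2| with h | h
  · have := core' 1 le_rfl (by norm_num) c1 c2 R N hN hD h A hA
    simpa using this
  · have := core' 1 le_rfl (by norm_num) c2 c1 R N hN (hD.trans h) h A hA
    rw [Finset.sum_product_right] at this
    simp only [Nat.cast_one, one_mul] at this
    rw [Finset.sum_product]
    have h0 : 0 < |c2| := by linarith
    calc _ = ∑ y ∈ A, ∑ x ∈ A, wt (R - (((x:ℝ) - c2) ^ 2 + ((y:ℝ) - c1) ^ 2)) := by
          apply Finset.sum_congr rfl; intro x _; apply Finset.sum_congr rfl; intro y _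
          congr 2; ring
      _ ≤ _ := this
      _ ≤ _ := by gcongr

lemma K1_bound {ν : Measure ℝ} (hν : Tame ν) (c R : ℝ) :
    ∫⁻ z, ENNReal.ofReal (wt (R - (z - c)^2)) ∂ν ≤ 200 := by
  apply hν
  · exact (wt_meas.comp (by fun_prop)).ennreal_ofReal
  intro θ _
  rw [ENNReal.tsum_eq_iSup_sum]
  apply iSup_le
  intro s
  rw [← ENNReal.ofReal_sum_of_nonneg (fun _ _ => wt_nonneg _)]
  have := F2 s (c - θ) R
  apply ENNReal.ofReal_le_of_le_toReal
  simp only [ENNReal.toReal_ofNat]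
  refine le_trans (le_of_eq ?_) this
  apply Finset.sum_congr rfl
  intro j _
  congr 2; ring

def Kf (N c1 c2 R : ℝ) (x z : ℝ) : ℝ≥0∞ :=
  if |x| ≤ 2 * N ∧ |z| ≤ 2 * N then ENNReal.ofReal (wt (R - ((x - c1)^2 + (z - c2)^2))) else 0

lemma Kf_meas (N c1 c2 R : ℝ) : Measurable (fun p : ℝ × ℝ => Kf N c1 c2 R p.1 p.2) := by
  unfold Kf
  apply Measurable.ite
  · have h1 : MeasurableSet {p : ℝ × ℝ | |p.1| ≤ 2 * N} := measurableSet_le (by fun_prop) (by fun_prop)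
    have h2 : MeasurableSet {p : ℝ × ℝ | |p.2| ≤ 2 * N} := measurableSet_le (by fun_prop) (by fun_prop)
    exact h1.inter h2
  · exact (wt_meas.comp (by fun_prop)).ennreal_ofReal
  · fun_prop

lemma K2_bound {ν1 ν2 : Measure ℝ} [SigmaFinite ν1] [SigmaFinite ν2] (h1 : Tame ν1) (h2 : Tame ν2)
    (c1 c2 R N : ℝ) (hN : 1 ≤ N) (hD : 200 * N ≤ |c2|) :
    ∫⁻ x, ∫⁻ z, Kf N c1 c2 R x z ∂ν2 ∂ν1 ≤ ENNReal.ofReal (400000 * (N * (N / |c2| + 1 / N) ^ (1/8 : ℝ))) := by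
  have hKm := Kf_meas N c1 c2 R
  apply h1 _ (hKm.lintegral_prod_right')
  intro θ1 hθ1
  rw [← lintegral_tsum (fun h => (by
    have : Measurable (fun z => (fun p : ℝ × ℝ => Kf N c1 c2 R p.1 p.2) ((h:ℝ) + θ1, z)) := hKm.comp (by fun_prop)
    exact this.aemeasurable))]
  apply h2
  · apply Measurable.tsum
    intro h
    have : Measurable (fun z => (fun p : ℝ × ℝ => Kf N c1 c2 R p.1 p.2) ((h:ℝ) + θ1, z)) := hKm.comp (by fun_prop)
    exact this
  intro θ2 hθ2
  rw [← ENNReal.tsum_prod (f := fun (j h : ℤ) => Kf N c1 c2 R (h + θ1) (j + θ2)), ENNReal.tsum_eq_iSup_sum]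
  apply iSup_le
  intro s
  set L : ℤ := ⌊4 * N⌋
  set A : Finset ℤ := Finset.Icc (-L) L with hAdef
  have hA : ∀ j ∈ A, |(j:ℝ)| ≤ 4 * N := by
    intro j hj
    rw [hAdef, Finset.mem_Icc] at hj
    have h3 : (L:ℝ) ≤ 4 * N := Int.floor_le _
    have h4 : (-L:ℝ) ≤ j := by exact_mod_cast hj.1
    have h5 : (j:ℝ) ≤ L := by exact_mod_cast hj.2
    rw [abs_le]; constructor <;> linarith
  have hA' : ∀ j : ℤ, |(j:ℝ)| ≤ 4 * N → j ∈ A := by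
    intro j hj
    rw [hAdef, Finset.mem_Icc]
    have := abs_le.1 hj
    constructor
    · have : -j ≤ L := Int.le_floor.2 (by push_cast; linarith)
      linarith
    · exact Int.le_floor.2 (by linarith)
  have hmemA : ∀ (j : ℤ) θ, θ ∈ Set.Icc (0:ℝ) 1 → |(j:ℝ) + θ| ≤ 2 * N → j ∈ A := by
    intro j θ hθ h
    apply hA'
    have := abs_le.1 h
    rw [abs_le]; constructor <;> linarith [hθ.1, hθ.2]
  calc ∑ p ∈ s, Kf N c1 c2 R (p.2 + θ1) (p.1 + θ2) ≤ ∑ p ∈ A ×ˢ A, ENNReal.ofReal (wt (R - (((p.2:ℝ) + θ1 - c1)^2 + ((p.1:ℝ) + θ2 - c2)^2))) := by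
        rw [← Finset.sum_filter_add_sum_filter_not s (fun p => p ∈ A ×ˢ A)]
        have hz : ∑ p ∈ s.filter (fun p => ¬ p ∈ A ×ˢ A), Kf N c1 c2 R (p.2 + θ1) (p.1 + θ2) = 0 := by
          apply Finset.sum_eq_zero
          intro p hp
          have hp := (Finset.mem_filter.1 hp).2
          unfold Kf
          rw [if_neg]
          rintro ⟨k1, k2⟩
          exact hp (Finset.mem_product.2 ⟨hmemA _ _ hθ2 k2, hmemA _ _ hθ1 k1⟩)
        rw [hz, add_zero]
        refine (Finset.sum_le_sum_of_subset (t := A ×ˢ A) (fun p hp => (Finset.mem_filter.1 hp).2)).trans ?_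
        apply Finset.sum_le_sum
        intro p _
        unfold Kf
        split_ifs <;> simp
    _ ≤ _ := by
        rw [← ENNReal.ofReal_sum_of_nonneg (fun _ _ => wt_nonneg _)]
        apply ENNReal.ofReal_le_ofReal
        have hc : |c2| / 2 ≤ |c2 - θ2| := by
          have := abs_sub_abs_le_abs_sub c2 θ2
          rw [abs_of_nonneg hθ2.1] at this
          linarith [hθ2.2]
        have hc0 : 0 < |c2| := by linarith
        have := core2 (c1 - θ1) (c2 - θ2) R N hN (by linarith) A hA
        rw [Finset.sum_product_right] at this
        rw [Finset.sum_product]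
        calc _ = ∑ y ∈ A, ∑ x ∈ A, wt (R - (((x:ℝ) - (c1 - θ1)) ^ 2 + ((y:ℝ) - (c2 - θ2)) ^ 2)) := by
              apply Finset.sum_congr rfl; intro x _; apply Finset.sum_congr rfl; intro y _
              congr 2; ring
          _ ≤ _ := this
          _ ≤ 200000 * (N * (2 * (N / |c2| + 1 / N) ^ (1/8 : ℝ))) := by
              gcongr
              have h2 : (2:ℝ) ^ (1/8:ℝ) ≤ 2 := by
                calc (2:ℝ) ^ (1/8:ℝ) ≤ 2 ^ (1:ℝ) := Real.rpow_le_rpow_of_exponent_le (by norm_num) (by norm_num)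
                  _ = 2 := by simp
              calc (N / |c2 - θ2| + 1 / N) ^ (1/8:ℝ) ≤ (2 * (N / |c2| + 1 / N)) ^ (1/8:ℝ) := by
                    gcongr
                    have : N / |c2 - θ2| ≤ N / (|c2| / 2) := by gcongr
                    have e : N / (|c2| / 2) = 2 * (N / |c2|) := by field_simp
                    have : 0 ≤ 1 / N := by positivity
                    linarith
                _ = 2 ^ (1/8:ℝ) * (N / |c2| + 1 / N) ^ (1/8:ℝ) := by
                    rw [Real.mul_rpow (by norm_num) (by positivity)]
                _ ≤ _ := by gcongr
          _ = _ := by ring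

end

section
open MeasureTheory
open scoped ENNReal NNReal Classical

section pilevel
set_option linter.unusedSectionVars false
variable {ι : Type} [Fintype ι] [DecidableEq ι]

def Qset (N : ℝ) (c : ι → ℝ) (R : ℝ) : Set (ι → ℝ) :=
  {v | (∀ i, |v i| ≤ 2 * N) ∧ |∑ i, (v i - c i)^2 - R| ≤ 2}

def Qf (N : ℝ) (c : ι → ℝ) (R : ℝ) : (ι → ℝ) → ℝ≥0∞ := (Qset N c R).indicator 1

lemma Qset_meas (N : ℝ) (c : ι → ℝ) (R : ℝ) : MeasurableSet (Qset N c R) := by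
  have h1 : MeasurableSet {v : ι → ℝ | ∀ i, |v i| ≤ 2 * N} := by
    simp only [Set.ofPred_forall]
    exact MeasurableSet.iInter fun i => measurableSet_le (by fun_prop) (by fun_prop)
  have h2 : MeasurableSet {v : ι → ℝ | |∑ i, (v i - c i)^2 - R| ≤ 2} :=
    measurableSet_le (by fun_prop) (by fun_prop)
  exact h1.inter h2

lemma Qf_meas (N : ℝ) (c : ι → ℝ) (R : ℝ) : Measurable (Qf N c R) :=
  measurable_one.indicator (Qset_meas N c R)

variable (ν : ι → Measure ℝ) [∀ i, SigmaFinite (ν i)]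

lemma Q_fill (hν : ∀ i, Tame (ν i)) (N : ℝ) (hN : 1 ≤ N) (c : ι → ℝ) (R : ℝ) (s : Finset ι) (B : ℝ≥0∞)
    (hB : ∀ v, (∫⋯∫⁻_s, Qf N c R ∂ν) v ≤ B) :
    Measure.pi ν (Qset N c R) ≤ B * ENNReal.ofReal (5 * N) ^ (Fintype.card ι - s.card) := by
  have key : ∀ t : Finset ι, Disjoint s t → ∀ v, (∫⋯∫⁻_(s ∪ t), Qf N c R ∂ν) v ≤ B * ENNReal.ofReal (5 * N) ^ t.card := by
    intro t
    induction t using Finset.induction_on with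
    | empty => intro _ v; simpa using hB v
    | insert i t hi ih =>
      intro hd v
      rw [Finset.disjoint_insert_right] at hd
      rw [Finset.union_insert, lmarginal_insert _ (Qf_meas N c R) (by simp [hi, hd.1])]
      calc _ ≤ ∫⁻ x, ({x : ℝ | |x| ≤ 2 * N}).indicator (fun _ => B * ENNReal.ofReal (5 * N) ^ t.card) x ∂(ν i) := by
            apply lintegral_mono
            intro x
            by_cases hx : |x| ≤ 2 * N
            · rw [Set.indicator_of_mem (by exact hx)]
              exact ih hd.2 _
            · rw [Set.indicator_of_notMem (by exact hx)]
              apply le_of_eq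
              unfold lmarginal
              rw [lintegral_eq_zero_iff' (by
                apply Measurable.aemeasurable
                exact (Qf_meas N c R).comp measurable_updateFinset)]
              apply Filter.Eventually.of_forall
              intro y
              simp only [Pi.zero_apply, Qf]
              apply Set.indicator_of_notMem
              intro hmem
              have := hmem.1 i
              simp [Function.updateFinset, hi, hd.1] at this
              exact hx this
        _ = B * ENNReal.ofReal (5 * N) ^ t.card * ν i {x : ℝ | |x| ≤ 2 * N} := by
            rw [lintegral_indicator_const (measurableSet_le (by fun_prop) (by fun_prop))]
        _ ≤ B * ENNReal.ofReal (5 * N) ^ t.card * ENNReal.ofReal (5 * N) := by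
            gcongr; exact tame_box (hν i) N hN
        _ = _ := by rw [Finset.card_insert_of_notMem hi, pow_succ, mul_assoc]
  have h := key sᶜ disjoint_compl_right 0
  rw [Finset.union_compl, lmarginal_univ, Finset.card_compl] at h
  rwa [Qf, lintegral_indicator_one (Qset_meas N c R)] at h

lemma sum_upd (c v : ι → ℝ) (a : ι) (x : ℝ) :
    ∑ i, (Function.update v a x i - c i)^2 = (x - c a)^2 + ∑ i ∈ Finset.univ.erase a, (v i - c i)^2 := by
  rw [← Finset.add_sum_erase _ _ (Finset.mem_univ a)]
  congr 1
  · simp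
  · apply Finset.sum_congr rfl
    intro i hi
    rw [Function.update_of_ne (Finset.ne_of_mem_erase hi)]

lemma marg1 (N : ℝ) (c : ι → ℝ) (R : ℝ) (a : ι) (ha : ν a = volume) (v : ι → ℝ) :
    (∫⋯∫⁻_{a}, Qf N c R ∂ν) v ≤ ENNReal.ofReal (wt (R - ∑ i ∈ Finset.univ.erase a, (v i - c i)^2)) := by
  rw [lmarginal_singleton, ha]
  refine le_trans ?_ (slice1 1 le_rfl (c a) _)
  have hm : MeasurableSet {z : ℝ | |1 * (z - c a) ^ 2 - (R - ∑ i ∈ Finset.univ.erase a, (v i - c i) ^ 2)| ≤ 2} := measurableSet_le (by fun_prop) (by fun_prop)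
  rw [← lintegral_indicator_one hm]
  apply lintegral_mono
  intro x
  by_cases hx : Function.update v a x ∈ Qset N c R
  · rw [Set.indicator_of_mem]
    · exact Set.indicator_le_self' (by simp) _
    · have := hx.2
      rw [sum_upd] at this
      change |1 * (x - c a) ^ 2 - (R - ∑ i ∈ Finset.univ.erase a, (v i - c i) ^ 2)| ≤ 2
      convert this using 2; ring
  · simp [Qf, hx]

lemma marg1A (N : ℝ) (hN : 1 ≤ N) (c : ι → ℝ) (R : ℝ) (a : ι) (ha : ν a = volume) (hc : 4 * N ≤ |c a|) (v : ι → ℝ) :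
    (∫⋯∫⁻_{a}, Qf N c R ∂ν) v ≤ ENNReal.ofReal (4 / |c a|) := by
  rw [lmarginal_singleton, ha]
  refine le_trans ?_ (sliceA (c a) (R - ∑ i ∈ Finset.univ.erase a, (v i - c i)^2) N (by linarith) hc)
  have hm : MeasurableSet {z : ℝ | |z| ≤ 2 * N ∧ |(z - c a) ^ 2 - (R - ∑ i ∈ Finset.univ.erase a, (v i - c i) ^ 2)| ≤ 2} := by
    have h1 : MeasurableSet {z : ℝ | |z| ≤ 2 * N} := measurableSet_le (by fun_prop) (by fun_prop)
    have h2 : MeasurableSet {z : ℝ | |(z - c a) ^ 2 - (R - ∑ i ∈ Finset.univ.erase a, (v i - c i) ^ 2)| ≤ 2} := measurableSet_le (by fun_prop) (by fun_prop)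
    exact h1.inter h2
  rw [← lintegral_indicator_one hm]
  apply lintegral_mono
  intro x
  by_cases hx : Function.update v a x ∈ Qset N c R
  · rw [Set.indicator_of_mem]
    · exact Set.indicator_le_self' (by simp) _
    · refine ⟨by simpa using hx.1 a, ?_⟩
      have := hx.2
      rw [sum_upd] at this
      convert this using 2; ring
  · simp [Qf, hx]

lemma marg2 (hν : ∀ i, Tame (ν i)) (N : ℝ) (c : ι → ℝ) (R : ℝ) (a b : ι) (hab : b ≠ a) (ha : ν a = volume) (v : ι → ℝ) :
    (∫⋯∫⁻_{b, a}, Qf N c R ∂ν) v ≤ 200 := by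
  rw [lmarginal_insert _ (Qf_meas N c R) (by simpa using hab)]
  refine le_trans (lintegral_mono fun x => marg1 ν N c R a ha _) ?_
  refine le_trans (le_of_eq ?_) (K1_bound (hν b) (c b) (R - ∑ i ∈ (Finset.univ.erase a).erase b, (v i - c i)^2))
  congr 1; ext x; congr 2
  rw [← Finset.add_sum_erase _ _ (Finset.mem_erase.2 ⟨hab, Finset.mem_univ b⟩)]
  simp only [Function.update_self]
  have : ∑ i ∈ (Finset.univ.erase a).erase b, (Function.update v b x i - c i)^2 = ∑ i ∈ (Finset.univ.erase a).erase b, (v i - c i)^2 := by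
    apply Finset.sum_congr rfl
    intro i hi
    rw [Function.update_of_ne (Finset.ne_of_mem_erase hi)]
  rw [this]; ring

lemma marg1_zero (N : ℝ) (c : ι → ℝ) (R : ℝ) (a b : ι) (hab : b ≠ a) (v : ι → ℝ) (hv : ¬ |v b| ≤ 2 * N) :
    (∫⋯∫⁻_{a}, Qf N c R ∂ν) v = 0 := by
  rw [lmarginal_singleton]
  refine (lintegral_congr (g := fun _ => 0) fun x => ?_).trans lintegral_zero
  simp only [Qf]
  apply Set.indicator_of_notMem
  intro hx
  have := hx.1 b
  rw [Function.update_of_ne hab] at this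
  exact hv this

lemma marg3 (hν : ∀ i, Tame (ν i)) (N : ℝ) (hN : 1 ≤ N) (c : ι → ℝ) (R : ℝ) (a b e : ι) (hab : b ≠ a) (hea : e ≠ a) (heb : e ≠ b)
    (ha : ν a = volume) (hc : 200 * N ≤ |c b|) (v : ι → ℝ) :
    (∫⋯∫⁻_{e, b, a}, Qf N c R ∂ν) v ≤ ENNReal.ofReal (400000 * (N * (N / |c b| + 1 / N) ^ (1/8 : ℝ))) := by
  rw [lmarginal_insert _ (Qf_meas N c R) (by simp [hea, heb])]
  refine le_trans ?_ (K2_bound (hν e) (hν b) (c e) (c b) (R - ∑ i ∈ ((Finset.univ.erase a).erase b).erase e, (v i - c i)^2) N hN hc)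
  apply lintegral_mono
  intro x
  simp only
  rw [lmarginal_insert _ (Qf_meas N c R) (by simpa using hab)]
  apply lintegral_mono
  intro z
  simp only
  unfold Kf
  split_ifs with h
  · refine (marg1 ν N c R a ha _).trans (le_of_eq ?_)
    congr 2
    rw [← Finset.add_sum_erase _ _ (Finset.mem_erase.2 ⟨hab, Finset.mem_univ b⟩),
      ← Finset.add_sum_erase _ _ (Finset.mem_erase.2 ⟨heb, (Finset.mem_erase.2 ⟨hea, Finset.mem_univ e⟩)⟩)]
    rw [Function.update_self, Function.update_of_ne heb, Function.update_self]
    have : ∑ i ∈ ((Finset.univ.erase a).erase b).erase e, (Function.update (Function.update v e x) b z i - c i)^2 = ∑ i ∈ ((Finset.univ.erase a).erase b).erase e, (v i - c i)^2 := by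
      apply Finset.sum_congr rfl
      intro i hi
      rw [Function.update_of_ne (Finset.ne_of_mem_erase (Finset.mem_of_mem_erase hi)), Function.update_of_ne (Finset.ne_of_mem_erase hi)]
    rw [this]; ring
  · apply le_of_eq
    rw [not_and_or] at h
    rcases h with h | h
    · exact marg1_zero ν N c R a e hea _ (by rwa [Function.update_of_ne heb, Function.update_self])
    · exact marg1_zero ν N c R a b hab _ (by rwa [Function.update_self])

end pilevel

end

section
open MeasureTheory
open scoped ENNReal NNReal Classical

abbrev EE (m n : ℕ) := (Fin m → ℝ) × (Fin n → ℤ)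

def muE (m n : ℕ) : Measure (EE m n) := (volume : Measure (Fin m → ℝ)).prod (Measure.count : Measure (Fin n → ℤ))

instance (m n : ℕ) : SigmaFinite (muE m n) := by unfold muE; infer_instance

def nsq {m n : ℕ} (κ : EE m n) : ℝ := (∑ i, (κ.1 i)^2) + ∑ i, ((κ.2 i : ℝ))^2

def emb {m n : ℕ} (κ : EE m n) : Fin m ⊕ Fin n → ℝ := Sum.elim κ.1 (fun i => (κ.2 i : ℝ))

def nuS (m n : ℕ) : Fin m ⊕ Fin n → Measure ℝ := Sum.elim (fun _ => volume) (fun _ => zc)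

instance (m n : ℕ) (i : Fin m ⊕ Fin n) : SigmaFinite (nuS m n i) := by
  rcases i with i | i
  · exact inferInstanceAs (SigmaFinite (volume : Measure ℝ))
  · exact zc_sf

lemma nuS_tame (m n : ℕ) (i : Fin m ⊕ Fin n) : Tame (nuS m n i) := by
  rcases i with i | i
  · exact tame_volume
  · exact tame_zc

lemma emb_meas {m n : ℕ} : Measurable (emb (m := m) (n := n)) := by
  rw [measurable_pi_iff]
  rintro (i | i)
  · exact (measurable_pi_apply i).comp measurable_fst
  · exact (measurable_from_top (f := fun j : ℤ => (j:ℝ))).comp ((measurable_pi_apply i).comp measurable_snd)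

lemma nsq_emb {m n : ℕ} (κ : EE m n) : nsq κ = ∑ i, (emb κ i)^2 := by
  simp [nsq, emb]

lemma emb_sub {m n : ℕ} (κ κ' : EE m n) (i) : emb (κ - κ') i = emb κ i - emb κ' i := by
  rcases i with i | i <;> simp [emb]

lemma emb_add {m n : ℕ} (κ κ' : EE m n) (i) : emb (κ + κ') i = emb κ i + emb κ' i := by
  rcases i with i | i <;> simp [emb]

lemma nsq_meas {m n : ℕ} : Measurable (nsq (m := m) (n := n)) := by
  have : nsq (m := m) (n := n) = fun κ => ∑ i, (emb κ i)^2 := funext nsq_emb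
  rw [this]
  have := emb_meas (m := m) (n := n)
  fun_prop

lemma count_pi (n : ℕ) : (Measure.count : Measure (Fin n → ℤ)) = Measure.pi (fun _ => Measure.count) := by
  apply Measure.ext_of_singleton
  intro j
  rw [Measure.pi_singleton]
  simp

lemma map_emb (m n : ℕ) : (muE m n).map emb = Measure.pi (nuS m n) := by
  symm
  apply Measure.pi_eq
  intro s hs
  rw [Measure.map_apply emb_meas (MeasurableSet.univ_pi hs)]
  have : emb ⁻¹' (Set.univ.pi s) = (Set.univ.pi (fun i : Fin m => s (Sum.inl i))) ×ˢ
      (Set.univ.pi (fun i : Fin n => (fun j : ℤ => (j:ℝ)) ⁻¹' s (Sum.inr i))) := by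
    ext κ
    simp [emb, Set.mem_pi]
  rw [this, muE, Measure.prod_prod, count_pi, volume_pi, Measure.pi_pi, Measure.pi_pi, Fintype.prod_sum_type]
  congr 1
  apply Finset.prod_congr rfl
  intro i _
  simp only [nuS, Sum.elim_inr, zc]
  rw [Measure.map_apply measurable_from_top (hs _)]

def SN {m n : ℕ} (N : ℝ) : Set (EE m n) := {κ | nsq κ ≤ 4 * N^2 ∧ (1 < N → N^2/4 ≤ nsq κ)}

lemma SN_meas {m n : ℕ} (N : ℝ) : MeasurableSet (SN (m := m) (n := n) N) := by
  have h1 : MeasurableSet {κ : EE m n | nsq κ ≤ 4 * N^2} := measurableSet_le nsq_meas measurable_const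
  by_cases h : 1 < N
  · have h2 : MeasurableSet {κ : EE m n | N^2/4 ≤ nsq κ} := measurableSet_le measurable_const nsq_meas
    convert h1.inter h2 using 1
    ext κ; simp [SN, h]
  · convert h1 using 1
    ext κ; simp [SN, h]

lemma emb_le_of_nsq {m n : ℕ} {N : ℝ} (hN : 0 ≤ N) {κ : EE m n} (h : nsq κ ≤ 4 * N^2) (i) : |emb κ i| ≤ 2 * N := by
  apply abs_le_of_sq_le_sq _ (by linarith)
  rw [nsq_emb] at h
  calc (emb κ i)^2 ≤ ∑ i, (emb κ i)^2 := Finset.single_le_sum (f := fun i => (emb κ i)^2) (fun _ _ => sq_nonneg _) (Finset.mem_univ i)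
    _ ≤ _ := by linarith

lemma nsq_id {m n : ℕ} (ξ κ : EE m n) : nsq (ξ - κ) + nsq κ = 2 * ∑ i, (emb κ i - emb ξ i / 2)^2 + (nsq ξ) / 2 := by
  rw [nsq_emb, nsq_emb, nsq_emb, Finset.mul_sum, Finset.sum_div, ← Finset.sum_add_distrib, ← Finset.sum_add_distrib]
  apply Finset.sum_congr rfl
  intro i _
  rw [emb_sub]; ring

def biSet {m n : ℕ} (N1 N2 : ℝ) (ξ : EE m n) (R : ℝ) : Set (EE m n) :=
  {κ | κ ∈ SN N2 ∧ ξ - κ ∈ SN N1 ∧ |nsq (ξ - κ) + nsq κ - R| ≤ 1}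

lemma biSet_sub {m n : ℕ} (N1 N2 : ℝ) (hN : 0 ≤ N2) (ξ : EE m n) (R : ℝ) :
    biSet N1 N2 ξ R ⊆ emb ⁻¹' Qset N2 (fun i => emb ξ i / 2) (R / 2 - nsq ξ / 4) := by
  rintro κ ⟨h1, h2, h3⟩
  refine ⟨fun i => emb_le_of_nsq hN h1.1 i, ?_⟩
  rw [nsq_id] at h3
  have h3 := abs_le.1 h3
  rw [abs_le]
  constructor <;> linarith

lemma biSet_le {m n : ℕ} (N1 N2 : ℝ) (hN : 1 ≤ N2) (ξ : EE m n) (R : ℝ) (s : Finset (Fin m ⊕ Fin n)) (B : ℝ≥0∞)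
    (hB : ∀ v, (∫⋯∫⁻_s, Qf N2 (fun i => emb ξ i / 2) (R / 2 - nsq ξ / 4) ∂(nuS m n)) v ≤ B) :
    muE m n (biSet N1 N2 ξ R) ≤ B * ENNReal.ofReal (5 * N2) ^ (m + n - s.card) := by
  refine (measure_mono (biSet_sub N1 N2 (by linarith) ξ R)).trans ?_
  rw [← Measure.map_apply emb_meas (Qset_meas _ _ _), map_emb]
  have := Q_fill (nuS m n) (nuS_tame m n) N2 hN _ _ s B hB
  simpa using this

/-- no-gain bound -/
lemma bi_nogain {m n : ℕ} (hm : 1 ≤ m) (hn : 1 ≤ n) (N1 N2 : ℝ) (hN : 1 ≤ N2) (ξ : EE m n) (R : ℝ) :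
    muE m n (biSet N1 N2 ξ R) ≤ 200 * ENNReal.ofReal (5 * N2) ^ (m + n - 2) := by
  have h := biSet_le N1 N2 hN ξ R {Sum.inr ⟨0, hn⟩, Sum.inl ⟨0, hm⟩} 200
    (fun v => marg2 (nuS m n) (nuS_tame m n) N2 _ _ (Sum.inl ⟨0, hm⟩) (Sum.inr ⟨0, hn⟩) (by simp) rfl v)
  rwa [Finset.card_pair (by simp)] at h

/-- transversal real direction -/
lemma bi_slice {m n : ℕ} (hm : 1 ≤ m) (N1 N2 : ℝ) (hN : 1 ≤ N2) (ξ : EE m n) (R : ℝ)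
    (hc : 8 * N2 ≤ |emb ξ (Sum.inl ⟨0, hm⟩)|) :
    muE m n (biSet N1 N2 ξ R) ≤ ENNReal.ofReal (8 / |emb ξ (Sum.inl ⟨0, hm⟩)|) * ENNReal.ofReal (5 * N2) ^ (m + n - 1) := by
  have h := biSet_le N1 N2 hN ξ R {Sum.inl ⟨0, hm⟩} (ENNReal.ofReal (8 / |emb ξ (Sum.inl ⟨0, hm⟩)|))
    (fun v => (marg1A (nuS m n) N2 hN (fun i => emb ξ i / 2) (R / 2 - nsq ξ / 4) (Sum.inl ⟨0, hm⟩) rfl (by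
      rw [abs_div, abs_two]; linarith) v).trans (le_of_eq (by
      rw [abs_div, abs_two]; congr 1; field_simp; norm_num)))
  rwa [Finset.card_singleton] at h

lemma nsq_nonneg {m n : ℕ} (κ : EE m n) : 0 ≤ nsq κ := by unfold nsq; positivity

lemma nsq_sub_le {m n : ℕ} (ξ κ : EE m n) : nsq (ξ - κ) ≤ 2 * nsq ξ + 2 * nsq κ := by
  rw [nsq_emb, nsq_emb, nsq_emb, Finset.mul_sum, Finset.mul_sum, ← Finset.sum_add_distrib]
  apply Finset.sum_le_sum
  intro i _
  rw [emb_sub]; nlinarith [sq_nonneg (emb ξ i + emb κ i)]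

lemma exists_large {m n : ℕ} (hm : 1 ≤ m) (ξ : EE m n) (T : ℝ) (hT : 0 ≤ T) (h : T^2 ≤ nsq ξ) :
    ∃ i, T / (m + n : ℕ) ≤ |emb ξ i| := by
  by_contra hcon
  push Not at hcon
  have hd : (0:ℝ) < (m + n : ℕ) := by exact_mod_cast (by omega : 0 < m + n)
  have hd1 : (1:ℝ) ≤ (m + n : ℕ) := by exact_mod_cast (by omega : 1 ≤ m + n)
  have : nsq ξ < T^2 := by
    rw [nsq_emb]
    calc ∑ i, (emb ξ i)^2 < ∑ i : Fin m ⊕ Fin n, (T / (m + n : ℕ))^2 := by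
          apply Finset.sum_lt_sum_of_nonempty ⟨Sum.inl ⟨0, hm⟩, Finset.mem_univ _⟩
          intro i _
          rw [sq_lt_sq, abs_of_nonneg (by positivity : 0 ≤ T / (m + n : ℕ))]
          exact hcon i
      _ = T^2 / (m + n : ℕ) := by
          simp only [Finset.sum_const, Finset.card_univ, Fintype.card_sum, Fintype.card_fin, nsmul_eq_mul]
          field_simp
      _ ≤ T^2 := div_le_self (by positivity) hd1
  linarith

lemma le_rpow_eighth {x X : ℝ} (hx : 0 ≤ x) (hx1 : x ≤ 1) (hX : x ≤ X) (η : ℝ) (h0 : 0 ≤ η) (h1 : η ≤ 1) : x ≤ X ^ η := by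
  rcases hx.eq_or_lt with rfl | hx
  · exact Real.rpow_nonneg hX _
  calc x = x ^ (1:ℝ) := by simp
    _ ≤ x ^ η := Real.rpow_le_rpow_of_exponent_ge hx hx1 h1
    _ ≤ _ := Real.rpow_le_rpow hx.le hX h0

set_option maxHeartbeats 800000 in
lemma bi_count {m n : ℕ} (hm : 1 ≤ m) (hn : 1 ≤ n) (hd : 3 ≤ m + n) (N1 N2 : ℝ) (hN : 1 ≤ N2) (hNN : N2 ≤ N1) (ξ : EE m n) (R : ℝ) :
    muE m n (biSet N1 N2 ξ R) ≤ ENNReal.ofReal (3200000 * (m + n : ℕ) * (5 * N2) ^ (m + n - 2) * (N2 / N1 + 1 / N2) ^ (1/8:ℝ)) := by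
  set d : ℝ := ((m + n : ℕ) : ℝ) with hdd
  have hd3 : 3 ≤ d := by rw [hdd]; exact_mod_cast hd
  set X := N2 / N1 + 1 / N2 with hX
  have hN1 : 0 < N1 := by linarith
  have hN2 : 0 < N2 := by linarith
  have hr0 : 0 ≤ N2 / N1 := by positivity
  have hi0 : 0 ≤ 1 / N2 := by positivity
  have hr1 : N2 / N1 ≤ 1 := (div_le_one hN1).2 hNN
  have hX0 : 0 ≤ X := by positivity
  by_cases hK : N1 < 1600 * d * N2
  · refine (bi_nogain hm hn N1 N2 hN ξ R).trans ?_
    have e : (200 : ℝ≥0∞) = ENNReal.ofReal 200 := by simp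
    rw [e, ← ENNReal.ofReal_pow (by positivity), ← ENNReal.ofReal_mul (by norm_num)]
    apply ENNReal.ofReal_le_ofReal
    have h1 : (1600 * d)⁻¹ ≤ X ^ (1/8:ℝ) := by
      apply le_rpow_eighth (by positivity) _ _ _ (by norm_num) (by norm_num)
      · apply inv_le_one_of_one_le₀; linarith
      · have : (1600 * d)⁻¹ ≤ N2 / N1 := by
          rw [inv_eq_one_div, div_le_div_iff₀ (by positivity) hN1]; linarith
        linarith
    have h2 : 200 ≤ 3200000 * d * X ^ (1/8:ℝ) := by
      calc (200:ℝ) ≤ 3200000 * d * (1600 * d)⁻¹ := by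
            have : 3200000 * d * (1600 * d)⁻¹ = 2000 := by field_simp; norm_num
            linarith
        _ ≤ _ := by gcongr
    calc 200 * (5 * N2) ^ (m + n - 2) ≤ 3200000 * d * X ^ (1/8:ℝ) * (5 * N2) ^ (m + n - 2) := by gcongr
      _ = _ := by ring
  push Not at hK
  rcases (biSet N1 N2 ξ R).eq_empty_or_nonempty with he | ⟨κ, hκ⟩
  · rw [he]; simp
  have hN11 : 1 < N1 := by nlinarith
  have hξ : (N1/4)^2 ≤ nsq ξ := by
    have h1 := hκ.2.1.2 hN11
    have h2 := hκ.1.1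
    have h3 := nsq_sub_le ξ κ
    have h4 : 4800 * N2 ≤ N1 := by nlinarith
    nlinarith
  obtain ⟨b, hb⟩ := exists_large hm ξ (N1/4) (by positivity) hξ
  rw [← hdd] at hb
  have hb' : 400 * N2 ≤ |emb ξ b| := by
    refine le_trans ?_ hb
    rw [le_div_iff₀ (by linarith)]; linarith
  have hbpos : 0 < |emb ξ b| := by linarith
  have hbr : N2 / |emb ξ b| ≤ 4 * d * (N2 / N1) := by
    calc N2 / |emb ξ b| ≤ N2 / (N1 / 4 / d) := by gcongr
      _ = _ := by field_simp
  by_cases hba : b = Sum.inl ⟨0, hm⟩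
  · have h := bi_slice hm N1 N2 hN ξ R (by rw [← hba]; linarith)
    rw [← hba] at h
    refine h.trans ?_
    rw [← ENNReal.ofReal_pow (by positivity), ← ENNReal.ofReal_mul (by positivity)]
    apply ENNReal.ofReal_le_ofReal
    have e : m + n - 1 = (m + n - 2) + 1 := by omega
    rw [e, pow_succ]
    have h1 : N2 / N1 ≤ X ^ (1/8:ℝ) := le_rpow_eighth hr0 hr1 (by linarith) _ (by norm_num) (by norm_num)
    calc 8 / |emb ξ b| * ((5 * N2) ^ (m + n - 2) * (5 * N2)) = 40 * (N2 / |emb ξ b|) * (5 * N2) ^ (m + n - 2) := by ring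
      _ ≤ 40 * (4 * d * X ^ (1/8:ℝ)) * (5 * N2) ^ (m + n - 2) := by
          gcongr; exact hbr.trans (by gcongr)
      _ = 160 * (d * (5 * N2) ^ (m + n - 2) * X ^ (1/8:ℝ)) := by ring
      _ ≤ 3200000 * (d * (5 * N2) ^ (m + n - 2) * X ^ (1/8:ℝ)) := by gcongr; norm_num
      _ = _ := by ring
  · obtain ⟨e, hea, heb⟩ : ∃ e : Fin m ⊕ Fin n, e ≠ Sum.inl ⟨0, hm⟩ ∧ e ≠ b := by
      have : ∃ e ∈ (Finset.univ : Finset (Fin m ⊕ Fin n)), e ∉ ({Sum.inl ⟨0, hm⟩, b} : Finset _) := by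
        apply Finset.exists_mem_notMem_of_card_lt_card
        refine lt_of_le_of_lt Finset.card_le_two ?_
        simp; omega
      obtain ⟨e, _, he⟩ := this
      simp at he
      exact ⟨e, he.1, he.2⟩
    have h := biSet_le N1 N2 hN ξ R {e, b, Sum.inl ⟨0, hm⟩} _
      (fun v => marg3 (nuS m n) (nuS_tame m n) N2 hN (fun i => emb ξ i / 2) (R / 2 - nsq ξ / 4) (Sum.inl ⟨0, hm⟩) b e hba hea heb rfl (by
        rw [abs_div, abs_two]; linarith) v)
    refine h.trans ?_
    rw [Finset.card_insert_of_notMem (by simp [hea, heb]), Finset.card_pair hba,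
      ← ENNReal.ofReal_pow (by positivity), ← ENNReal.ofReal_mul (by positivity)]
    apply ENNReal.ofReal_le_ofReal
    rw [abs_div, abs_two]
    have e3 : m + n - 2 = (m + n - (2 + 1)) + 1 := by omega
    have h8 : (N2 / (|emb ξ b| / 2) + 1 / N2) ^ (1/8:ℝ) ≤ 8 * d * X ^ (1/8:ℝ) := by
      calc (N2 / (|emb ξ b| / 2) + 1 / N2) ^ (1/8:ℝ) ≤ (8 * d * X) ^ (1/8:ℝ) := by
            gcongr
            have : N2 / (|emb ξ b| / 2) = 2 * (N2 / |emb ξ b|) := by field_simp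
            rw [this, hX]
            nlinarith
        _ = (8 * d) ^ (1/8:ℝ) * X ^ (1/8:ℝ) := Real.mul_rpow (by positivity) hX0
        _ ≤ _ := by
            gcongr
            calc (8 * d) ^ (1/8:ℝ) ≤ (8 * d) ^ (1:ℝ) := Real.rpow_le_rpow_of_exponent_le (by linarith) (by norm_num)
              _ = 8 * d := by simp
    calc 400000 * (N2 * (N2 / (|emb ξ b| / 2) + 1 / N2) ^ (1/8:ℝ)) * (5 * N2) ^ (m + n - (2 + 1))
        ≤ 400000 * ((5 * N2) * (8 * d * X ^ (1/8:ℝ))) * (5 * N2) ^ (m + n - (2 + 1)) := by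
          gcongr; linarith
      _ = _ := by rw [e3, pow_succ]; ring

end

section
open MeasureTheory
open scoped ENNReal NNReal Classical

lemma muE_SN (m n : ℕ) (N : ℝ) (hN : 1 ≤ N) : muE m n (SN N) ≤ ENNReal.ofReal (5 * N) ^ (m + n) := by
  have hsub : SN (m := m) (n := n) N ⊆ emb ⁻¹' (Set.univ.pi (fun _ => {x : ℝ | |x| ≤ 2 * N})) := by
    intro κ hκ i _
    exact emb_le_of_nsq (by linarith) hκ.1 i
  refine (measure_mono hsub).trans ?_
  have hm : MeasurableSet {x : ℝ | |x| ≤ 2 * N} := measurableSet_le (by fun_prop) (by fun_prop)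
  rw [← Measure.map_apply emb_meas (MeasurableSet.univ_pi fun _ => hm), map_emb, Measure.pi_pi]
  calc ∏ i, nuS m n i {x | |x| ≤ 2 * N} ≤ ∏ i : Fin m ⊕ Fin n, ENNReal.ofReal (5 * N) :=
        Finset.prod_le_prod' fun i _ => tame_box (nuS_tame m n i) N hN
    _ = _ := by simp

def triSet {m n : ℕ} (N1 N2 N3 : ℝ) (ξ : EE m n) (R : ℝ) : Set (EE m n × EE m n) :=
  {p | (p.1 ∈ SN N2 ∧ p.2 ∈ SN N3) ∧ ξ - (p.1 + p.2) ∈ SN N1 ∧ |nsq (ξ - (p.1 + p.2)) + (nsq p.1 + nsq p.2) - R| ≤ 1}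

lemma triSet_meas {m n : ℕ} (N1 N2 N3 : ℝ) (ξ : EE m n) (R : ℝ) : MeasurableSet (triSet N1 N2 N3 ξ R) := by
  have h1 : MeasurableSet {p : EE m n × EE m n | p.1 ∈ SN N2} := measurable_fst (SN_meas N2)
  have h2 : MeasurableSet {p : EE m n × EE m n | p.2 ∈ SN N3} := measurable_snd (SN_meas N3)
  have hs : Measurable (fun p : EE m n × EE m n => ξ - (p.1 + p.2)) := by fun_prop
  have h3 : MeasurableSet {p : EE m n × EE m n | ξ - (p.1 + p.2) ∈ SN N1} := hs (SN_meas N1)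
  have hn := nsq_meas (m := m) (n := n)
  have h4 : MeasurableSet {p : EE m n × EE m n | |nsq (ξ - (p.1 + p.2)) + (nsq p.1 + nsq p.2) - R| ≤ 1} :=
    measurableSet_le (by fun_prop) (by fun_prop)
  exact (h1.inter h2).inter (h3.inter h4)

lemma tri_fiber {m n : ℕ} (N1 N2 N3 : ℝ) (hN3 : 1 ≤ N3) (ξ : EE m n) (R : ℝ) (B : ℝ≥0∞)
    (hB : ∀ κ3 ∈ SN (m := m) (n := n) N3, muE m n (biSet N1 N2 (ξ - κ3) (R - nsq κ3)) ≤ B) :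
    ((muE m n).prod (muE m n)) (triSet N1 N2 N3 ξ R) ≤ B * ENNReal.ofReal (5 * N3) ^ (m + n) := by
  rw [Measure.prod_apply_symm (triSet_meas _ _ _ _ _)]
  calc _ ≤ ∫⁻ κ3, (SN N3).indicator (fun _ => B) κ3 ∂(muE m n) := by
        apply lintegral_mono
        intro κ3
        by_cases h3 : κ3 ∈ SN (m := m) (n := n) N3
        · rw [Set.indicator_of_mem h3]
          refine le_trans (measure_mono ?_) (hB κ3 h3)
          rintro κ2 ⟨⟨h1, h2⟩, h4, h5⟩
          have e : ξ - (κ2 + κ3) = ξ - κ3 - κ2 := by abel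
          simp only [e] at h4 h5
          refine ⟨h1, h4, ?_⟩
          convert h5 using 2; ring
        · rw [Set.indicator_of_notMem h3]
          apply le_of_eq
          convert measure_empty (μ := muE m n)
          rw [Set.eq_empty_iff_forall_notMem]
          rintro κ2 ⟨⟨h1, h2⟩, h4, h5⟩
          exact h3 h2
    _ = B * muE m n (SN N3) := by rw [lintegral_indicator_const (SN_meas N3)]
    _ ≤ _ := by gcongr; exact muE_SN m n N3 hN3

lemma vol_fun1 (s : Set ℝ) (hs : MeasurableSet s) : volume {ζ : Fin 1 → ℝ | ζ 0 ∈ s} = volume s := by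
  have := (volume_preserving_funUnique (Fin 1) ℝ).measure_preimage hs.nullMeasurableSet
  rw [← this]
  rfl

lemma sq_bound_of_SN {N : ℝ} (hN : 0 ≤ N) {κ : EE 1 1} (h : κ ∈ SN N) : |κ.1 0| ≤ 2 * N ∧ |(κ.2 0 : ℝ)| ≤ 2 * N :=
  ⟨emb_le_of_nsq hN h.1 (Sum.inl 0), emb_le_of_nsq hN h.1 (Sum.inr 0)⟩

lemma tri_int (N1 N2 N3 : ℝ) (hN3 : 1 ≤ N3) (hN2 : N3 ≤ N2) (ξ : EE 1 1) (R : ℝ)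
    (hD : 150 * N2 ≤ |(ξ.2 0 : ℝ)|) :
    ((muE 1 1).prod (muE 1 1)) (triSet N1 N2 N3 ξ R) ≤
      ENNReal.ofReal (200000 * (N2 * (N2 / |2 * (ξ.2 0 : ℝ) / 3| + 1 / N2) ^ (1/8:ℝ)) * (4 * N3)) := by
  have hmeas := triSet_meas N1 N2 N3 ξ R
  have hN20 : 0 < N2 := by linarith
  set B : ℝ := 200000 * (N2 * (N2 / |2 * (ξ.2 0 : ℝ) / 3| + 1 / N2) ^ (1/8:ℝ)) with hBdef
  have hB0 : 0 ≤ B := by positivity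
  set f : EE 1 1 × EE 1 1 → ℝ≥0∞ := (triSet N1 N2 N3 ξ R).indicator 1 with hf
  have hfm : Measurable f := measurable_one.indicator hmeas
  rw [← lintegral_indicator_one hmeas, lintegral_prod_symm _ hfm.aemeasurable]
  have step : ∀ ζ3 : Fin 1 → ℝ, ∑' j3 : Fin 1 → ℤ, ∫⁻ κ2, f (κ2, (ζ3, j3)) ∂(muE 1 1) ≤
      ({ζ : Fin 1 → ℝ | ζ 0 ∈ Set.Icc (-(2 * N3)) (2 * N3)}).indicator (fun _ => ENNReal.ofReal B) ζ3 := by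
    intro ζ3
    by_cases hz3 : ζ3 0 ∈ Set.Icc (-(2 * N3)) (2 * N3)
    · rw [Set.indicator_of_mem (by exact hz3)]
      have e1 : ∀ j3 : Fin 1 → ℤ, ∫⁻ κ2, f (κ2, (ζ3, j3)) ∂(muE 1 1) = ∑' j2 : Fin 1 → ℤ, ∫⁻ ζ2 : Fin 1 → ℝ, f ((ζ2, j2), (ζ3, j3)) := by
        intro j3
        have : Measurable (fun κ2 => f (κ2, (ζ3, j3))) := hfm.comp (by fun_prop)
        rw [muE, lintegral_prod_symm _ this.aemeasurable, lintegral_count]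
      simp_rw [e1]
      rw [← ENNReal.tsum_prod (f := fun (j3 j2 : Fin 1 → ℤ) => ∫⁻ ζ2 : Fin 1 → ℝ, f ((ζ2, j2), (ζ3, j3))), ENNReal.tsum_eq_iSup_sum]
      apply iSup_le
      intro S
      set R' : ℝ := 2 * R - (ξ.1 0 - ζ3 0)^2 - 2 * (ζ3 0)^2 - (2/3) * (ξ.2 0 : ℝ)^2 with hR'
      set L : ℤ := ⌊4 * N2⌋
      set A : Finset ℤ := Finset.Icc (-L) L with hAdef
      have hA : ∀ j ∈ A, |(j:ℝ)| ≤ 4 * N2 := by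
        intro j hj
        rw [hAdef, Finset.mem_Icc] at hj
        have h3 : (L:ℝ) ≤ 4 * N2 := Int.floor_le _
        have h4 : (-L:ℝ) ≤ j := by exact_mod_cast hj.1
        have h5 : (j:ℝ) ≤ L := by exact_mod_cast hj.2
        rw [abs_le]; constructor <;> linarith
      have hA' : ∀ j : ℤ, |(j:ℝ)| ≤ 4 * N2 → j ∈ A := by
        intro j hj
        rw [hAdef, Finset.mem_Icc]
        have := abs_le.1 hj
        constructor
        · have : -j ≤ L := Int.le_floor.2 (by push_cast; linarith)
          linarith
        · exact Int.le_floor.2 (by linarith)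
      let φ : (Fin 1 → ℤ) × (Fin 1 → ℤ) → ℤ × ℤ := fun p => (p.2 0 - p.1 0, p.2 0 + p.1 0)
      have hφ : Function.Injective φ := by
        rintro ⟨a, b⟩ ⟨a', b'⟩ h
        simp only [φ, Prod.mk.injEq] at h
        have h1 : a 0 = a' 0 := by omega
        have h2 : b 0 = b' 0 := by omega
        rw [Prod.mk.injEq]
        constructor <;> (ext i; fin_cases i; assumption)
      let W : ℤ × ℤ → ℝ := fun p => wt (R' - (((p.1:ℝ) - 0)^2 + (3:ℕ) * ((p.2:ℝ) - 2 * (ξ.2 0 : ℝ) / 3)^2))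
      have hterm : ∀ p : (Fin 1 → ℤ) × (Fin 1 → ℤ), ∫⁻ ζ2 : Fin 1 → ℝ, f ((ζ2, p.2), (ζ3, p.1)) ≤
          if φ p ∈ A ×ˢ A then ENNReal.ofReal (W (φ p)) else 0 := by
        rintro ⟨j3, j2⟩
        split_ifs with hmem
        · refine le_trans ?_ (slice1 4 (by norm_num) ((ξ.1 0 - ζ3 0)/2) _)
          have hms : MeasurableSet {z : ℝ | |4 * (z - (ξ.1 0 - ζ3 0)/2)^2 - (R' - ((((φ (j3, j2)).1:ℝ) - 0)^2 + (3:ℕ) * (((φ (j3, j2)).2:ℝ) - 2 * (ξ.2 0 : ℝ) / 3)^2))| ≤ 2} :=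
            measurableSet_le (by fun_prop) (by fun_prop)
          rw [← vol_fun1 _ hms]
          have hms' : MeasurableSet {ζ : Fin 1 → ℝ | ζ 0 ∈ {z : ℝ | |4 * (z - (ξ.1 0 - ζ3 0)/2)^2 - (R' - ((((φ (j3, j2)).1:ℝ) - 0)^2 + (3:ℕ) * (((φ (j3, j2)).2:ℝ) - 2 * (ξ.2 0 : ℝ) / 3)^2))| ≤ 2}} :=
            (measurable_pi_apply 0) hms
          rw [← lintegral_indicator_one hms']
          apply lintegral_mono
          intro ζ2
          by_cases hx : ((ζ2, j2), (ζ3, j3)) ∈ triSet N1 N2 N3 ξ R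
          · rw [Set.indicator_of_mem]
            · exact Set.indicator_le_self' (by simp) _
            · have h5 := hx.2.2
              change |4 * (ζ2 0 - (ξ.1 0 - ζ3 0)/2)^2 - (R' - ((((φ (j3, j2)).1:ℝ) - 0)^2 + (3:ℕ) * (((φ (j3, j2)).2:ℝ) - 2 * (ξ.2 0 : ℝ) / 3)^2))| ≤ 2
              simp only [nsq, Finset.univ_unique, Fin.default_eq_zero, Finset.sum_singleton, Prod.fst_sub, Prod.snd_sub,
                Prod.fst_add, Prod.snd_add, Pi.sub_apply, Pi.add_apply] at h5
              have h6 := abs_le.1 h5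
              push_cast at h6
              simp only [φ, hR']
              push_cast
              rw [abs_le]
              constructor <;> nlinarith
          · simp [hf, hx]
        · apply le_of_eq
          refine (lintegral_congr (g := fun _ => 0) fun ζ2 => ?_).trans lintegral_zero
          simp only [hf]
          apply Set.indicator_of_notMem
          intro hx
          apply hmem
          have h1 := abs_le.1 (sq_bound_of_SN (by linarith) hx.1.1).2
          have h2 := abs_le.1 (sq_bound_of_SN (by linarith) hx.1.2).2
          simp only at h1 h2
          rw [Finset.mem_product]
          constructor
          · apply hA'; simp only [φ]; push_cast; rw [abs_le]; constructor <;> linarith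
          · apply hA'; simp only [φ]; push_cast; rw [abs_le]; constructor <;> linarith
      calc _ ≤ ∑ p ∈ S, (if φ p ∈ A ×ˢ A then ENNReal.ofReal (W (φ p)) else 0) := Finset.sum_le_sum fun p _ => hterm p
        _ = ∑ q ∈ S.image φ, (if q ∈ A ×ˢ A then ENNReal.ofReal (W q) else 0) := by
            rw [Finset.sum_image (fun x _ y _ h => hφ h)]
        _ ≤ ∑ q ∈ A ×ˢ A, ENNReal.ofReal (W q) := by
            rw [← Finset.sum_filter]
            exact Finset.sum_le_sum_of_subset (fun q hq => (Finset.mem_filter.1 hq).2)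
        _ ≤ ENNReal.ofReal B := by
            rw [← ENNReal.ofReal_sum_of_nonneg (fun _ _ => wt_nonneg _)]
            apply ENNReal.ofReal_le_ofReal
            have h100 : 100 * N2 ≤ |2 * (ξ.2 0 : ℝ) / 3| := by
              rw [abs_div, abs_mul, abs_two, abs_of_pos (by norm_num : (0:ℝ) < 3)]; linarith
            exact core' 3 (by norm_num) le_rfl 0 (2 * (ξ.2 0 : ℝ) / 3) R' N2 (by linarith) h100 (by simp) A hA
    · rw [Set.indicator_of_notMem (by exact hz3)]
      apply le_of_eq
      rw [ENNReal.tsum_eq_zero]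
      intro j3
      refine (lintegral_congr (g := fun _ => 0) fun κ2 => ?_).trans lintegral_zero
      simp only [hf]
      apply Set.indicator_of_notMem
      intro hx
      have h2 := abs_le.1 (sq_bound_of_SN (by linarith) hx.1.2).1
      exact hz3 h2
  have hm2 : Measurable (fun κ3 => ∫⁻ κ2, f (κ2, κ3) ∂(muE 1 1)) := hfm.lintegral_prod_left'
  conv_lhs => rw [muE, lintegral_prod _ (by rw [← muE]; exact hm2.aemeasurable)]
  simp_rw [lintegral_count]
  refine (lintegral_mono step).trans ?_
  have hmI : MeasurableSet {ζ : Fin 1 → ℝ | ζ 0 ∈ Set.Icc (-(2 * N3)) (2 * N3)} := (measurable_pi_apply 0) measurableSet_Icc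
  rw [lintegral_indicator_const hmI, vol_fun1 _ measurableSet_Icc, Real.volume_Icc, ← ENNReal.ofReal_mul hB0]
  apply le_of_eq; congr 2; ring

lemma nsq_add_le {m n : ℕ} (ξ κ : EE m n) : nsq (ξ + κ) ≤ 2 * nsq ξ + 2 * nsq κ := by
  rw [nsq_emb, nsq_emb, nsq_emb, Finset.mul_sum, Finset.mul_sum, ← Finset.sum_add_distrib]
  apply Finset.sum_le_sum
  intro i _
  rw [emb_add]; nlinarith [sq_nonneg (emb ξ i - emb κ i)]

lemma min_geom {a b X : ℝ} (ha : 0 < a) (ha1 : a ≤ 1) (hb : 0 < b) (hX : a * b ≤ X) :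
    min a (b ^ (1/8:ℝ)) ≤ X ^ (1/16:ℝ) := by
  rcases le_total a b with h | h
  · refine (min_le_left _ _).trans ?_
    calc a ≤ a ^ (1/8:ℝ) := by
          nth_rewrite 1 [← Real.rpow_one a]
          exact Real.rpow_le_rpow_of_exponent_ge ha ha1 (by norm_num)
      _ = (a^2) ^ (1/16:ℝ) := by rw [← Real.rpow_natCast, ← Real.rpow_mul ha.le]; norm_num
      _ ≤ _ := Real.rpow_le_rpow (by positivity) (by nlinarith) (by norm_num)
  · refine (min_le_right _ _).trans ?_
    calc b ^ (1/8:ℝ) = (b^2) ^ (1/16:ℝ) := by rw [← Real.rpow_natCast, ← Real.rpow_mul hb.le]; norm_num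
      _ ≤ _ := Real.rpow_le_rpow (by positivity) (by nlinarith) (by norm_num)

lemma two_rpow_le (X : ℝ) (hX : 0 ≤ X) (c η : ℝ) (hc : 1 ≤ c) (h1 : η ≤ 1) : (c * X) ^ η ≤ c * X ^ η := by
  rw [Real.mul_rpow (by linarith) hX]
  gcongr
  calc c ^ η ≤ c ^ (1:ℝ) := Real.rpow_le_rpow_of_exponent_le hc h1
    _ = c := by simp

lemma tri_arith {N1 N2 N3 : ℝ} (hN3 : 1 ≤ N3) (hN2 : N3 ≤ N2) (hN1 : N2 ≤ N1) :
    min (N3 / N2) ((N2 / N1 + 1 / N2) ^ (1/8:ℝ)) ≤ 4 * (N3 / N1 + 1 / N2) ^ (1/16:ℝ) := by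
  have h1 : 0 < N1 := by linarith
  have h2 : 0 < N2 := by linarith
  have h3 : 0 < N3 := by linarith
  set X := N3 / N1 + 1 / N2 with hX
  have hp1 : 0 ≤ N3 / N1 := by positivity
  have hp2 : 0 ≤ 1 / N2 := by positivity
  have hX0 : 0 < X := by positivity
  rcases le_total (N2 / N1) (1 / N2) with h | h
  · refine (min_le_right _ _).trans ?_
    have hi : 1 / N2 ≤ 1 := by rw [div_le_one h2]; linarith
    calc (N2 / N1 + 1 / N2) ^ (1/8:ℝ) ≤ (2 * (1 / N2)) ^ (1/8:ℝ) := by gcongr; linarith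
      _ ≤ 2 * (1 / N2) ^ (1/8:ℝ) := two_rpow_le _ hp2 _ _ (by norm_num) (by norm_num)
      _ ≤ 2 * (1 / N2) ^ (1/16:ℝ) := by
          gcongr 2 * ?_
          exact Real.rpow_le_rpow_of_exponent_ge (by positivity) hi (by norm_num)
      _ ≤ 4 * X ^ (1/16:ℝ) := by
          gcongr
          · norm_num
          · linarith
  · have hm := min_geom (a := N3 / N2) (b := N2 / N1) (X := X) (by positivity) ((div_le_one h2).2 hN2) (by positivity) (by
      have : N3 / N2 * (N2 / N1) = N3 / N1 := by field_simp
      linarith)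
    have h5 : (N2 / N1 + 1 / N2) ^ (1/8:ℝ) ≤ 2 * (N2 / N1) ^ (1/8:ℝ) := by
      calc _ ≤ (2 * (N2 / N1)) ^ (1/8:ℝ) := by gcongr; linarith
        _ ≤ _ := two_rpow_le _ (by positivity) _ _ (by norm_num) (by norm_num)
    have h6 : 0 ≤ X ^ (1/16:ℝ) := by positivity
    rcases min_le_iff.1 hm with h7 | h7
    · exact (min_le_left _ _).trans (by linarith)
    · exact (min_le_right _ _).trans (by linarith)

lemma tri_count (N1 N2 N3 : ℝ) (hN3 : 1 ≤ N3) (hN2 : N3 ≤ N2) (hN1 : N2 ≤ N1) (ξ : EE 1 1) (R : ℝ) :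
    ((muE 1 1).prod (muE 1 1)) (triSet N1 N2 N3 ξ R) ≤
      ENNReal.ofReal (40000000 * (N2 * N3) * (N3 / N1 + 1 / N2) ^ (1/16:ℝ)) := by
  have h1 : 0 < N1 := by linarith
  have h2 : 0 < N2 := by linarith
  have h3 : 0 < N3 := by linarith
  set X := N3 / N1 + 1 / N2 with hX
  have hp1 : 0 ≤ N3 / N1 := by positivity
  have hp2 : 0 ≤ 1 / N2 := by positivity
  have hX0 : 0 < X := by positivity
  have b1 : ((muE 1 1).prod (muE 1 1)) (triSet N1 N2 N3 ξ R) ≤ ENNReal.ofReal (5000 * (N2 * N3) * (N3 / N2)) := by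
    have h := tri_fiber N1 N2 N3 hN3 ξ R 200 (fun κ3 _ => by
      simpa using bi_nogain (m := 1) (n := 1) le_rfl le_rfl N1 N2 (by linarith) (ξ - κ3) (R - nsq κ3))
    refine h.trans (le_of_eq ?_)
    have e : (200 : ℝ≥0∞) = ENNReal.ofReal 200 := by simp
    rw [e, ← ENNReal.ofReal_pow (by positivity), ← ENNReal.ofReal_mul (by norm_num)]
    congr 1; field_simp; norm_num; ring
  by_cases hK : N1 < 2000 * N2
  · refine b1.trans (ENNReal.ofReal_le_ofReal ?_)
    have h4 : N3 / N2 / 2000 ≤ X ^ (1/16:ℝ) := by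
      apply le_rpow_eighth (by positivity) _ _ _ (by norm_num) (by norm_num)
      · have := (div_le_one h2).2 hN2
        linarith
      · have : N3 / N2 / 2000 ≤ N3 / N1 := by
          rw [div_div]; gcongr; linarith
        linarith
    calc 5000 * (N2 * N3) * (N3 / N2) = 10000000 * (N2 * N3) * (N3 / N2 / 2000) := by ring
      _ ≤ 10000000 * (N2 * N3) * X ^ (1/16:ℝ) := by gcongr
      _ ≤ _ := by gcongr; norm_num
  push Not at hK
  rcases (triSet N1 N2 N3 ξ R).eq_empty_or_nonempty with he | ⟨⟨κ2, κ3⟩, hκ⟩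
  · rw [he]; simp
  have hN11 : 1 < N1 := by linarith
  have hξ : (N1/4)^2 ≤ nsq ξ := by
    have k1 := hκ.2.1.2 hN11
    have k2 := hκ.1.1.1
    have k3 := hκ.1.2.1
    have k4 := nsq_sub_le ξ (κ2 + κ3)
    have k5 := nsq_add_le κ2 κ3
    simp only at k1 k2 k3
    nlinarith
  obtain ⟨b, hb⟩ := exists_large le_rfl ξ (N1/4) (by positivity) hξ
  norm_num at hb
  rcases b with b | b
  · have hb0 : b = 0 := Subsingleton.elim _ _
    subst hb0
    have hlow : ∀ κ3 ∈ SN (m := 1) (n := 1) N3, N1 / 16 ≤ |emb (ξ - κ3) (Sum.inl 0)| := by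
      intro κ3 h
      rw [emb_sub]
      have k1 := emb_le_of_nsq (by linarith) h.1 (Sum.inl 0)
      have k2 := abs_sub_abs_le_abs_sub (emb ξ (Sum.inl 0)) (emb κ3 (Sum.inl 0))
      linarith
    have h := tri_fiber N1 N2 N3 hN3 ξ R (ENNReal.ofReal (640 * (N2 / N1))) (fun κ3 hk => by
      have k0 := hlow κ3 hk
      have k1 := bi_slice (m := 1) (n := 1) le_rfl N1 N2 (by linarith) (ξ - κ3) (R - nsq κ3) (by
        refine le_trans ?_ k0
        linarith)
      refine k1.trans ?_
      rw [← ENNReal.ofReal_pow (by positivity), ← ENNReal.ofReal_mul (by positivity)]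
      apply ENNReal.ofReal_le_ofReal
      calc 8 / |emb (ξ - κ3) (Sum.inl 0)| * (5 * N2) ^ (1 + 1 - 1) ≤ 8 / (N1 / 16) * (5 * N2) ^ (1 + 1 - 1) := by gcongr
        _ = _ := by norm_num; field_simp; norm_num)
    refine h.trans ?_
    rw [← ENNReal.ofReal_pow (by positivity), ← ENNReal.ofReal_mul (by positivity)]
    apply ENNReal.ofReal_le_ofReal
    have h4 : N3 / N1 ≤ X ^ (1/16:ℝ) := by
      apply le_rpow_eighth (by positivity) _ _ _ (by norm_num) (by norm_num)
      · rw [div_le_one h1]; linarith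
      · linarith
    calc 640 * (N2 / N1) * (5 * N3) ^ (1 + 1) = 16000 * (N2 * N3) * (N3 / N1) := by ring
      _ ≤ 16000 * (N2 * N3) * X ^ (1/16:ℝ) := by gcongr
      _ ≤ _ := by gcongr; norm_num
  · have hb0 : b = 0 := Subsingleton.elim _ _
    subst hb0
    have hb' : N1 / 8 ≤ |(ξ.2 0 : ℝ)| := by
      have : emb ξ (Sum.inr 0) = (ξ.2 0 : ℝ) := rfl
      rw [this] at hb; linarith
    have h := tri_int N1 N2 N3 hN3 hN2 ξ R (by linarith)
    have b2 : ((muE 1 1).prod (muE 1 1)) (triSet N1 N2 N3 ξ R) ≤ ENNReal.ofReal (9600000 * (N2 * N3) * (N2 / N1 + 1 / N2) ^ (1/8:ℝ)) := by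
      refine h.trans (ENNReal.ofReal_le_ofReal ?_)
      have h5 : (N2 / |2 * (ξ.2 0 : ℝ) / 3| + 1 / N2) ^ (1/8:ℝ) ≤ 12 * (N2 / N1 + 1 / N2) ^ (1/8:ℝ) := by
        refine le_trans ?_ (two_rpow_le _ (by positivity) 12 _ (by norm_num) (by norm_num))
        gcongr
        have : N2 / |2 * (ξ.2 0 : ℝ) / 3| ≤ N2 / (N1 / 12) := by
          gcongr
          rw [abs_div, abs_mul, abs_two, abs_of_pos (by norm_num : (0:ℝ) < 3)]; linarith
        have e : N2 / (N1 / 12) = 12 * (N2 / N1) := by field_simp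
        linarith
      calc _ ≤ 200000 * (N2 * (12 * (N2 / N1 + 1 / N2) ^ (1/8:ℝ))) * (4 * N3) := by gcongr
        _ = _ := by ring
    have h6 := tri_arith hN3 hN2 hN1
    have h7 : 0 ≤ N2 * N3 := by positivity
    have h8 : 0 ≤ X ^ (1/16:ℝ) := by positivity
    rcases min_le_iff.1 h6 with h9 | h9
    · refine b1.trans (ENNReal.ofReal_le_ofReal ?_)
      calc 5000 * (N2 * N3) * (N3 / N2) ≤ 5000 * (N2 * N3) * (4 * X ^ (1/16:ℝ)) := by gcongr
        _ = 20000 * ((N2 * N3) * X ^ (1/16:ℝ)) := by ring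
        _ ≤ 40000000 * ((N2 * N3) * X ^ (1/16:ℝ)) := by gcongr; norm_num
        _ = _ := by ring
    · refine b2.trans (ENNReal.ofReal_le_ofReal ?_)
      calc 9600000 * (N2 * N3) * (N2 / N1 + 1 / N2) ^ (1/8:ℝ) ≤ 9600000 * (N2 * N3) * (4 * X ^ (1/16:ℝ)) := by gcongr
        _ = 38400000 * ((N2 * N3) * X ^ (1/16:ℝ)) := by ring
        _ ≤ 40000000 * ((N2 * N3) * X ^ (1/16:ℝ)) := by gcongr; norm_num
        _ = _ := by ring

end

section
open MeasureTheory
open scoped ENNReal NNReal Classical ComplexConjugate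

lemma ennreal_amgm (a b : ℝ≥0∞) : a * b ≤ (a^2 + b^2) / 2 := by
  rw [ENNReal.le_div_iff_mul_le (by simp) (by simp)]
  induction a with
  | top => simp
  | coe a =>
    induction b with
    | top => simp
    | coe b =>
      norm_cast
      have := two_mul_le_add_sq (a:ℝ) b
      rw [← NNReal.coe_le_coe]; push_cast; linarith

lemma schur {Ω X : Type*} [MeasurableSpace Ω] [MeasurableSpace X] (P : Measure Ω) [IsFiniteMeasure P]
    (μ : Measure X) [SFinite μ] (e : Ω → X → ℂ) (he : Measurable (Function.uncurry e)) (he1 : ∀ ω x, ‖e ω x‖ = 1)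
    (h : X → ℂ) (hh : AEStronglyMeasurable h μ) (K : X → X → ℝ≥0∞) (hKm : Measurable (Function.uncurry K))
    (hKs : ∀ x x', K x x' = K x' x) (hK : ∀ x x', ‖∫ ω, e ω x * conj (e ω x') ∂P‖ₑ ≤ K x x') (A : ℝ≥0∞)
    (hA : ∀ᵐ x ∂μ, ∫⁻ x', K x x' ∂μ ≤ A) :
    ∫⁻ ω, ‖∫ x, h x * e ω x ∂μ‖ₑ^2 ∂P ≤ A * ∫⁻ x, ‖h x‖ₑ^2 ∂μ := by
  by_cases hInt : Integrable h μ
  swap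
  · have : ∀ ω, ∫ x, h x * e ω x ∂μ = 0 := by
      intro ω
      apply integral_undef
      intro hc
      apply hInt
      have hm : Measurable (e ω) := he.comp measurable_prodMk_left
      have h2 : Integrable (fun x => (h x * e ω x) * conj (e ω x)) μ := by
        apply hc.mul_bdd (c := 1)
        · exact (Complex.continuous_conj.measurable.comp hm).aestronglyMeasurable
        · exact Filter.Eventually.of_forall (fun x => by simp [he1])
      refine h2.congr (Filter.Eventually.of_forall fun x => ?_)
      simp only
      rw [mul_assoc, Complex.mul_conj, Complex.normSq_eq_norm_sq, he1]; simp
    simp [this]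
  have hc : Integrable (fun p : X × X => h p.1 * conj (h p.2)) (μ.prod μ) := by
    apply hInt.mul_prod (g := fun x => conj (h x))
    exact (Complex.conjCLE.toContinuousLinearMap).integrable_comp hInt
  have hem1 : Measurable (fun q : Ω × (X × X) => e q.1 q.2.1) := he.comp (f := fun q : Ω × (X × X) => (q.1, q.2.1)) (by fun_prop)
  have hem2 : Measurable (fun q : Ω × (X × X) => conj (e q.1 q.2.2)) :=
    Complex.continuous_conj.measurable.comp (he.comp (f := fun q : Ω × (X × X) => (q.1, q.2.2)) (by fun_prop))
  have hbig : Integrable (fun q : Ω × (X × X) => (h q.2.1 * conj (h q.2.2)) * (e q.1 q.2.1 * conj (e q.1 q.2.2))) (P.prod (μ.prod μ)) := by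
    apply Integrable.mul_bdd (c := 1)
    · exact hc.comp_snd P
    · exact (hem1.mul hem2).aestronglyMeasurable
    · exact Filter.Eventually.of_forall (fun x => by simp [he1])
  have hpt : ∀ ω, ∫ p : X × X, (h p.1 * conj (h p.2)) * (e ω p.1 * conj (e ω p.2)) ∂(μ.prod μ) = ((‖∫ x, h x * e ω x ∂μ‖^2 : ℝ) : ℂ) := by
    intro ω
    have : ∀ p : X × X, (h p.1 * conj (h p.2)) * (e ω p.1 * conj (e ω p.2)) = (h p.1 * e ω p.1) * (conj (h p.2 * e ω p.2)) := by
      intro p; simp only [map_mul]; ring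
    simp_rw [this]
    rw [integral_prod_mul (fun x => h x * e ω x) (fun x => conj (h x * e ω x)), integral_conj, Complex.mul_conj, Complex.normSq_eq_norm_sq]
  have hInt2 : Integrable (fun ω => ((‖∫ x, h x * e ω x ∂μ‖^2 : ℝ) : ℂ)) P := by
    refine hbig.integral_prod_left.congr (Filter.Eventually.of_forall fun ω => ?_)
    exact hpt ω
  have hInt3 : Integrable (fun ω => (‖∫ x, h x * e ω x ∂μ‖^2 : ℝ)) P := by
    have := hInt2.re
    refine this.congr (Filter.Eventually.of_forall fun ω => ?_)
    exact Complex.ofReal_re _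
  have e1 : ∫⁻ ω, ‖∫ x, h x * e ω x ∂μ‖ₑ^2 ∂P = ‖∫ ω, ((‖∫ x, h x * e ω x ∂μ‖^2 : ℝ) : ℂ) ∂P‖ₑ := by
    rw [integral_complex_ofReal]
    have h0 : 0 ≤ ∫ ω, (‖∫ x, h x * e ω x ∂μ‖^2 : ℝ) ∂P := integral_nonneg fun ω => by positivity
    rw [← ofReal_norm]
    rw [Complex.norm_real, Real.norm_of_nonneg h0, ofReal_integral_eq_lintegral_ofReal hInt3 (Filter.Eventually.of_forall fun ω => by positivity)]
    apply lintegral_congr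
    intro ω
    rw [ENNReal.ofReal_pow (norm_nonneg _), ofReal_norm]
  rw [e1]
  simp_rw [← hpt]
  rw [integral_integral_swap hbig]
  calc _ ≤ ∫⁻ p : X × X, ‖∫ ω, h p.1 * conj (h p.2) * (e ω p.1 * conj (e ω p.2)) ∂P‖ₑ ∂(μ.prod μ) := enorm_integral_le_lintegral_enorm _
    _ ≤ ∫⁻ p : X × X, (‖h p.1‖ₑ^2 + ‖h p.2‖ₑ^2) / 2 * K p.1 p.2 ∂(μ.prod μ) := by
        apply lintegral_mono
        intro p
        simp only
        rw [integral_const_mul, enorm_mul, enorm_mul]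
        gcongr
        · have : ‖conj (h p.2)‖ₑ = ‖h p.2‖ₑ := by
            rw [← ofReal_norm, ← ofReal_norm, RCLike.norm_conj]
          rw [this]; exact ennreal_amgm _ _
        · exact hK _ _
    _ = ∫⁻ p : X × X, (‖h p.1‖ₑ^2 / 2 * K p.1 p.2 + ‖h p.2‖ₑ^2 / 2 * K p.1 p.2) ∂(μ.prod μ) := by
        apply lintegral_congr; intro p
        rw [ENNReal.add_div, add_mul]
    _ = ∫⁻ p : X × X, ‖h p.1‖ₑ^2 / 2 * K p.1 p.2 ∂(μ.prod μ) + ∫⁻ p : X × X, ‖h p.2‖ₑ^2 / 2 * K p.1 p.2 ∂(μ.prod μ) := by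
        apply lintegral_add_left'
        have : AEMeasurable (fun p : X × X => ‖h p.1‖ₑ^2 / 2) (μ.prod μ) := ((hh.comp_fst (ν := μ)).enorm.pow_const 2).div_const 2
        exact this.mul hKm.aemeasurable
    _ = ∫⁻ p : X × X, ‖h p.1‖ₑ^2 / 2 * K p.1 p.2 ∂(μ.prod μ) + ∫⁻ p : X × X, ‖h p.1‖ₑ^2 / 2 * K p.1 p.2 ∂(μ.prod μ) := by
        congr 1
        rw [← lintegral_prod_swap]
        apply lintegral_congr; intro p
        simp [hKs p.2 p.1]
    _ ≤ (A * ∫⁻ x, ‖h x‖ₑ^2 ∂μ) / 2 + (A * ∫⁻ x, ‖h x‖ₑ^2 ∂μ) / 2 := by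
        have : ∫⁻ p : X × X, ‖h p.1‖ₑ^2 / 2 * K p.1 p.2 ∂(μ.prod μ) ≤ (A * ∫⁻ x, ‖h x‖ₑ^2 ∂μ) / 2 := by
          rw [lintegral_prod _ (by
            have : AEMeasurable (fun p : X × X => ‖h p.1‖ₑ^2 / 2) (μ.prod μ) := ((hh.comp_fst (ν := μ)).enorm.pow_const 2).div_const 2
            exact this.mul hKm.aemeasurable)]
          calc _ = ∫⁻ x, ‖h x‖ₑ^2 / 2 * ∫⁻ x', K x x' ∂μ ∂μ := by
                apply lintegral_congr; intro x
                simp only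
                exact lintegral_const_mul _ (hKm.comp measurable_prodMk_left)
            _ ≤ ∫⁻ x, (A / 2) * ‖h x‖ₑ^2 ∂μ := by
                apply lintegral_mono_ae
                filter_upwards [hA] with x hx
                calc _ ≤ ‖h x‖ₑ^2 / 2 * A := by gcongr
                  _ = _ := by rw [div_eq_mul_inv, div_eq_mul_inv]; ring
            _ = _ := by
                rw [lintegral_const_mul'' _ (hh.enorm.pow_const 2), div_eq_mul_inv, div_eq_mul_inv]; ring
        gcongr
    _ = _ := ENNReal.add_halves _

end

section
open MeasureTheory
open scoped ENNReal NNReal Classical ComplexConjugate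

lemma torus_orth1 (k : ℤ) : ∫ θ in Set.Icc (0:ℝ) (2*Real.pi*1), Complex.exp (Complex.I * ((θ * k : ℝ) : ℂ)) = if k = 0 then ((2*Real.pi : ℝ):ℂ) else 0 := by
  rw [integral_Icc_eq_integral_Ioc, ← intervalIntegral.integral_of_le (by positivity)]
  split_ifs with h
  · subst h; simp
  · have hk : (Complex.I * (k:ℂ)) ≠ 0 := by
      simp [h]
    have : ∀ θ : ℝ, Complex.exp (Complex.I * ((θ * k : ℝ) : ℂ)) = Complex.exp ((Complex.I * (k:ℂ)) * θ) := by
      intro θ; congr 1; push_cast; ring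
    simp_rw [this]
    rw [integral_exp_mul_complex hk]
    have e2 : Complex.exp (Complex.I * (k:ℂ) * ((2*Real.pi*1 : ℝ):ℂ)) = 1 := by
      rw [Complex.exp_eq_one_iff]
      exact ⟨k, by push_cast; ring⟩
    rw [e2]; simp

lemma torus_restrict (n : ℕ) : (volume.restrict (torusBox 1 n)) = Measure.pi (fun _ : Fin n => volume.restrict (Set.Icc (0:ℝ) (2*Real.pi*1))) := by
  have : torusBox 1 n = Set.univ.pi (fun _ : Fin n => Set.Icc (0:ℝ) (2*Real.pi*1)) := by
    ext θ
    simp [torusBox, Set.mem_pi, Pi.le_def, forall_and]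
  rw [this, volume_pi, Measure.restrict_pi_pi]

lemma torus_orth (n : ℕ) (j j' : Fin n → ℤ) : ∫ θ in torusBox 1 n, Complex.exp (Complex.I * ((∑ i, θ i * ((j i - j' i : ℤ) : ℝ) : ℝ) : ℂ)) = if j = j' then (((2*Real.pi)^n : ℝ):ℂ) else 0 := by
  have h1 : ∀ θ : Fin n → ℝ, Complex.exp (Complex.I * ((∑ i, θ i * ((j i - j' i : ℤ) : ℝ) : ℝ) : ℂ)) = ∏ i, Complex.exp (Complex.I * ((θ i * ((j i - j' i : ℤ):ℝ) : ℝ):ℂ)) := by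
    intro θ
    rw [← Complex.exp_sum, Complex.ofReal_sum, Finset.mul_sum]
  simp_rw [h1]
  rw [torus_restrict, integral_fintype_prod_eq_prod (f := fun i (s:ℝ) => Complex.exp (Complex.I * ((s * ((j i - j' i : ℤ):ℝ) : ℝ):ℂ)))]
  simp_rw [torus_orth1]
  split_ifs with h
  · subst h; simp
  · obtain ⟨i, hi⟩ := Function.ne_iff.1 h
    apply Finset.prod_eq_zero (Finset.mem_univ i)
    rw [if_neg (sub_ne_zero.2 hi)]

/-- Gaussian weight measure. -/
def gw (m : ℕ) (b : ℝ) : Measure (Fin m → ℝ) := volume.withDensity (fun x => ENNReal.ofReal (Real.exp (-b * ∑ i, x i^2)))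

lemma gauss_int (m : ℕ) (b : ℝ) (hb : 0 < b) : Integrable (fun x : Fin m → ℝ => Real.exp (-b * ∑ i, x i^2)) ∧ ∫ x : Fin m → ℝ, Real.exp (-b * ∑ i, x i^2) = (√(Real.pi / b))^m := by
  have h1 : ∀ x : Fin m → ℝ, Real.exp (-b * ∑ i, x i^2) = ∏ i, Real.exp (-b * x i^2) := by
    intro x; rw [← Real.exp_sum, Finset.mul_sum]
  simp_rw [h1]
  constructor
  · exact Integrable.fintype_prod (f := fun _ s => Real.exp (-b * s^2)) (fun _ => integrable_exp_neg_mul_sq hb)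
  · rw [integral_fintype_prod_volume_eq_pow (fun s => Real.exp (-b * s^2)), integral_gaussian]; simp

lemma gauss_lint (m : ℕ) (b : ℝ) (hb : 0 < b) : ∫⁻ x : Fin m → ℝ, ENNReal.ofReal (Real.exp (-b * ∑ i, x i^2)) = ENNReal.ofReal ((√(Real.pi / b))^m) := by
  rw [← (gauss_int m b hb).2, ofReal_integral_eq_lintegral_ofReal (gauss_int m b hb).1 (Filter.Eventually.of_forall fun x => (Real.exp_pos _).le)]

lemma gw_finite (m : ℕ) (b : ℝ) (hb : 0 < b) : IsFiniteMeasure (gw m b) := by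
  constructor
  rw [gw, withDensity_apply _ MeasurableSet.univ, Measure.restrict_univ, gauss_lint m b hb]
  exact ENNReal.ofReal_lt_top

lemma gw_fourier (m : ℕ) (b : ℝ) (hb : 0 < b) (c : Fin m → ℝ) : ‖∫ x, Complex.exp (Complex.I * ((∑ i, x i * c i : ℝ):ℂ)) ∂(gw m b)‖ = (√(Real.pi / b))^m * Real.exp (-(1/(4*b)) * ∑ i, c i^2) := by
  have hm : Measurable (fun x : Fin m → ℝ => Real.toNNReal (Real.exp (-b * ∑ i, x i^2))) := by fun_prop
  have e0 : gw m b = volume.withDensity (fun x => ((Real.toNNReal (Real.exp (-b * ∑ i, x i^2)) : ℝ≥0) : ℝ≥0∞)) := rfl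
  rw [e0, integral_withDensity_eq_integral_smul hm]
  have := GaussianFourier.integral_cexp_neg_mul_sum_add (ι := Fin m) (b := (b:ℂ)) (by simpa using hb) (fun i => Complex.I * c i)
  have e1 : ∀ x : Fin m → ℝ, (Real.exp (-b * ∑ i, x i^2)).toNNReal • Complex.exp (Complex.I * ((∑ i, x i * c i : ℝ):ℂ)) = Complex.exp (-(b:ℂ) * ∑ i, (x i:ℂ)^2 + ∑ i, (Complex.I * c i) * x i) := by
    intro x
    rw [NNReal.smul_def, Real.coe_toNNReal _ (Real.exp_pos _).le, Complex.real_smul, Complex.ofReal_exp, ← Complex.exp_add]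
    congr 1
    push_cast
    rw [Finset.mul_sum (s := Finset.univ) (f := fun i => (x i:ℂ) * c i)]
    congr 1
    apply Finset.sum_congr rfl; intro i _; ring
  simp_rw [e1]
  rw [this, norm_mul, Complex.norm_exp]
  congr 1
  · have : ((Real.pi:ℂ) / (b:ℂ)) = ((Real.pi / b : ℝ):ℂ) := by push_cast; rfl
    rw [this, Complex.norm_cpow_eq_rpow_re_of_pos (by positivity), Real.sqrt_eq_rpow, ← Real.rpow_natCast, ← Real.rpow_mul (by positivity)]
    congr 1
    simp
    ring
  · congr 1
    have : (∑ i, (Complex.I * (c i:ℂ))^2) / (4 * (b:ℂ)) = ((-(1/(4*b)) * ∑ i, c i^2 : ℝ):ℂ) := by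
      simp_rw [mul_pow, Complex.I_sq]
      push_cast
      rw [← Finset.mul_sum]
      field_simp
    rw [this, Complex.ofReal_re]

end

section
open MeasureTheory
open scoped ENNReal NNReal Classical ComplexConjugate

variable {m n : ℕ}

/-- phase -/
def ph (x : Fin m → ℝ) (θ : Fin n → ℝ) (κ : EE m n) : ℝ := (∑ i, x i * κ.1 i) + ∑ i, θ i * (κ.2 i : ℝ)

/-- unit exponential -/
def ex (s : ℝ) : ℂ := Complex.exp (Complex.I * (s:ℂ))

lemma ex_add (s t : ℝ) : ex (s+t) = ex s * ex t := by
  simp [ex, mul_add, Complex.exp_add]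
lemma ex_norm (s : ℝ) : ‖ex s‖ = 1 := by
  rw [ex, mul_comm, Complex.norm_exp_ofReal_mul_I]
lemma ex_enorm (s : ℝ) : ‖ex s‖ₑ = 1 := by
  rw [← ofReal_norm, ex_norm]; simp
lemma ex_conj (s : ℝ) : conj (ex s) = ex (-s) := by
  rw [ex, ex, ← Complex.exp_conj]; simp
lemma ex_meas : Measurable ex := by unfold ex; fun_prop
lemma ph_meas : Measurable (fun q : ((Fin m → ℝ) × (Fin n → ℝ)) × EE m n => ph q.1.1 q.1.2 q.2) := by
  unfold ph
  have : ∀ i, Measurable (fun q : ((Fin m → ℝ) × (Fin n → ℝ)) × EE m n => ((q.2.2 i : ℤ) : ℝ)) := by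
    intro i
    exact (measurable_from_top (f := fun z : ℤ => (z:ℝ))).comp ((measurable_pi_apply i).comp (measurable_snd.comp measurable_snd))
  fun_prop

/-- the kernel -/
def KK (b : ℝ) (κ κ' : EE m n) : ℝ≥0∞ :=
  if κ.2 = κ'.2 then ENNReal.ofReal ((√(Real.pi / b))^m * Real.exp (-(1/(4*b)) * ∑ i, (κ.1 i - κ'.1 i)^2) * (2*Real.pi)^n) else 0

lemma KK_meas (b : ℝ) : Measurable (Function.uncurry (KK (m := m) (n := n) b)) := by
  unfold KK Function.uncurry
  apply Measurable.ite
  · exact measurableSet_eq_fun (by fun_prop) (by fun_prop)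
  · fun_prop
  · fun_prop

lemma KK_int (b : ℝ) (hb : 0 < b) (κ : EE m n) : ∫⁻ κ', KK b κ κ' ∂(muE m n) = ENNReal.ofReal ((2*Real.pi)^(m+n)) := by
  have hmm : Measurable (KK b κ) := (KK_meas b).comp measurable_prodMk_left
  rw [muE, lintegral_prod _ hmm.aemeasurable]
  have h1 : ∀ ζ : Fin m → ℝ, ∫⁻ j, KK b κ (ζ, j) ∂(Measure.count : Measure (Fin n → ℤ)) = ENNReal.ofReal ((√(Real.pi / b))^m * (2*Real.pi)^n) * ENNReal.ofReal (Real.exp (-(1/(4*b)) * ∑ i, (κ.1 - ζ) i^2)) := by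
    intro ζ
    rw [lintegral_count, tsum_eq_single κ.2]
    · simp only [KK, if_true]
      rw [← ENNReal.ofReal_mul (by positivity)]
      congr 1
      simp only [Pi.sub_apply]; ring
    · intro j hj
      simp [KK, Ne.symm hj]
  simp_rw [h1]
  rw [lintegral_const_mul _ (by fun_prop), lintegral_sub_left_eq_self (fun ζ : Fin m → ℝ => ENNReal.ofReal (Real.exp (-(1/(4*b)) * ∑ i, ζ i^2))), gauss_lint _ _ (by positivity), ← ENNReal.ofReal_mul (by positivity)]
  congr 1
  have : √(Real.pi / b) * √(Real.pi / (1/(4*b))) = 2 * Real.pi := by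
    rw [← Real.sqrt_mul (by positivity)]
    have : Real.pi / b * (Real.pi / (1/(4*b))) = (2*Real.pi)^2 := by field_simp; ring
    rw [this, Real.sqrt_sq (by positivity)]
  calc _ = (√(Real.pi / b) * √(Real.pi / (1/(4*b))))^m * (2*Real.pi)^n := by rw [mul_pow]; ring
    _ = _ := by rw [this, pow_add]

lemma planch_meas (h : EE m n → ℂ) (hh : Measurable h) : Measurable (fun q : (Fin m → ℝ) × (Fin n → ℝ) => ‖∫ κ, h κ * ex (ph q.1 q.2 κ) ∂(muE m n)‖ₑ^2) := by
  have h1 : StronglyMeasurable (fun q : ((Fin m → ℝ) × (Fin n → ℝ)) × EE m n => h q.2 * ex (ph q.1.1 q.1.2 q.2)) := by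
    apply Measurable.stronglyMeasurable
    exact (hh.comp measurable_snd).mul (ex_meas.comp ph_meas)
  exact (h1.integral_prod_right' (ν := muE m n)).measurable.enorm.pow_const 2

lemma planch_b (b : ℝ) (hb : 0 < b) (h : EE m n → ℂ) (hh : Measurable h) :
    ∫⁻ x : Fin m → ℝ, ENNReal.ofReal (Real.exp (-b * ∑ i, x i^2)) * ∫⁻ θ in torusBox 1 n, ‖∫ κ, h κ * ex (ph x θ κ) ∂(muE m n)‖ₑ^2
      ≤ ENNReal.ofReal ((2*Real.pi)^(m+n)) * ∫⁻ κ, ‖h κ‖ₑ^2 ∂(muE m n) := by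
  have hgw := gw_finite m b hb
  have hbx : IsFiniteMeasure (volume.restrict (torusBox 1 n)) := by
    rw [torus_restrict]; infer_instance
  have hs := schur (P := (gw m b).prod (volume.restrict (torusBox 1 n))) (μ := muE m n)
    (e := fun q κ => ex (ph q.1 q.2 κ)) (ex_meas.comp ph_meas) (fun _ _ => ex_norm _) h hh.aestronglyMeasurable
    (KK b) (KK_meas b) (by
      intro κ κ'
      simp only [KK, eq_comm (a := κ.2)]
      congr 6
      apply Finset.sum_congr rfl; intro i _; ring) (by
      intro κ κ'
      have e1 : ∀ q : (Fin m → ℝ) × (Fin n → ℝ), ex (ph q.1 q.2 κ) * conj (ex (ph q.1 q.2 κ')) =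
        Complex.exp (Complex.I * ((∑ i, q.1 i * (κ.1 i - κ'.1 i) : ℝ):ℂ)) * Complex.exp (Complex.I * ((∑ i, q.2 i * ((κ.2 i - κ'.2 i : ℤ) : ℝ) : ℝ) : ℂ)) := by
        intro q
        rw [ex_conj, ← ex_add]
        change _ = ex _ * ex _
        rw [← ex_add]
        congr 1
        simp only [ph]
        push_cast
        simp only [mul_sub, Finset.sum_sub_distrib]
        ring
      simp_rw [e1]
      rw [integral_prod_mul (fun x : Fin m → ℝ => Complex.exp (Complex.I * ((∑ i, x i * (κ.1 i - κ'.1 i) : ℝ):ℂ))) (fun θ : Fin n → ℝ => Complex.exp (Complex.I * ((∑ i, θ i * ((κ.2 i - κ'.2 i : ℤ) : ℝ) : ℝ) : ℂ)))]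
      rw [torus_orth, ← ofReal_norm, norm_mul, gw_fourier m b hb (fun i => κ.1 i - κ'.1 i)]
      unfold KK
      split_ifs with h
      · rw [Complex.norm_real, Real.norm_of_nonneg (by positivity)]
      · simp) _ (Filter.Eventually.of_forall fun κ => (KK_int b hb κ).le)
  refine le_trans (le_of_eq ?_) hs
  rw [lintegral_prod _ (planch_meas h hh).aemeasurable, gw, lintegral_withDensity_eq_lintegral_mul _ (by fun_prop)]
  · rfl
  · exact (planch_meas h hh).lintegral_prod_right'

lemma planch (h : EE m n → ℂ) (hh : Measurable h) :
    ∫⁻ x : Fin m → ℝ, ∫⁻ θ in torusBox 1 n, ‖∫ κ, h κ * ex (ph x θ κ) ∂(muE m n)‖ₑ^2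
      ≤ ENNReal.ofReal ((2*Real.pi)^(m+n)) * ∫⁻ κ, ‖h κ‖ₑ^2 ∂(muE m n) := by
  set G : (Fin m → ℝ) → ℝ≥0∞ := fun x => ∫⁻ θ in torusBox 1 n, ‖∫ κ, h κ * ex (ph x θ κ) ∂(muE m n)‖ₑ^2 with hG
  have hGm : Measurable G := (planch_meas h hh).lintegral_prod_right'
  have ht : Filter.Tendsto (fun k : ℕ => ∫⁻ x : Fin m → ℝ, ENNReal.ofReal (Real.exp (-(1/((k:ℝ)+1)) * ∑ i, x i^2)) * G x) Filter.atTop (nhds (∫⁻ x, G x)) := by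
    apply lintegral_tendsto_of_tendsto_of_monotone
    · intro k; exact ((by fun_prop : Measurable _).mul hGm).aemeasurable
    · refine Filter.Eventually.of_forall fun x => ?_
      intro a c hac
      simp only
      gcongr
    · refine Filter.Eventually.of_forall fun x => ?_
      have h1 : Filter.Tendsto (fun k : ℕ => ENNReal.ofReal (Real.exp (-(1/((k:ℝ)+1)) * ∑ i, x i^2))) Filter.atTop (nhds 1) := by
        have h2 : Filter.Tendsto (fun k : ℕ => Real.exp (-(1/((k:ℝ)+1)) * ∑ i, x i^2)) Filter.atTop (nhds (Real.exp (-0 * ∑ i, x i^2))) :=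
          (Real.continuous_exp.tendsto _).comp (((tendsto_one_div_add_atTop_nhds_zero_nat (𝕜 := ℝ)).neg).mul_const _)
        have := ENNReal.tendsto_ofReal h2
        simpa using this
      have := ENNReal.Tendsto.mul_const h1 (b := G x) (Or.inl one_ne_zero)
      simpa using this
  refine le_of_tendsto' ht fun k => planch_b _ (by positivity) h hh

end

section
open MeasureTheory
open scoped ENNReal NNReal Classical ComplexConjugate

/-- summable weights -/
def wl (l : ℤ) : ℝ := 2 * (1 / (l:ℝ)^2) + if l = 0 then 1 else 0

lemma wl_nonneg (l : ℤ) : 0 ≤ wl l := by unfold wl; split_ifs <;> positivity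

lemma wl_sum : Summable wl := by
  unfold wl
  apply Summable.add
  · exact ((Real.summable_one_div_int_pow (p := 2)).2 (by norm_num)).mul_left 2
  · exact (hasSum_ite_eq (0:ℤ) (1:ℝ)).summable

lemma exp_le_wl (s : ℝ) (l : ℤ) (h : |s - 2*l| ≤ 1) : Real.exp (-s^2/2) ≤ wl l := by
  unfold wl
  by_cases hl : l = 0
  · subst hl
    have : Real.exp (-s^2/2) ≤ 1 := Real.exp_le_one_iff.2 (by nlinarith [sq_nonneg s])
    simp only [if_true, Int.cast_zero]; norm_num; nlinarith [sq_nonneg s]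
  · rw [if_neg hl, add_zero]
    have hl1 : (1:ℝ) ≤ |(l:ℝ)| := by exact_mod_cast Int.one_le_abs hl
    have hs : |(l:ℝ)| ≤ |s| := by
      have := abs_sub_abs_le_abs_sub (2*(l:ℝ)) s
      rw [abs_sub_comm, abs_mul] at this
      norm_num at this
      linarith
    have hsq : (l:ℝ)^2 ≤ s^2 := sq_le_sq.2 hs
    have hl2 : (1:ℝ) ≤ (l:ℝ)^2 := by rw [← sq_abs]; nlinarith
    have e1 : s^2/2 + 1 ≤ Real.exp (s^2/2) := Real.add_one_le_exp _
    rw [show -s^2/2 = -(s^2/2) by ring, Real.exp_neg]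
    calc _ ≤ ((l:ℝ)^2/2)⁻¹ := by
          apply inv_anti₀ (by positivity); linarith
      _ = _ := by field_simp

lemma exp_le_sum (s : ℝ) : ENNReal.ofReal (Real.exp (-s^2/2)) ≤ ∑' l : ℤ, (if |s - 2*l| ≤ 1 then ENNReal.ofReal (wl l) else 0) := by
  refine le_trans ?_ (ENNReal.le_tsum (round (s/2)))
  have : |s - 2 * (round (s/2) : ℤ)| ≤ 1 := by
    have := abs_sub_round (s/2)
    have e : s - 2 * (round (s/2) : ℤ) = 2 * (s/2 - (round (s/2) : ℤ)) := by ring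
    rw [e, abs_mul]; norm_num; linarith
  rw [if_pos this]
  exact ENNReal.ofReal_le_ofReal (exp_le_wl _ _ this)

lemma time_gauss (s : ℝ) : ∫ t, ex (-t * s) ∂(ProbabilityTheory.gaussianReal 0 1) = ((Real.exp (-s^2/2) : ℝ) : ℂ) := by
  have h := ProbabilityTheory.charFun_gaussianReal (μ := 0) (v := 1) (-s)
  rw [charFun_apply_real] at h
  have : ∀ t : ℝ, ex (-t * s) = Complex.exp (((-s : ℝ):ℂ) * t * Complex.I) := by
    intro t; unfold ex; congr 1; push_cast; ring
  simp_rw [this]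
  rw [h]
  push_cast
  congr 1; simp; ring

lemma time_dens (f : ℝ → ℝ≥0∞) (hf : Measurable f) : ∫⁻ t in Set.Icc (0:ℝ) 1, f t ≤ ENNReal.ofReal (√(2*Real.pi) * Real.exp (1/2)) * ∫⁻ t, f t ∂(ProbabilityTheory.gaussianReal 0 1) := by
  rw [ProbabilityTheory.gaussianReal_of_var_ne_zero _ (by norm_num), lintegral_withDensity_eq_lintegral_mul _ (ProbabilityTheory.measurable_gaussianPDF _ _) hf,
    ← lintegral_const_mul _ ((ProbabilityTheory.measurable_gaussianPDF _ _).mul hf), ← lintegral_indicator measurableSet_Icc]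
  apply lintegral_mono
  intro t
  by_cases ht : t ∈ Set.Icc (0:ℝ) 1
  · rw [Set.indicator_of_mem ht]
    simp only [Pi.mul_apply]
    rw [← mul_assoc, ProbabilityTheory.gaussianPDF, ← ENNReal.ofReal_mul (by positivity)]
    conv_lhs => rw [← one_mul (f t)]
    gcongr
    rw [← ENNReal.ofReal_one]
    apply ENNReal.ofReal_le_ofReal
    unfold ProbabilityTheory.gaussianPDFReal
    have : √(2*Real.pi) ≠ 0 := by positivity
    simp only [NNReal.coe_one, mul_one, sub_zero]
    have e : √(2 * Real.pi) * Real.exp (1 / 2) * ((√(2 * Real.pi))⁻¹ * Real.exp (-t ^ 2 / 2)) = Real.exp (1/2 + -t^2/2) := by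
      rw [Real.exp_add]; field_simp
    rw [e]
    apply Real.one_le_exp
    have := ht.1; have := ht.2; nlinarith
  · rw [Set.indicator_of_notMem ht]; exact zero_le

/-- the time constant -/
def CT : ℝ≥0∞ := ENNReal.ofReal (√(2*Real.pi) * Real.exp (1/2)) * ENNReal.ofReal (∑' l, wl l)

lemma CT_ne_top : CT ≠ ∞ := by unfold CT; exact ENNReal.mul_ne_top ENNReal.ofReal_ne_top ENNReal.ofReal_ne_top

lemma time_lemma {Y : Type*} [MeasurableSpace Y] (μ : Measure Y) [SFinite μ] (Φ : Y → ℝ) (hΦ : Measurable Φ)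
    (F : Y → ℂ) (hF : Measurable F) (S : Set Y) (hS : MeasurableSet S) (hFS : ∀ y, y ∉ S → F y = 0) (M : ℝ≥0∞)
    (hM : ∀ R : ℝ, μ {y | y ∈ S ∧ |Φ y - R| ≤ 1} ≤ M) :
    ∫⁻ t in Set.Icc (0:ℝ) 1, ‖∫ y, F y * ex (-t * Φ y) ∂μ‖ₑ^2 ≤ CT * M * ∫⁻ y, ‖F y‖ₑ^2 ∂μ := by
  have hex : Measurable (fun q : ℝ × Y => ex (-q.1 * Φ q.2)) :=
    ex_meas.comp (by fun_prop)
  have hm : Measurable (fun t : ℝ => ‖∫ y, F y * ex (-t * Φ y) ∂μ‖ₑ^2) := by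
    have h1 : StronglyMeasurable (fun q : ℝ × Y => F q.2 * ex (-q.1 * Φ q.2)) :=
      ((hF.comp measurable_snd).mul hex).stronglyMeasurable
    exact (h1.integral_prod_right' (ν := μ)).measurable.enorm.pow_const 2
  refine (time_dens _ hm).trans ?_
  have hr : ∀ t : ℝ, ∫ y, F y * ex (-t * Φ y) ∂μ = ∫ y, F y * ex (-t * Φ y) ∂(μ.restrict S) := by
    intro t
    symm
    apply setIntegral_eq_integral_of_forall_compl_eq_zero
    intro y hy; rw [hFS y hy, zero_mul]
  simp_rw [hr]
  have hs := schur (P := ProbabilityTheory.gaussianReal 0 1) (μ := μ.restrict S) (e := fun t y => ex (-t * Φ y)) hex (fun _ _ => ex_norm _)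
    F hF.aestronglyMeasurable (fun y y' => ENNReal.ofReal (Real.exp (-(Φ y' - Φ y)^2/2)))
    (by unfold Function.uncurry; fun_prop)
    (by intro y y'; rw [show (Φ y' - Φ y)^2 = (Φ y - Φ y')^2 by ring])
    (by
      intro y y'
      have : ∀ t : ℝ, ex (-t * Φ y) * conj (ex (-t * Φ y')) = ex (-t * (Φ y - Φ y')) := by
        intro t; rw [ex_conj, ← ex_add]; congr 1; ring
      simp_rw [this]
      rw [time_gauss, ← ofReal_norm, Complex.norm_real, Real.norm_of_nonneg (Real.exp_pos _).le, show (Φ y' - Φ y)^2 = (Φ y - Φ y')^2 by ring])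
    (ENNReal.ofReal (∑' l, wl l) * M)
    (by
      refine Filter.Eventually.of_forall fun y => ?_
      calc _ ≤ ∫⁻ y', ∑' l : ℤ, (if |(Φ y' - Φ y) - 2*l| ≤ 1 then ENNReal.ofReal (wl l) else 0) ∂(μ.restrict S) :=
            lintegral_mono fun y' => exp_le_sum _
        _ = ∑' l : ℤ, ∫⁻ y', (if |(Φ y' - Φ y) - 2*l| ≤ 1 then ENNReal.ofReal (wl l) else 0) ∂(μ.restrict S) := by
            apply lintegral_tsum
            intro l
            apply Measurable.aemeasurable
            apply Measurable.ite (measurableSet_le (by fun_prop) (by fun_prop)) <;> fun_prop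
        _ ≤ ∑' l : ℤ, ENNReal.ofReal (wl l) * M := by
            apply ENNReal.tsum_le_tsum
            intro l
            have hms : MeasurableSet {y' | |(Φ y' - Φ y) - 2*l| ≤ 1} := measurableSet_le (by fun_prop) (by fun_prop)
            have : ∀ y', (if |(Φ y' - Φ y) - 2*l| ≤ 1 then ENNReal.ofReal (wl l) else 0) = Set.indicator {y' | |(Φ y' - Φ y) - 2*l| ≤ 1} (fun _ => ENNReal.ofReal (wl l)) y' := by
              intro y'; rw [Set.indicator_apply]; rfl
            simp_rw [this]
            rw [lintegral_indicator hms, setLIntegral_const, Measure.restrict_apply hms]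
            gcongr
            refine le_trans (measure_mono ?_) (hM (Φ y + 2*l))
            rintro y' ⟨h1, h2⟩
            refine ⟨h2, ?_⟩
            have h1' : |(Φ y' - Φ y) - 2*l| ≤ 1 := h1
            rwa [← sub_sub]
        _ = _ := by
            rw [ENNReal.tsum_mul_right, ENNReal.ofReal_tsum_of_nonneg wl_nonneg wl_sum])
  calc _ ≤ ENNReal.ofReal (√(2*Real.pi) * Real.exp (1/2)) * (ENNReal.ofReal (∑' l, wl l) * M * ∫⁻ y, ‖F y‖ₑ^2 ∂(μ.restrict S)) := by gcongr
    _ ≤ ENNReal.ofReal (√(2*Real.pi) * Real.exp (1/2)) * (ENNReal.ofReal (∑' l, wl l) * M * ∫⁻ y, ‖F y‖ₑ^2 ∂μ) := by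
        gcongr; exact Measure.restrict_le_self
    _ = _ := by unfold CT; ring

end

section
open MeasureTheory
open scoped ENNReal NNReal Classical ComplexConjugate

variable {m n : ℕ}

instance muE_inv : (muE m n).IsAddRightInvariant := by unfold muE; infer_instance

lemma nsq_meas' : Measurable (nsq (m := m) (n := n)) := nsq_meas

lemma shear_mp {Y : Type*} [MeasurableSpace Y] (ν : Measure Y) [SFinite ν] (σ : Y → EE m n) (hσ : Measurable σ) :
    MeasurePreserving (fun p : Y × EE m n => (p.1, p.2 - σ p.1)) (ν.prod (muE m n)) (ν.prod (muE m n)) := by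
  apply (MeasurePreserving.id ν).skew_product (g := fun y ξ => ξ - σ y)
  · exact measurable_snd.sub (hσ.comp measurable_fst)
  · refine Filter.Eventually.of_forall fun y => ?_
    exact map_sub_right_eq_self _ _

lemma main_est {Y : Type*} [MeasurableSpace Y] (ν : Measure Y) [SFinite ν] (σ : Y → EE m n) (hσ : Measurable σ)
    (ψ : Y → ℝ) (hψ : Measurable ψ) (F : Y × EE m n → ℂ) (hF : Measurable F) (S : Set (Y × EE m n)) (hS : MeasurableSet S)
    (hFS : ∀ p, p ∉ S → F p = 0) (M : ℝ≥0∞)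
    (hM : ∀ ξ, ∀ R : ℝ, ν {y | (y, ξ - σ y) ∈ S ∧ |nsq (ξ - σ y) + ψ y - R| ≤ 1} ≤ M)
    (hI : Integrable F (ν.prod (muE m n))) :
    ∫⁻ t in Set.Icc (0:ℝ) 1, ∫⁻ x : Fin m → ℝ, ∫⁻ θ in torusBox 1 n,
      ‖∫ p, F p * ex (ph x θ (p.2 + σ p.1) - t * (nsq p.2 + ψ p.1)) ∂(ν.prod (muE m n))‖ₑ^2
      ≤ ENNReal.ofReal ((2*Real.pi)^(m+n)) * (CT * M * ∫⁻ p, ‖F p‖ₑ^2 ∂(ν.prod (muE m n))) := by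
  have hsh := shear_mp ν σ hσ
  have hΘ : Measurable (fun p : Y × EE m n => (p.1, p.2 - σ p.1)) := hsh.measurable
  set F' : Y × EE m n → ℂ := fun p => F (p.1, p.2 - σ p.1) with hF'
  have hF'm : Measurable F' := hF.comp hΘ
  have hF'I : Integrable F' (ν.prod (muE m n)) := hsh.integrable_comp_of_integrable hI
  set Φ : Y × EE m n → ℝ := fun p => nsq (p.2 - σ p.1) + ψ p.1 with hΦ
  have hΦm : Measurable Φ := (nsq_meas'.comp (measurable_snd.comp hΘ)).add (hψ.comp measurable_fst)
  set H : ℝ → EE m n → ℂ := fun t ξ => ∫ y, F' (y, ξ) * ex (-t * Φ (y, ξ)) ∂ν with hH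
  have hHm : Measurable (fun q : ℝ × EE m n => H q.1 q.2) := by
    have h1 : StronglyMeasurable (fun q : (ℝ × EE m n) × Y => F' (q.2, q.1.2) * ex (-q.1.1 * Φ (q.2, q.1.2))) := by
      apply Measurable.stronglyMeasurable
      have hh : Measurable (fun q : (ℝ × EE m n) × Y => (q.2, q.1.2)) := by fun_prop
      exact (hF'm.comp hh).mul (ex_meas.comp ((by fun_prop : Measurable (fun q : (ℝ × EE m n) × Y => -q.1.1)).mul (hΦm.comp hh)))
    exact (h1.integral_prod_right' (ν := ν)).measurable
  have hU : ∀ t x θ, ∫ p, F p * ex (ph x θ (p.2 + σ p.1) - t * (nsq p.2 + ψ p.1)) ∂(ν.prod (muE m n)) = ∫ ξ, H t ξ * ex (ph x θ ξ) ∂(muE m n) := by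
    intro t x θ
    have hphm : Measurable (fun ξ : EE m n => ph x θ ξ) := by
      exact ph_meas.comp (measurable_prodMk_left (x := (x, θ)))
    have hmm : Measurable (fun p : Y × EE m n => F p * ex (ph x θ (p.2 + σ p.1) - t * (nsq p.2 + ψ p.1))) := by
      apply hF.mul (ex_meas.comp _)
      apply (hphm.comp (measurable_snd.add (hσ.comp measurable_fst))).sub
      exact ((nsq_meas'.comp measurable_snd).add (hψ.comp measurable_fst)).const_mul t
    conv_lhs => rw [← hsh.map_eq]
    rw [integral_map hΘ.aemeasurable hmm.aestronglyMeasurable]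
    have e1 : ∀ p : Y × EE m n, F (p.1, p.2 - σ p.1) * ex (ph x θ (p.2 - σ p.1 + σ p.1) - t * (nsq (p.2 - σ p.1) + ψ p.1)) = (F' p * ex (-t * Φ p)) * ex (ph x θ p.2) := by
      intro p
      rw [mul_assoc, ← ex_add, sub_add_cancel]
      congr 2
      simp only [hΦ]; ring
    simp only [e1]
    rw [integral_prod_symm]
    · apply integral_congr_ae
      refine Filter.Eventually.of_forall fun ξ => ?_
      simp only [hH]
      rw [integral_mul_const]
    · have h2 : Integrable (fun p => F' p * (ex (-t * Φ p) * ex (ph x θ p.2))) (ν.prod (muE m n)) := by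
        apply hF'I.mul_bdd (c := 1)
        · exact ((ex_meas.comp (hΦm.const_mul (-t))).mul (ex_meas.comp (hphm.comp measurable_snd))).aestronglyMeasurable
        · exact Filter.Eventually.of_forall fun p => by rw [norm_mul, ex_norm, ex_norm, one_mul]
      simpa only [mul_assoc] using h2
  simp_rw [hU]
  calc _ ≤ ∫⁻ t in Set.Icc (0:ℝ) 1, ENNReal.ofReal ((2*Real.pi)^(m+n)) * ∫⁻ ξ, ‖H t ξ‖ₑ^2 ∂(muE m n) :=
        lintegral_mono fun t => planch _ (hHm.comp measurable_prodMk_left)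
    _ = ENNReal.ofReal ((2*Real.pi)^(m+n)) * ∫⁻ t in Set.Icc (0:ℝ) 1, ∫⁻ ξ, ‖H t ξ‖ₑ^2 ∂(muE m n) :=
        lintegral_const_mul' _ _ ENNReal.ofReal_ne_top
    _ = ENNReal.ofReal ((2*Real.pi)^(m+n)) * ∫⁻ ξ, (∫⁻ t in Set.Icc (0:ℝ) 1, ‖H t ξ‖ₑ^2) ∂(muE m n) := by
        rw [lintegral_lintegral_swap]
        exact (hHm.enorm.pow_const 2).aemeasurable
    _ ≤ ENNReal.ofReal ((2*Real.pi)^(m+n)) * ∫⁻ ξ, CT * M * ∫⁻ y, ‖F' (y, ξ)‖ₑ^2 ∂ν ∂(muE m n) := by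
        gcongr with ξ
        have hsl : Measurable (fun y : Y => ((y, ξ) : Y × EE m n)) := by fun_prop
        refine time_lemma ν (fun y => Φ (y, ξ)) (hΦm.comp hsl) (fun y => F' (y, ξ)) (hF'm.comp hsl) {y | (y, ξ - σ y) ∈ S} ((hΘ.comp hsl) hS) ?_ M ?_
        · intro y hy; exact hFS _ hy
        · intro R; exact hM ξ R
    _ = ENNReal.ofReal ((2*Real.pi)^(m+n)) * (CT * M * ∫⁻ ξ, ∫⁻ y, ‖F' (y, ξ)‖ₑ^2 ∂ν ∂(muE m n)) := by
        rw [lintegral_const_mul]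
        exact (hF'm.enorm.pow_const 2).lintegral_prod_left'
    _ = _ := by
        congr 2
        rw [← lintegral_prod_symm _ (hF'm.enorm.pow_const 2).aemeasurable]
        exact hsh.lintegral_comp (hF.enorm.pow_const 2)

end

section
open MeasureTheory
open scoped ENNReal NNReal Classical ComplexConjugate

variable {m n : ℕ}

/-- uncurried data -/
def gE (g : (Fin m → ℝ) → (Fin n → ℤ) → ℂ) (κ : EE m n) : ℂ := g κ.1 κ.2

/-- measurable data with finite norm and the right support -/
def Good (g : (Fin m → ℝ) → (Fin n → ℤ) → ℂ) (N : ℝ) : Prop :=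
  Measurable (gE g) ∧ l2sq 1 g ≠ ∞ ∧ SuppIn 1 g N

lemma freqNorm_eq (ζ : Fin m → ℝ) (j : Fin n → ℤ) : freqNorm 1 ζ j = √(nsq ((ζ, j) : EE m n)) := by
  simp [freqNorm, nsq]

lemma supp_SN {g : (Fin m → ℝ) → (Fin n → ℤ) → ℂ} {N : ℝ} (hN : 1 ≤ N) (h : SuppIn 1 g N) (κ : EE m n) (hκ : κ ∉ SN N) : gE g κ = 0 := by
  by_contra hne
  apply hκ
  obtain ⟨h1, h2⟩ := h κ.1 κ.2 hne
  rw [freqNorm_eq] at h1 h2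
  refine ⟨?_, fun hN1 => ?_⟩
  · rw [Real.sqrt_le_left (by linarith)] at h1
    calc _ ≤ _ := h1
      _ = _ := by ring
  · have := h2 hN1
    rw [Real.le_sqrt' (by linarith)] at this
    calc _ = (N/2)^2 := by ring
      _ ≤ _ := this

lemma l2sq_eq (g : (Fin m → ℝ) → (Fin n → ℤ) → ℂ) (hg : Measurable (gE g)) : l2sq 1 g = ∫⁻ κ, ‖gE g κ‖ₑ^2 ∂(muE m n) := by
  rw [muE, lintegral_prod_symm _ (hg.enorm.pow_const 2).aemeasurable, lintegral_count]
  simp [l2sq, gE, enorm_eq_nnnorm]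

lemma l1_le {g : (Fin m → ℝ) → (Fin n → ℤ) → ℂ} {N : ℝ} (hN : 1 ≤ N) (hg : Good g N) :
    ∫⁻ κ, ‖gE g κ‖ₑ ∂(muE m n) ≤ (l2sq 1 g)^(1/2:ℝ) * ENNReal.ofReal ((5*N)^(((m:ℝ)+n)/2)) := by
  have h1 : ∀ κ, ‖gE g κ‖ₑ = (fun κ => ‖gE g κ‖ₑ) κ * (SN N).indicator (fun _ => (1:ℝ≥0∞)) κ := by
    intro κ
    by_cases h : κ ∈ SN N
    · simp [h]
    · simp [h, supp_SN hN hg.2.2 κ h]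
  have h2 := ENNReal.lintegral_mul_le_Lp_mul_Lq (muE m n) (Real.HolderConjugate.two_two) hg.1.enorm.aemeasurable
    ((measurable_const (a := (1:ℝ≥0∞))).indicator (SN_meas N)).aemeasurable (g := (SN N).indicator (fun _ => (1:ℝ≥0∞)))
  calc _ = ∫⁻ κ, ((fun κ : EE m n => ‖gE g κ‖ₑ) * (SN N).indicator (fun _ => (1:ℝ≥0∞)) : EE m n → ℝ≥0∞) κ ∂(muE m n) := lintegral_congr h1
    _ ≤ _ := h2
    _ ≤ _ := by
      gcongr
      · rw [l2sq_eq g hg.1]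
        gcongr with κ
        rw [← ENNReal.rpow_natCast]; norm_num
      · have : ∀ κ, ((SN N).indicator (fun _ => (1:ℝ≥0∞)) κ)^(2:ℝ) = (SN (m := m) (n := n) N).indicator (fun _ => (1:ℝ≥0∞)) κ := by
          intro κ
          by_cases h : κ ∈ SN N <;> simp [h]
        simp_rw [this]
        rw [lintegral_indicator (SN_meas N), setLIntegral_const, one_mul]
        calc _ ≤ ((ENNReal.ofReal (5*N))^(m+n))^(1/2:ℝ) := by gcongr; exact muE_SN m n N hN
          _ = _ := by
            rw [← ENNReal.rpow_natCast, ← ENNReal.rpow_mul, ENNReal.ofReal_rpow_of_pos (by linarith)]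
            congr 2; push_cast; ring

lemma good_int {g : (Fin m → ℝ) → (Fin n → ℤ) → ℂ} {N : ℝ} (hN : 1 ≤ N) (hg : Good g N) : Integrable (gE g) (muE m n) := by
  refine ⟨hg.1.aestronglyMeasurable, ?_⟩
  refine lt_of_le_of_lt (l1_le hN hg) ?_
  exact ENNReal.mul_lt_top (ENNReal.rpow_lt_top_of_nonneg (by norm_num) hg.2.1) ENNReal.ofReal_lt_top

lemma ph_meas1 (x : Fin m → ℝ) (θ : Fin n → ℝ) : Measurable (fun ξ : EE m n => ph x θ ξ) :=
  ph_meas.comp (measurable_prodMk_left (x := (x, θ)))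

lemma good_int' {g : (Fin m → ℝ) → (Fin n → ℤ) → ℂ} {N : ℝ} (hN : 1 ≤ N) (hg : Good g N) (t : ℝ) (x : Fin m → ℝ) (θ : Fin n → ℝ) :
    Integrable (fun κ => gE g κ * ex (ph x θ κ - t * nsq κ)) (muE m n) := by
  apply (good_int hN hg).mul_bdd (c := 1)
  · exact (ex_meas.comp ((ph_meas1 x θ).sub (nsq_meas'.const_mul t))).aestronglyMeasurable
  · exact Filter.Eventually.of_forall fun p => by rw [ex_norm]

lemma wave_eq {g : (Fin m → ℝ) → (Fin n → ℤ) → ℂ} {N : ℝ} (hN : 1 ≤ N) (hg : Good g N) (t : ℝ) (x : Fin m → ℝ) (θ : Fin n → ℝ) :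
    waveU 1 g t x θ = ∫ κ, gE g κ * ex (ph x θ κ - t * nsq κ) ∂(muE m n) := by
  have hI := good_int' hN hg t x θ
  unfold muE at hI ⊢
  rw [integral_prod_symm _ hI, integral_countable hI.integral_prod_right]
  simp only [Measure.real, Measure.count_singleton, ENNReal.toReal_one, one_smul]
  simp only [waveU, one_pow, div_one, Complex.ofReal_one, one_mul]
  rfl

lemma wave_le {g : (Fin m → ℝ) → (Fin n → ℤ) → ℂ} {N : ℝ} (hN : 1 ≤ N) (hg : Good g N) (t : ℝ) (x : Fin m → ℝ) (θ : Fin n → ℝ) :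
    ‖waveU 1 g t x θ‖ₑ ≤ (l2sq 1 g)^(1/2:ℝ) * ENNReal.ofReal ((5*N)^(((m:ℝ)+n)/2)) := by
  rw [wave_eq hN hg]
  refine (enorm_integral_le_lintegral_enorm _).trans ((le_of_eq ?_).trans (l1_le hN hg))
  apply lintegral_congr; intro κ
  rw [enorm_mul, ex_enorm, mul_one]

lemma ph_add (x : Fin m → ℝ) (θ : Fin n → ℝ) (κ κ' : EE m n) : ph x θ (κ + κ') = ph x θ κ + ph x θ κ' := by
  simp only [ph, Prod.fst_add, Prod.snd_add, Pi.add_apply, Int.cast_add, mul_add, Finset.sum_add_distrib]; ring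

lemma bil (hm : 1 ≤ m) (hn : 1 ≤ n) (hd : 3 ≤ m + n) {N1 N2 : ℝ} (hN : 1 ≤ N2) (hNN : N2 ≤ N1)
    {g1 g2 : (Fin m → ℝ) → (Fin n → ℤ) → ℂ} (h1 : Good g1 N1) (h2 : Good g2 N2) :
    ∫⁻ t in Set.Icc (0:ℝ) 1, ∫⁻ x : Fin m → ℝ, ∫⁻ θ in torusBox 1 n, ‖waveU 1 g1 t x θ * waveU 1 g2 t x θ‖ₑ^2
    ≤ ENNReal.ofReal ((2*Real.pi)^(m+n)) * (CT * ENNReal.ofReal (3200000 * (m + n : ℕ) * (5 * N2) ^ (m + n - 2) * (N2 / N1 + 1 / N2) ^ (1/8:ℝ)) * (l2sq 1 g1 * l2sq 1 g2)) := by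
  have hN1 : 1 ≤ N1 := hN.trans hNN
  have hmain := main_est (muE m n) (fun κ => κ) measurable_id nsq nsq_meas' (fun p => gE g2 p.1 * gE g1 p.2)
    ((h2.1.comp measurable_fst).mul (h1.1.comp measurable_snd)) (SN N2 ×ˢ SN N1) ((SN_meas _).prod (SN_meas _))
    (by
      intro p hp
      by_cases hp1 : p.1 ∈ SN N2
      · have : p.2 ∉ SN N1 := fun h => hp ⟨hp1, h⟩
        rw [supp_SN hN1 h1.2.2 _ this, mul_zero]
      · rw [supp_SN hN h2.2.2 _ hp1, zero_mul]) _
    (by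
      intro ξ R
      refine le_trans (measure_mono ?_) (bi_count hm hn hd N1 N2 hN hNN ξ R)
      rintro y ⟨⟨ha, hb⟩, hc⟩
      exact ⟨ha, hb, hc⟩)
    ((good_int hN h2).mul_prod (good_int hN1 h1))
  have e1 : ∫⁻ p : EE m n × EE m n, ‖gE g2 p.1 * gE g1 p.2‖ₑ^2 ∂((muE m n).prod (muE m n)) = l2sq 1 g1 * l2sq 1 g2 := by
    simp_rw [enorm_mul, mul_pow]
    rw [lintegral_prod_mul (f := fun κ => ‖gE g2 κ‖ₑ^2) (g := fun κ => ‖gE g1 κ‖ₑ^2) (h2.1.enorm.pow_const 2).aemeasurable (h1.1.enorm.pow_const 2).aemeasurable,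
      l2sq_eq g1 h1.1, l2sq_eq g2 h2.1, mul_comm]
  rw [e1] at hmain
  refine le_trans (le_of_eq ?_) hmain
  apply lintegral_congr; intro t
  apply lintegral_congr; intro x
  apply lintegral_congr; intro θ
  congr 2
  rw [wave_eq hN1 h1, wave_eq hN h2, mul_comm, ← integral_prod_mul (fun κ => gE g2 κ * ex (ph x θ κ - t * nsq κ)) (fun κ => gE g1 κ * ex (ph x θ κ - t * nsq κ))]
  congr 1
  funext p
  have : ex (ph x θ (p.2 + p.1) - t * (nsq p.2 + nsq p.1)) = ex (ph x θ p.1 - t * nsq p.1) * ex (ph x θ p.2 - t * nsq p.2) := by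
    rw [← ex_add, ph_add]; congr 1; ring
  rw [this]; ring

lemma tril {N1 N2 N3 : ℝ} (hN : 1 ≤ N3) (hNN : N3 ≤ N2) (hNN2 : N2 ≤ N1)
    {g1 g2 g3 : (Fin 1 → ℝ) → (Fin 1 → ℤ) → ℂ} (h1 : Good g1 N1) (h2 : Good g2 N2) (h3 : Good g3 N3) :
    ∫⁻ t in Set.Icc (0:ℝ) 1, ∫⁻ x : Fin 1 → ℝ, ∫⁻ θ in torusBox 1 1, ‖waveU 1 g1 t x θ * (waveU 1 g2 t x θ * waveU 1 g3 t x θ)‖ₑ^2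
    ≤ ENNReal.ofReal ((2*Real.pi)^(1+1)) * (CT * ENNReal.ofReal (40000000*(N2*N3)*(N3/N1+1/N2)^(1/16:ℝ)) * (l2sq 1 g1 * (l2sq 1 g2 * l2sq 1 g3))) := by
  have hN2 : 1 ≤ N2 := hN.trans hNN
  have hN1 : 1 ≤ N1 := hN2.trans hNN2
  have hmain := main_est ((muE 1 1).prod (muE 1 1)) (fun κ => κ.1 + κ.2) (measurable_fst.add measurable_snd) (fun q => nsq q.1 + nsq q.2)
    ((nsq_meas'.comp measurable_fst).add (nsq_meas'.comp measurable_snd)) (fun p => (gE g2 p.1.1 * gE g3 p.1.2) * gE g1 p.2)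
    (((h2.1.comp (measurable_fst.comp measurable_fst)).mul (h3.1.comp (measurable_snd.comp measurable_fst))).mul (h1.1.comp measurable_snd))
    ((SN N2 ×ˢ SN N3) ×ˢ SN N1) (((SN_meas _).prod (SN_meas _)).prod (SN_meas _))
    (by
      intro p hp
      by_cases hp1 : p.1.1 ∈ SN N2
      · by_cases hp2 : p.1.2 ∈ SN N3
        · have : p.2 ∉ SN N1 := fun h => hp ⟨⟨hp1, hp2⟩, h⟩
          rw [supp_SN hN1 h1.2.2 _ this, mul_zero]
        · rw [supp_SN hN h3.2.2 _ hp2, mul_zero, zero_mul]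
      · rw [supp_SN hN2 h2.2.2 _ hp1, zero_mul, zero_mul]) _
    (by
      intro ξ R
      refine le_trans (measure_mono ?_) (tri_count N1 N2 N3 hN hNN hNN2 ξ R)
      rintro y ⟨⟨ha, hb⟩, hc⟩
      exact ⟨ha, hb, hc⟩)
    (((good_int hN2 h2).mul_prod (good_int hN h3)).mul_prod (good_int hN1 h1))
  have e1 : ∫⁻ p : (EE 1 1 × EE 1 1) × EE 1 1, ‖(gE g2 p.1.1 * gE g3 p.1.2) * gE g1 p.2‖ₑ^2 ∂(((muE 1 1).prod (muE 1 1)).prod (muE 1 1)) = l2sq 1 g1 * (l2sq 1 g2 * l2sq 1 g3) := by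
    simp_rw [enorm_mul, mul_pow]
    have h23 : Measurable (fun q : EE 1 1 × EE 1 1 => ‖gE g2 q.1‖ₑ^2 * ‖gE g3 q.2‖ₑ^2) :=
      ((h2.1.comp measurable_fst).enorm.pow_const 2).mul ((h3.1.comp measurable_snd).enorm.pow_const 2)
    rw [lintegral_prod_mul (f := fun q : EE 1 1 × EE 1 1 => ‖gE g2 q.1‖ₑ^2 * ‖gE g3 q.2‖ₑ^2) (g := fun κ => ‖gE g1 κ‖ₑ^2) h23.aemeasurable (h1.1.enorm.pow_const 2).aemeasurable,
      lintegral_prod_mul (f := fun κ => ‖gE g2 κ‖ₑ^2) (g := fun κ => ‖gE g3 κ‖ₑ^2) (h2.1.enorm.pow_const 2).aemeasurable (h3.1.enorm.pow_const 2).aemeasurable,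
      l2sq_eq g1 h1.1, l2sq_eq g2 h2.1, l2sq_eq g3 h3.1, mul_comm]
  rw [e1] at hmain
  refine le_trans (le_of_eq ?_) hmain
  apply lintegral_congr; intro t
  apply lintegral_congr; intro x
  apply lintegral_congr; intro θ
  congr 2
  rw [wave_eq hN1 h1, wave_eq hN h3, wave_eq hN2 h2, mul_comm, ← integral_prod_mul (fun κ => gE g2 κ * ex (ph x θ κ - t * nsq κ)) (fun κ => gE g3 κ * ex (ph x θ κ - t * nsq κ)),
    ← integral_prod_mul (fun q : EE 1 1 × EE 1 1 => (gE g2 q.1 * ex (ph x θ q.1 - t * nsq q.1)) * (gE g3 q.2 * ex (ph x θ q.2 - t * nsq q.2))) (fun κ => gE g1 κ * ex (ph x θ κ - t * nsq κ))]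
  congr 1
  funext p
  have : ex (ph x θ (p.2 + (p.1.1 + p.1.2)) - t * (nsq p.2 + (nsq p.1.1 + nsq p.1.2))) = ex (ph x θ p.1.1 - t * nsq p.1.1) * ex (ph x θ p.1.2 - t * nsq p.1.2) * ex (ph x θ p.2 - t * nsq p.2) := by
    rw [← ex_add, ← ex_add, ph_add, ph_add]; congr 1; ring
  rw [this]; ring

end

section
open MeasureTheory
open scoped ENNReal NNReal Classical ComplexConjugate

/-- the estimate for good data -/
def PP (m n k : ℕ) : Prop := ∃ δ C : ℝ, 0 < δ ∧ 0 < C ∧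
    ∀ (N : Fin (k + 1) → ℝ) (g : Fin (k + 1) → (Fin m → ℝ) → (Fin n → ℤ) → ℂ),
      (∀ i, 1 ≤ N i) →
      (∀ i j : Fin (k + 1), i ≤ j → N j ≤ N i) →
      (∀ i, Good (g i) (N i)) →
      (∫⁻ t in Set.Icc (0 : ℝ) 1, ∫⁻ x : Fin m → ℝ, ∫⁻ y in torusBox 1 n,
          ‖∏ i : Fin (k + 1), waveU 1 (g i) t x y‖ₑ ^ 2) ^ (1 / 2 : ℝ)
        ≤ ENNReal.ofReal (C * (N (Fin.last k) / N 0 + 1 / N 1) ^ δ)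
            * (l2sq 1 (g 0)) ^ (1 / 2 : ℝ)
            * ∏ i : Fin k, (ENNReal.ofReal ((N i.succ) ^ (((m : ℝ) + n) / 2 - 1 / (k : ℝ)))
                * (l2sq 1 (g i.succ)) ^ (1 / 2 : ℝ))

lemma half_pow (a b c : ℝ) (L : ℝ≥0∞) (ha : 0 ≤ a) (hc : 0 ≤ c) (h : a * CT.toReal * b ≤ c^2) :
    (ENNReal.ofReal a * (CT * ENNReal.ofReal b * L))^(1/2:ℝ) ≤ ENNReal.ofReal c * L^(1/2:ℝ) := by
  have e : ENNReal.ofReal a * (CT * ENNReal.ofReal b * L) = ENNReal.ofReal (a * CT.toReal * b) * L := by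
    rw [ENNReal.ofReal_mul (by positivity), ENNReal.ofReal_mul ha, ENNReal.ofReal_toReal CT_ne_top]; ring
  rw [e, ENNReal.mul_rpow_of_nonneg _ _ (by norm_num)]
  gcongr
  calc _ ≤ (ENNReal.ofReal (c^2))^(1/2:ℝ) := by gcongr
    _ = _ := by
      rw [ENNReal.ofReal_rpow_of_nonneg (by positivity) (by norm_num), ← Real.sqrt_eq_rpow, Real.sqrt_sq hc]

lemma base_bil (m n : ℕ) (hm : 1 ≤ m) (hn : 1 ≤ n) (hd : 3 ≤ m + n) : PP m n 1 := by
  set A : ℝ := (2*Real.pi)^(m+n) * CT.toReal * (3200000 * (m + n : ℕ) * 5^(m+n-2)) with hA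
  have hA0 : 0 ≤ A := by positivity
  refine ⟨1/16, √A + 1, by norm_num, by positivity, ?_⟩
  intro N g hN hanti hg
  have hN1 := hN 1
  have hN0 := hN 0
  have h01 : N 1 ≤ N 0 := hanti 0 1 (by simp)
  have hp2 : ∀ f : Fin (1+1) → ℂ, ∏ i, f i = f 0 * f 1 := fun f => Fin.prod_univ_two f
  simp only [hp2, Fin.prod_univ_one, Fin.isValue]
  rw [show (Fin.last 1) = 1 from rfl, show Fin.succ (0 : Fin 1) = 1 from rfl]
  refine (ENNReal.rpow_le_rpow (bil hm hn hd hN1 h01 (hg 0) (hg 1)) (by norm_num)).trans ?_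
  set Q := N 1 / N 0 + 1 / N 1 with hQ
  have hQ0 : 0 < Q := by positivity
  have hN1p : 0 < N 1 := by linarith
  refine (half_pow _ _ (((√A + 1) * Q^(1/16:ℝ)) * (N 1)^(((m:ℝ)+n)/2 - 1/((1:ℕ):ℝ))) _ (by positivity) (by positivity) ?_).trans (le_of_eq ?_)
  · have e1 : (Q^(1/16:ℝ))^2 = Q^(1/8:ℝ) := by
      rw [← Real.rpow_natCast, ← Real.rpow_mul hQ0.le]; norm_num
    have e2 : ((N 1)^(((m:ℝ)+n)/2 - 1/((1:ℕ):ℝ)))^2 = (N 1)^(m+n-2) := by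
      rw [← Real.rpow_natCast, ← Real.rpow_mul hN1p.le, ← Real.rpow_natCast, Nat.cast_sub (by omega)]
      congr 1; push_cast; ring
    have e3 : (((√A + 1) * Q^(1/16:ℝ)) * (N 1)^(((m:ℝ)+n)/2 - 1/((1:ℕ):ℝ)))^2 = (√A + 1)^2 * Q^(1/8:ℝ) * (N 1)^(m+n-2) := by
      rw [mul_pow, mul_pow, e1, e2]
    rw [e3, mul_pow (5:ℝ)]
    have : A ≤ (√A + 1)^2 := by nlinarith [Real.sq_sqrt hA0, Real.sqrt_nonneg A]
    calc _ = A * Q^(1/8:ℝ) * (N 1)^(m+n-2) := by rw [hA]; ring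
      _ ≤ _ := by gcongr
  · rw [ENNReal.ofReal_mul (by positivity), ENNReal.mul_rpow_of_nonneg _ _ (by norm_num)]; ring

lemma base_tril : PP 1 1 2 := by
  set A : ℝ := (2*Real.pi)^(1+1) * CT.toReal * 40000000 with hA
  have hA0 : 0 ≤ A := by positivity
  refine ⟨1/32, √A + 1, by norm_num, by positivity, ?_⟩
  intro N g hN hanti hg
  have hN1 := hN 1
  have hN0 := hN 0
  have hN2 := hN 2
  have h01 : N 1 ≤ N 0 := hanti 0 1 (by simp)
  have h12 : N 2 ≤ N 1 := hanti 1 2 (by decide)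
  have hp3 : ∀ f : Fin (2+1) → ℂ, ∏ i, f i = f 0 * (f 1 * f 2) := fun f => by rw [← mul_assoc]; exact Fin.prod_univ_three f
  simp only [hp3, Fin.prod_univ_two, Fin.isValue]
  rw [show (Fin.last 2) = 2 from rfl, show Fin.succ (0 : Fin 2) = 1 from rfl, show Fin.succ (1 : Fin 2) = 2 from rfl]
  refine (ENNReal.rpow_le_rpow (tril hN2 h12 h01 (hg 0) (hg 1) (hg 2)) (by norm_num)).trans ?_
  set Q := N 2 / N 0 + 1 / N 1 with hQ
  have hQ0 : 0 < Q := by positivity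
  have hN1p : 0 < N 1 := by linarith
  have hN2p : 0 < N 2 := by linarith
  have hs : (((1:ℕ):ℝ) + ((1:ℕ):ℝ))/2 - 1/((2:ℕ):ℝ) = 1/2 := by norm_num
  rw [hs]
  refine (half_pow _ _ (((√A + 1) * Q^(1/32:ℝ)) * ((N 1)^(1/2:ℝ) * (N 2)^(1/2:ℝ))) _ (by positivity) (by positivity) ?_).trans (le_of_eq ?_)
  · have e1 : (Q^(1/32:ℝ))^2 = Q^(1/16:ℝ) := by
      rw [← Real.rpow_natCast, ← Real.rpow_mul hQ0.le]; norm_num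
    have e3 : (((√A + 1) * Q^(1/32:ℝ)) * ((N 1)^(1/2:ℝ) * (N 2)^(1/2:ℝ)))^2 = (√A + 1)^2 * Q^(1/16:ℝ) * (N 1 * N 2) := by
      rw [mul_pow, mul_pow, mul_pow, e1, ← Real.sqrt_eq_rpow, ← Real.sqrt_eq_rpow, Real.sq_sqrt hN1p.le, Real.sq_sqrt hN2p.le]
    rw [e3]
    have : A ≤ (√A + 1)^2 := by nlinarith [Real.sq_sqrt hA0, Real.sqrt_nonneg A]
    calc _ = A * Q^(1/16:ℝ) * (N 1 * N 2) := by rw [hA]; ring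
      _ ≤ _ := by gcongr
  · rw [ENNReal.ofReal_mul (p := (√A + 1) * Q^(1/32:ℝ)) (by positivity), ENNReal.ofReal_mul (p := (N 1)^(1/2:ℝ)) (by positivity), ENNReal.mul_rpow_of_nonneg _ _ (by norm_num), ENNReal.mul_rpow_of_nonneg _ _ (by norm_num)]; ring

lemma ind_real (k : ℕ) (hk : 1 ≤ k) (D δ C : ℝ) (hδ : 0 < δ) (hC : 0 < C) (a b N0 N1 : ℝ) (P : Fin k → ℝ)
    (ha : 1 ≤ a) (hab : a ≤ b) (hb1 : b ≤ N1) (h10 : N1 ≤ N0) (hP : ∀ i, b ≤ P i) :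
    (5*a)^(D/2) * (C * (b/N0 + 1/N1)^δ) * ∏ i, (P i)^(D/2 - 1/(k:ℝ))
    ≤ (5^(D/2) * 2^δ * C) * (a/N0 + 1/N1)^(min δ (1/((k:ℝ)+1))) * ((∏ i, (P i)^(D/2 - 1/((k:ℝ)+1))) * a^(D/2 - 1/((k:ℝ)+1))) := by
  have hk0 : (0:ℝ) < k := by exact_mod_cast hk
  have hb0 : 0 < b := by linarith
  have ha0 : 0 < a := by linarith
  have hN10 : 0 < N1 := by linarith
  have hN00 : 0 < N0 := by linarith
  set r : ℝ := 1/((k:ℝ)+1) with hr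
  have hr0 : 0 < r := by positivity
  set δ' := min δ r with hδ'
  have hδ'0 : 0 < δ' := lt_min hδ hr0
  have e1 : ∏ i, (P i)^(D/2 - 1/(k:ℝ)) ≤ (∏ i, (P i)^(D/2 - r)) * (b^r)⁻¹ := by
    have : ∀ i, (P i)^(D/2 - 1/(k:ℝ)) ≤ (P i)^(D/2 - r) * b^(-(r/k)) := by
      intro i
      have hPi : 0 < P i := lt_of_lt_of_le hb0 (hP i)
      have : D/2 - 1/(k:ℝ) = (D/2 - r) + -(r/k) := by rw [hr]; field_simp; ring
      rw [this, Real.rpow_add hPi]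
      gcongr _ * ?_
      exact Real.rpow_le_rpow_of_nonpos hb0 (hP i) (by rw [neg_nonpos]; positivity)
    calc _ ≤ ∏ i, ((P i)^(D/2 - r) * b^(-(r/k))) := by
          apply Finset.prod_le_prod
          · intro i _
            have hPi : 0 < P i := lt_of_lt_of_le hb0 (hP i)
            positivity
          · intro i _; exact this i
      _ = _ := by
          rw [Finset.prod_mul_distrib]
          congr 1
          rw [Finset.prod_const, Finset.card_univ, Fintype.card_fin, ← Real.rpow_natCast, ← Real.rpow_mul hb0.le, ← Real.rpow_neg hb0.le]
          congr 1; field_simp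
  have e2 : a^(D/2) = a^(D/2 - r) * a^r := by rw [← Real.rpow_add ha0]; congr 1; ring
  set y := b/N0 + 1/N1 with hy
  have hy0 : 0 < y := by positivity
  have hy2 : y ≤ 2 := by
    have : b/N0 ≤ 1 := by rw [div_le_one hN00]; linarith
    have : 1/N1 ≤ 1 := by rw [div_le_one hN10]; linarith
    linarith
  have e3 : a^r * (b^r)⁻¹ * y^δ ≤ 2^δ * (a/N0 + 1/N1)^δ' := by
    have f1 : a^r * (b^r)⁻¹ ≤ (a/b)^δ' := by
      rw [← div_eq_mul_inv, ← Real.div_rpow ha0.le hb0.le]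
      exact Real.rpow_le_rpow_of_exponent_ge (by positivity) (by rw [div_le_one hb0]; exact hab) (min_le_right _ _)
    have f2 : y^δ ≤ 2^δ * y^δ' := by
      have : δ = (δ - δ') + δ' := by ring
      calc y^δ = y^(δ-δ') * y^δ' := by rw [← Real.rpow_add hy0]; congr 1
        _ ≤ 2^(δ-δ') * y^δ' := by gcongr; linarith [min_le_left δ r]
        _ ≤ 2^δ * y^δ' := by gcongr <;> linarith
    calc _ ≤ (a/b)^δ' * (2^δ * y^δ') := by gcongr
      _ = 2^δ * ((a/b)*y)^δ' := by rw [Real.mul_rpow (by positivity) hy0.le]; ring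
      _ ≤ _ := by
        gcongr
        rw [hy, mul_add]
        gcongr ?_ + ?_
        · apply le_of_eq; field_simp
        · have : a/b ≤ 1 := by rw [div_le_one hb0]; exact hab
          calc _ ≤ 1 * (1/N1) := by gcongr
            _ = _ := one_mul _
  have hPP : 0 ≤ ∏ i, (P i)^(D/2 - r) := Finset.prod_nonneg fun i _ => Real.rpow_nonneg (hb0.le.trans (hP i)) _
  calc _ ≤ (5*a)^(D/2) * (C * y^δ) * ((∏ i, (P i)^(D/2 - r)) * (b^r)⁻¹) := by gcongr
    _ = (5^(D/2) * C * a^(D/2-r) * (∏ i, (P i)^(D/2 - r))) * (a^r * (b^r)⁻¹ * y^δ) := by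
        rw [Real.mul_rpow (by norm_num) ha0.le, e2]; ring
    _ ≤ (5^(D/2) * C * a^(D/2-r) * (∏ i, (P i)^(D/2 - r))) * (2^δ * (a/N0 + 1/N1)^δ') := by gcongr
    _ = _ := by ring

lemma ind_step (m n k : ℕ) (hk : 1 ≤ k) (h : PP m n k) : PP m n (k+1) := by
  obtain ⟨δ, C, hδ, hC, H⟩ := h
  refine ⟨min δ (1/((k:ℝ)+1)), 5^(((m:ℝ)+n)/2) * 2^δ * C, lt_min hδ (by positivity), by positivity, ?_⟩
  intro N g hN hanti hg
  have H1 := H (fun i => N i.castSucc) (fun i => g i.castSucc) (fun i => hN _) (fun i j hij => hanti _ _ (by simpa using hij)) (fun i => hg _)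
  obtain ⟨k, rfl⟩ : ∃ k', k = k' + 1 := ⟨k - 1, by omega⟩
  have hone : ((1 : Fin (k+1+1)).castSucc : Fin (k+1+1+1)) = 1 := rfl
  have hzero : ((0 : Fin (k+1+1)).castSucc : Fin (k+1+1+1)) = 0 := rfl
  simp only [hone, hzero] at H1
  set a := N (Fin.last (k+1+1)) with ha
  set la := (l2sq 1 (g (Fin.last (k+1+1))))^(1/2:ℝ) with hla
  set B : ℝ≥0∞ := la * ENNReal.ofReal ((5*a)^(((m:ℝ)+n)/2)) with hB
  have hBtop : B ≠ ∞ := ENNReal.mul_ne_top (ENNReal.rpow_ne_top_of_nonneg (by norm_num) (hg _).2.1) ENNReal.ofReal_ne_top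
  have hB2 : B^2 ≠ ∞ := ENNReal.pow_ne_top hBtop
  have step1 : (∫⁻ t in Set.Icc (0 : ℝ) 1, ∫⁻ x : Fin m → ℝ, ∫⁻ y in torusBox 1 n,
          ‖∏ i : Fin (k + 1 + 1 + 1), waveU 1 (g i) t x y‖ₑ ^ 2) ≤ B^2 * ∫⁻ t in Set.Icc (0 : ℝ) 1, ∫⁻ x : Fin m → ℝ, ∫⁻ y in torusBox 1 n,
          ‖∏ i : Fin (k + 1 + 1), waveU 1 (g i.castSucc) t x y‖ₑ ^ 2 := by
    rw [← lintegral_const_mul' _ _ hB2]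
    refine lintegral_mono fun t => ?_
    rw [← lintegral_const_mul' _ _ hB2]
    refine lintegral_mono fun x => ?_
    rw [← lintegral_const_mul' _ _ hB2]
    refine lintegral_mono fun y => ?_
    simp only
    rw [Fin.prod_univ_castSucc, enorm_mul, mul_pow, mul_comm]
    gcongr
    exact wave_le (hN _) (hg _) t x y
  refine (ENNReal.rpow_le_rpow step1 (by norm_num)).trans ?_
  rw [ENNReal.mul_rpow_of_nonneg _ _ (by norm_num)]
  have hBs : (B^2)^(1/2:ℝ) = B := by
    rw [← ENNReal.rpow_natCast, ← ENNReal.rpow_mul]; norm_num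
  rw [hBs]
  refine (mul_le_mul_right H1 B).trans ?_
  have hr := ind_real (k+1) (by omega) ((m:ℝ)+n) δ C hδ hC a (N (Fin.last (k+1)).castSucc) (N 0) (N 1) (fun i => N i.castSucc.succ)
    (hN _) (hanti _ _ (Fin.le_last _)) (hanti _ _ (by rw [Fin.le_def]; simp)) (hanti _ _ (Fin.zero_le _)) (fun i => hanti _ _ (by
      rw [Fin.le_def]; simp; omega))
  have hPpos : ∀ i : Fin (k+1), 0 ≤ N i.castSucc.succ := fun i => by linarith [hN i.castSucc.succ]
  have ha0 : 0 ≤ a := by linarith [hN (Fin.last (k+1+1))]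
  have hq : 0 ≤ a / N 0 + 1 / N 1 := by
    have := hN 0; have := hN 1; positivity
  have hq2 : 0 ≤ N (Fin.last (k+1)).castSucc / N 0 + 1 / N 1 := by
    have := hN 0; have := hN 1; have := hN (Fin.last (k+1)).castSucc; positivity
  have hsu : ∀ i : Fin (k+1), (i.succ.castSucc : Fin (k+1+1+1)) = i.castSucc.succ := fun i => rfl
  rw [Fin.prod_univ_castSucc (n := k+1)]
  simp only [hsu, Fin.succ_last]
  simp only [Finset.prod_mul_distrib]
  rw [← ENNReal.ofReal_prod_of_nonneg (fun i _ => Real.rpow_nonneg (hPpos i) _), ← ENNReal.ofReal_prod_of_nonneg (fun i _ => Real.rpow_nonneg (hPpos i) _)]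
  set LL := ∏ i : Fin (k+1), (l2sq 1 (g i.castSucc.succ))^(1/2:ℝ)
  calc _ = ENNReal.ofReal ((5*a)^(((m:ℝ)+n)/2) * (C * (N (Fin.last (k+1)).castSucc / N 0 + 1 / N 1)^δ) * ∏ i : Fin (k+1), (N i.castSucc.succ)^(((m:ℝ)+n)/2 - 1/((k+1 : ℕ):ℝ))) * (la * (l2sq 1 (g 0))^(1/2:ℝ) * LL) := by
        rw [hB, ENNReal.ofReal_mul (p := (5*a)^(((m:ℝ)+n)/2) * (C * (N (Fin.last (k+1)).castSucc / N 0 + 1 / N 1)^δ)) (by positivity), ENNReal.ofReal_mul (p := (5*a)^(((m:ℝ)+n)/2)) (by positivity)]; ring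
    _ ≤ _ := mul_le_mul_left (ENNReal.ofReal_le_ofReal hr) _
    _ = _ := by
        rw [ENNReal.ofReal_mul (by positivity), ENNReal.ofReal_mul (Finset.prod_nonneg fun i _ => Real.rpow_nonneg (hPpos i) _)]
        push_cast
        ring

lemma PP_all (m n k : ℕ) (hm : 1 ≤ m) (hn : 1 ≤ n) (hk : 1 ≤ k) (hk2 : m + n = 2 → 2 ≤ k) : PP m n k := by
  by_cases hd : m + n = 2
  · obtain rfl : m = 1 := by omega
    obtain rfl : n = 1 := by omega
    exact Nat.le_induction base_tril (fun k hk ih => ind_step 1 1 k (by omega) ih) k (hk2 hd)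
  · exact Nat.le_induction (base_bil m n hm hn (by omega)) (fun k hk ih => ind_step m n k hk ih) k hk

end

section
open MeasureTheory
open scoped ENNReal NNReal Classical ComplexConjugate

variable {m n : ℕ}

lemma gm_aux (g : (Fin m → ℝ) → (Fin n → ℤ) → ℂ) (N : ℝ) (hN : 1 ≤ N) (hs : SuppIn 1 g N) :
    ∃ g' : (Fin m → ℝ) → (Fin n → ℤ) → ℂ, Measurable (gE g') ∧ SuppIn 1 g' N ∧ l2sq 1 g' ≤ l2sq 1 g ∧
      ∀ t x y, waveU 1 g' t x y = waveU 1 g t x y := by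
  have hfm : ∀ j : Fin n → ℤ, Measurable (fun ζ : Fin m → ℝ => freqNorm 1 ζ j) := by
    intro j; unfold freqNorm; fun_prop
  let T : (Fin n → ℤ) → Set (Fin m → ℝ) := fun j => {ζ | freqNorm 1 ζ j ≤ 2 * N ∧ (1 < N → N / 2 ≤ freqNorm 1 ζ j)}
  have hT : ∀ j, MeasurableSet (T j) := by
    intro j
    apply MeasurableSet.inter
    · exact measurableSet_le (hfm j) measurable_const
    · by_cases h : 1 < N
      · simp only [h, true_imp_iff]; exact measurableSet_le measurable_const (hfm j)
      · simp only [h, false_imp_iff]; exact MeasurableSet.univ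
  have key : ∀ j : Fin n → ℤ, ∃ h : (Fin m → ℝ) → ℂ, Measurable h ∧ (∀ ζ, h ζ ≠ 0 → ζ ∈ T j) ∧
      ((h =ᵐ[volume] fun ζ => g ζ j) ∨ (h = 0 ∧ ¬ AEStronglyMeasurable (fun ζ => g ζ j) volume)) := by
    intro j
    by_cases hj : AEStronglyMeasurable (fun ζ => g ζ j) volume
    · refine ⟨(T j).indicator (hj.mk _), hj.stronglyMeasurable_mk.measurable.indicator (hT j), ?_, Or.inl ?_⟩
      · intro ζ h; by_contra hc; exact h (Set.indicator_of_notMem hc _)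
      · filter_upwards [hj.ae_eq_mk] with ζ hζ
        by_cases h : ζ ∈ T j
        · rw [Set.indicator_of_mem h, ← hζ]
        · rw [Set.indicator_of_notMem h]
          by_contra hc
          exact h (hs ζ j (Ne.symm hc))
    · exact ⟨0, measurable_zero, fun ζ h => absurd rfl h, Or.inr ⟨rfl, hj⟩⟩
  choose h hm hsup hor using key
  refine ⟨fun ζ j => h j ζ, ?_, ?_, ?_, ?_⟩
  · exact measurable_from_prod_countable_left (fun j => hm j)
  · exact fun ζ j hne => hsup j ζ hne
  · unfold l2sq
    refine mul_le_mul_right (ENNReal.tsum_le_tsum fun j => ?_) _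
    rcases hor j with h1 | ⟨h1, -⟩
    · apply le_of_eq
      apply lintegral_congr_ae
      filter_upwards [h1] with ζ hζ
      rw [hζ]
    · simp [h1]
  · intro t x y
    unfold waveU
    congr 1
    apply tsum_congr; intro j
    rcases hor j with h1 | ⟨h1, h2⟩
    · apply integral_congr_ae
      filter_upwards [h1] with ζ hζ
      rw [hζ]
    · simp only [h1, Pi.zero_apply, zero_mul, integral_zero]
      symm
      apply integral_undef
      intro hI
      apply h2
      have hc : Continuous (fun ζ : Fin m → ℝ => Complex.exp (-(Complex.I *
      ((((∑ i, x i * ζ i) + ∑ i, y i * ((j i : ℝ) / 1))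
        - t * ((∑ i, (ζ i) ^ 2) + ∑ i, ((j i : ℝ) / 1) ^ 2) : ℝ) : ℂ)))) := by fun_prop
      refine (hI.1.mul hc.aestronglyMeasurable).congr (Filter.Eventually.of_forall fun ζ => ?_)
      simp only [Pi.mul_apply]
      rw [mul_assoc, ← Complex.exp_add, add_neg_cancel, Complex.exp_zero, mul_one]

lemma final_aux (m n k : ℕ)
    (hm : 1 ≤ m) (hn : 1 ≤ n) (hk : 1 ≤ k) (hk2 : m + n = 2 → 2 ≤ k) :
    ∃ δ C : ℝ, 0 < δ ∧ 0 < C ∧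
    ∀ (N : Fin (k + 1) → ℝ) (g : Fin (k + 1) → (Fin m → ℝ) → (Fin n → ℤ) → ℂ),
      (∀ i, IsDyadic (N i)) → (∀ i, 1 ≤ N i) →
      (∀ i j : Fin (k + 1), i ≤ j → N j ≤ N i) →
      (∀ i, SuppIn 1 (g i) (N i)) →
      (∫⁻ t in Set.Icc (0 : ℝ) 1, ∫⁻ x : Fin m → ℝ, ∫⁻ y in torusBox 1 n,
          (‖∏ i : Fin (k + 1), waveU 1 (g i) t x y‖₊ : ℝ≥0∞) ^ 2) ^ (1 / 2 : ℝ)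
        ≤ ENNReal.ofReal (C * (N (Fin.last k) / N 0 + 1 / N 1) ^ δ)
            * (l2sq 1 (g 0)) ^ (1 / 2 : ℝ)
            * ∏ i : Fin k, (ENNReal.ofReal ((N i.succ) ^ (((m : ℝ) + n) / 2 - 1 / (k : ℝ)))
                * (l2sq 1 (g i.succ)) ^ (1 / 2 : ℝ)) := by
  obtain ⟨δ, C, hδ, hC, H⟩ := PP_all m n k hm hn hk hk2
  refine ⟨δ, C, hδ, hC, ?_⟩
  intro N g _ hN hanti hs
  choose g' h1 h2 h3 h4 using fun i => gm_aux (g i) (N i) (hN i) (hs i)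
  have hNp : ∀ i, 0 < N i := fun i => lt_of_lt_of_le one_pos (hN i)
  simp_rw [← h4, ← enorm_eq_nnnorm]
  suffices hh : (∫⁻ t in Set.Icc (0 : ℝ) 1, ∫⁻ x : Fin m → ℝ, ∫⁻ y in torusBox 1 n,
          ‖∏ i : Fin (k + 1), waveU 1 (g' i) t x y‖ₑ ^ 2) ^ (1 / 2 : ℝ)
        ≤ ENNReal.ofReal (C * (N (Fin.last k) / N 0 + 1 / N 1) ^ δ)
            * (l2sq 1 (g' 0)) ^ (1 / 2 : ℝ)
            * ∏ i : Fin k, (ENNReal.ofReal ((N i.succ) ^ (((m : ℝ) + n) / 2 - 1 / (k : ℝ)))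
                * (l2sq 1 (g' i.succ)) ^ (1 / 2 : ℝ)) by
    refine hh.trans ?_
    gcongr with i
    · exact h3 0
    · exact h3 _
  by_cases hz : ∃ i, l2sq 1 (g' i) = 0
  · obtain ⟨i, hi⟩ := hz
    have hw : ∀ t x y, waveU 1 (g' i) t x y = 0 := by
      intro t x y
      have := wave_le (hN i) ⟨h1 i, by rw [hi]; simp, h2 i⟩ t x y
      rw [hi, ENNReal.zero_rpow_of_pos (by norm_num), zero_mul] at this
      simpa using this
    have : ∀ t x y, ∏ i : Fin (k + 1), waveU 1 (g' i) t x y = 0 := fun t x y =>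
      Finset.prod_eq_zero (Finset.mem_univ i) (hw t x y)
    simp [this]
  push Not at hz
  by_cases hf : ∀ i, l2sq 1 (g' i) ≠ ∞
  · exact H N g' hN hanti (fun i => ⟨h1 i, hf i, h2 i⟩)
  push Not at hf
  obtain ⟨i, hi⟩ := hf
  have hQ : ENNReal.ofReal (C * (N (Fin.last k) / N 0 + 1 / N 1) ^ δ) ≠ 0 := by
    have a := hNp (Fin.last k); have b := hNp 0; have c := hNp 1
    have : 0 < C * (N (Fin.last k) / N 0 + 1 / N 1) ^ δ := by positivity
    simpa using this
  have hr : ∀ i, (l2sq 1 (g' i)) ^ (1 / 2 : ℝ) ≠ 0 := by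
    intro i h
    rw [ENNReal.rpow_eq_zero_iff] at h
    rcases h with h | h
    · exact hz i h.1
    · norm_num at h
  have hfac : ∀ i : Fin k, ENNReal.ofReal ((N i.succ) ^ (((m : ℝ) + n) / 2 - 1 / (k : ℝ))) ≠ 0 := by
    intro i
    have : 0 < (N i.succ) ^ (((m : ℝ) + n) / 2 - 1 / (k : ℝ)) := Real.rpow_pos_of_pos (hNp _) _
    simpa using this
  refine le_top.trans (le_of_eq ?_)
  symm
  have hir : (l2sq 1 (g' i)) ^ (1 / 2 : ℝ) = ∞ := by rw [hi]; exact ENNReal.top_rpow_of_pos (by norm_num)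
  rcases Fin.eq_zero_or_eq_succ i with rfl | ⟨j, rfl⟩
  · rw [hir, ENNReal.mul_top hQ, ENNReal.top_mul]
    exact Finset.prod_ne_zero_iff.2 fun j _ => mul_ne_zero (hfac j) (hr _)
  · rw [← Finset.mul_prod_erase _ _ (Finset.mem_univ j), hir, ENNReal.mul_top (hfac j), ENNReal.top_mul, ENNReal.mul_top]
    · exact mul_ne_zero hQ (hr _)
    · exact Finset.prod_ne_zero_iff.2 fun j _ => mul_ne_zero (hfac j) (hr _)

end

/-- **Multilinear Strichartz estimate on the waveguide `ℝ^m × 𝕋ⁿ` (local in time).** -/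
theorem multilinear_strichartz_local (m n k : ℕ)
    (hm : 1 ≤ m) (hn : 1 ≤ n) (hk : 1 ≤ k) (hk2 : m + n = 2 → 2 ≤ k) :
    ∃ δ C : ℝ, 0 < δ ∧ 0 < C ∧
    ∀ (N : Fin (k + 1) → ℝ) (g : Fin (k + 1) → (Fin m → ℝ) → (Fin n → ℤ) → ℂ),
      (∀ i, IsDyadic (N i)) → (∀ i, 1 ≤ N i) →
      (∀ i j : Fin (k + 1), i ≤ j → N j ≤ N i) →
      (∀ i, SuppIn 1 (g i) (N i)) →
      (∫⁻ t in Set.Icc (0 : ℝ) 1, ∫⁻ x : Fin m → ℝ, ∫⁻ y in torusBox 1 n,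
          (‖∏ i : Fin (k + 1), waveU 1 (g i) t x y‖₊ : ℝ≥0∞) ^ 2) ^ (1 / 2 : ℝ)
        ≤ ENNReal.ofReal (C * (N (Fin.last k) / N 0 + 1 / N 1) ^ δ)
            * (l2sq 1 (g 0)) ^ (1 / 2 : ℝ)
            * ∏ i : Fin k, (ENNReal.ofReal ((N i.succ) ^ (((m : ℝ) + n) / 2 - 1 / (k : ℝ)))
                * (l2sq 1 (g i.succ)) ^ (1 / 2 : ℝ)) := by
  exact final_aux m n k hm hn hk hk2
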